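/- Joint central limit theorem for the score components: Fix (H,σ) ∈ (0,1)×(0,∞) and any sequence of sampling steps Δ_n > 0. Under P^n_{(H,σ)} (the centered Gaussian measure on ℝ^n with covariance σ²Δ_n^{2H}T_n(H)), the random vector (A_n, B_n) converges in law, as n → ∞, to a centered two-dimensional Gaussian distribution with covariance matrix J(H) = [[2, j_H], [j_H, e_H]]. -/

import Mathlib

open MeasureTheory Filter Topology Matrix

noncomputable section

/-- Covariance matrix `T_n(H)` of a standard fractional Gaussian noise: its `(i,j)` entry is
`(|i-j+1|^{2H} - 2|i-j|^{2H} + |i-j-1|^{2H})/2`. -/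
def fgnT (n : ℕ) (H : ℝ) : Matrix (Fin n) (Fin n) ℝ := fun i j =>
  (|((i : ℕ) : ℝ) - ((j : ℕ) : ℝ) + 1| ^ (2 * H)
      - 2 * |((i : ℕ) : ℝ) - ((j : ℕ) : ℝ)| ^ (2 * H)
      + |((i : ℕ) : ℝ) - ((j : ℕ) : ℝ) - 1| ^ (2 * H)) / 2

/-- Quadratic form `⟨x, M x⟩`. -/
def qForm {n : ℕ} (M : Matrix (Fin n) (Fin n) ℝ) (x : Fin n → ℝ) : ℝ :=
  ∑ i, ∑ j, x i * M i j * x j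

/-- Centered Gaussian measure on `ℝⁿ` with nondegenerate covariance matrix `S`, given by its
density with respect to Lebesgue measure. -/
def gaussianPi (n : ℕ) (S : Matrix (Fin n) (Fin n) ℝ) : Measure (Fin n → ℝ) :=
  volume.withDensity fun x => ENNReal.ofReal
    ((2 * Real.pi) ^ (-(n : ℝ) / 2) * S.det ^ (-(1 : ℝ) / 2) *
      Real.exp (-(qForm S⁻¹ x) / 2))

/-- The law `Pⁿ_{(H,σ)}` of fractional Gaussian noise observed with time step `Δ`:
a centered Gaussian measure on `ℝⁿ` with covariance `σ² Δ^{2H} T_n(H)`. -/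
def fgnP (n : ℕ) (Δ H σ : ℝ) : Measure (Fin n → ℝ) :=
  gaussianPi n ((σ ^ 2 * Δ ^ (2 * H)) • fgnT n H)

/-- Spectral density `f_H` of the increments of fractional Brownian motion. -/
def fgnSpec (H l : ℝ) : ℝ :=
  (Real.Gamma (2 * H + 1) * Real.sin (Real.pi * H) / (2 * Real.pi)) *
    (2 * (1 - Real.cos l)) * ∑' k : ℤ, |l + 2 * (k : ℝ) * Real.pi| ^ (-2 * H - 1)

/-- `∂_H log f_H(λ)`. -/
def dlogSpec (H l : ℝ) : ℝ := deriv (fun h : ℝ => Real.log (fgnSpec h l)) H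

/-- `j_H = -(1/(2π)) ∫_{-π}^{π} ∂_H log f_H(λ) dλ`. -/
def jH (H : ℝ) : ℝ := -(1 / (2 * Real.pi)) * ∫ l in (-Real.pi)..Real.pi, dlogSpec H l

/-- `e_H = (1/(4π)) ∫_{-π}^{π} |∂_H log f_H(λ)|² dλ`. -/
def eH (H : ℝ) : ℝ := (1 / (4 * Real.pi)) * ∫ l in (-Real.pi)..Real.pi, (dlogSpec H l) ^ 2

/-- The limit covariance matrix `J(H)` of `(A_n, B_n)`. -/
def Jmat (H : ℝ) : Matrix (Fin 2) (Fin 2) ℝ := !![2, jH H; jH H, eH H]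

/-- Log-likelihood `ℓ_n(H,σ)` of the fGn sample. -/
def loglik (n : ℕ) (Δ H σ : ℝ) (x : Fin n → ℝ) : ℝ :=
  -(n : ℝ) / 2 * Real.log (2 * Real.pi) - (n : ℝ) * H * Real.log Δ - (n : ℝ) * Real.log σ
    - Real.log (fgnT n H).det / 2
    - qForm (fgnT n H)⁻¹ x / (2 * σ ^ 2 * Δ ^ (2 * H))

/-- `C_n = (1/(nσ²Δ^{2H})) ⟨x, T_n(H)⁻¹ x⟩`. -/
def Cstat (n : ℕ) (Δ H σ : ℝ) (x : Fin n → ℝ) : ℝ :=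
  qForm (fgnT n H)⁻¹ x / ((n : ℝ) * σ ^ 2 * Δ ^ (2 * H))

/-- `A_n = √n (C_n - 1)`. -/
def Astat (n : ℕ) (Δ H σ : ℝ) (x : Fin n → ℝ) : ℝ :=
  Real.sqrt n * (Cstat n Δ H σ x - 1)

/-- Entrywise derivative in `H` of `T_n(H)⁻¹`. -/
def dInvT (n : ℕ) (H : ℝ) : Matrix (Fin n) (Fin n) ℝ := fun i j =>
  deriv (fun h : ℝ => (fgnT n h)⁻¹ i j) H

/-- Entrywise second derivative in `H` of `T_n(H)⁻¹`. -/
def d2InvT (n : ℕ) (H : ℝ) : Matrix (Fin n) (Fin n) ℝ := fun i j =>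
  deriv (fun h : ℝ => deriv (fun h' : ℝ => (fgnT n h')⁻¹ i j) h) H

/-- Entrywise derivative in `H` of `T_n(H)`. -/
def dT (n : ℕ) (H : ℝ) : Matrix (Fin n) (Fin n) ℝ := fun i j =>
  deriv (fun h : ℝ => fgnT n h i j) H

/-- `B_n = (1/√n) ( (1/2) ∂_H log det T_n(H) + (1/(2σ²Δ^{2H})) ⟨x, ∂_H(T_n(H)⁻¹) x⟩ )`. -/
def Bstat (n : ℕ) (Δ H σ : ℝ) (x : Fin n → ℝ) : ℝ :=
  (1 / Real.sqrt n) *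
    (deriv (fun h : ℝ => Real.log (fgnT n h).det) H / 2
      + qForm (dInvT n H) x / (2 * σ ^ 2 * Δ ^ (2 * H)))

/-- `D_n = (1/(nσ²Δ^{2H})) ⟨x, ∂_H(T_n(H)⁻¹) x⟩`. -/
def Dstat (n : ℕ) (Δ H σ : ℝ) (x : Fin n → ℝ) : ℝ :=
  qForm (dInvT n H) x / ((n : ℝ) * σ ^ 2 * Δ ^ (2 * H))

/-- `E_n = (1/n) ( (1/2) ∂_H² log det T_n(H) + (1/(2σ²Δ^{2H})) ⟨x, ∂_H²(T_n(H)⁻¹) x⟩ )`. -/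
def Estat (n : ℕ) (Δ H σ : ℝ) (x : Fin n → ℝ) : ℝ :=
  (1 / (n : ℝ)) *
    (deriv (fun h : ℝ => deriv (fun h' : ℝ => Real.log (fgnT n h').det) h) H / 2
      + qForm (d2InvT n H) x / (2 * σ ^ 2 * Δ ^ (2 * H)))

/-- Convergence in law (weak convergence of the laws against bounded continuous functions). -/
def TendstoInLaw {E : Type*} [MeasurableSpace E] [TopologicalSpace E]
    (μ : ℕ → Measure E) (ν : Measure E) : Prop :=
  ∀ g : BoundedContinuousFunction E ℝ,
    Tendsto (fun n => ∫ x, g x ∂μ n) atTop (𝓝 (∫ x, g x ∂ν))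

/-- Convergence in law to the centered Gaussian distribution on `ℝᵈ` with covariance matrix `S`,
expressed through the Cramér–Wold device: every linear functional converges in law to the
corresponding one-dimensional centered Gaussian law. -/
def TendstoInLawGaussian {d : ℕ} (μ : ℕ → Measure (Fin d → ℝ))
    (S : Matrix (Fin d) (Fin d) ℝ) : Prop :=
  ∀ t : Fin d → ℝ,
    TendstoInLaw (fun n => (μ n).map fun z => ∑ i, t i * z i)
      (ProbabilityTheory.gaussianReal 0 (qForm S t).toNNReal)

/-- Convergence in probability to a constant, for statistics defined on varying sample spaces. -/
def TendstoInProb {X : ℕ → Type*} [∀ n, MeasurableSpace (X n)]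
    (μ : ∀ n, Measure (X n)) (f : ∀ n, X n → ℝ) (c : ℝ) : Prop :=
  ∀ ε > 0, Tendsto (fun n => μ n {x | ε ≤ |f n x - c|}) atTop (𝓝 0)

/-- The LAN expansion: the likelihood ratio of `P^n_{θ₀ + φ_n u}` with respect to `P^n_{θ₀}`
is `exp(⟨u, ζ_n⟩ - ½⟨I u, u⟩ + r_n(u))` with `ζ_n → N(0, I)` in law and `r_n(u) → 0` in
probability under `P^n_{θ₀}`. -/
def LANExpansion {X : ℕ → Type*} [∀ n, MeasurableSpace (X n)] {d : ℕ}
    (P : (n : ℕ) → (Fin d → ℝ) → Measure (X n)) (θ₀ : Fin d → ℝ)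
    (φ : ℕ → Matrix (Fin d) (Fin d) ℝ) (I : Matrix (Fin d) (Fin d) ℝ) : Prop :=
  ∃ (ζ : (n : ℕ) → X n → Fin d → ℝ) (r : (n : ℕ) → (Fin d → ℝ) → X n → ℝ),
    (∀ n, Measurable (ζ n)) ∧
    TendstoInLawGaussian (fun n => (P n θ₀).map (ζ n)) I ∧
    ∀ u : Fin d → ℝ,
      (∀ᶠ n in atTop,
        P n (θ₀ + (φ n).mulVec u) = (P n θ₀).withDensity fun x =>
          ENNReal.ofReal (Real.exp (∑ i, u i * ζ n x i - qForm I u / 2 + r n u x))) ∧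
      TendstoInProb (fun n => P n θ₀) (fun n => r n u) 0

/-- Local Asymptotic Normality at `θ₀` with nondegenerate rate matrices `φ_n`
and nondegenerate Fisher information matrix `I`. -/
def IsLAN {X : ℕ → Type*} [∀ n, MeasurableSpace (X n)] {d : ℕ}
    (P : (n : ℕ) → (Fin d → ℝ) → Measure (X n)) (θ₀ : Fin d → ℝ)
    (φ : ℕ → Matrix (Fin d) (Fin d) ℝ) (I : Matrix (Fin d) (Fin d) ℝ) : Prop :=
  (∀ᶠ n in atTop, (φ n).det ≠ 0) ∧ I.det ≠ 0 ∧ LANExpansion P θ₀ φ I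

/-- Lebesgue measure on `(0, π]`. -/
def halfCircle : Measure ℝ := volume.restrict (Set.Ioc 0 Real.pi)

instance : IsFiniteMeasure halfCircle := by
  unfold halfCircle; infer_instance

lemma ae_halfCircle_mem : ∀ᵐ l ∂halfCircle, l ∈ Set.Ioc 0 Real.pi :=
  ae_restrict_mem measurableSet_Ioc

/-- Symmetric Toeplitz matrix of the cosine coefficients of a symbol on `(0, π]`. -/
def toep (n : ℕ) (u : ℝ → ℝ) : Matrix (Fin n) (Fin n) ℝ := fun i j =>
  ∫ l, Real.cos ((((i : ℕ) : ℝ) - ((j : ℕ) : ℝ)) * l) * u l ∂halfCircle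

/-- The vector `(cos (i l))_i`. -/
def cosVec (n : ℕ) (l : ℝ) : Fin n → ℝ := fun i => Real.cos (((i : ℕ) : ℝ) * l)

/-- The vector `(sin (i l))_i`. -/
def sinVec (n : ℕ) (l : ℝ) : Fin n → ℝ := fun i => Real.sin (((i : ℕ) : ℝ) * l)

lemma cos_sub_mul_eq {n : ℕ} (i j : Fin n) (l : ℝ) :
    Real.cos ((((i : ℕ) : ℝ) - ((j : ℕ) : ℝ)) * l)
      = cosVec n l i * cosVec n l j + sinVec n l i * sinVec n l j := by
  rw [sub_mul, Real.cos_sub]; rfl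

lemma integrable_cos_mul {u : ℝ → ℝ} (hu : Integrable u halfCircle) (a : ℝ) :
    Integrable (fun l => Real.cos (a * l) * u l) halfCircle := by
  refine hu.bdd_mul (c := 1) (by fun_prop) (Eventually.of_forall fun l => ?_)
  simpa using Real.abs_cos_le_one _

lemma toep_transpose (n : ℕ) (u : ℝ → ℝ) : (toep n u)ᵀ = toep n u := by
  ext i j
  simp only [Matrix.transpose_apply, toep]
  congr 1; ext l
  rw [← Real.cos_neg]; ring_nf

lemma toep_add (n : ℕ) {u v : ℝ → ℝ} (hu : Integrable u halfCircle)
    (hv : Integrable v halfCircle) :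
    toep n (fun l => u l + v l) = toep n u + toep n v := by
  ext i j
  simp only [toep, Matrix.add_apply, mul_add]
  exact integral_add (integrable_cos_mul hu _) (integrable_cos_mul hv _)

lemma toep_const_mul (n : ℕ) (c : ℝ) (u : ℝ → ℝ) :
    toep n (fun l => c * u l) = c • toep n u := by
  ext i j
  simp only [toep, Matrix.smul_apply, smul_eq_mul]
  rw [← integral_const_mul]
  congr 1; ext l; ring

lemma toep_congr (n : ℕ) {u v : ℝ → ℝ} (h : u =ᵐ[halfCircle] v) : toep n u = toep n v := by
  ext i j
  refine integral_congr_ae ?_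
  filter_upwards [h] with l hl
  rw [hl]

lemma integral_cos_int_mul (k : ℤ) :
    ∫ l, Real.cos ((k : ℝ) * l) ∂halfCircle = if k = 0 then Real.pi else 0 := by
  unfold halfCircle
  rw [← intervalIntegral.integral_of_le Real.pi_pos.le]
  split_ifs with h
  · simp [h]
  · have hk : (k : ℝ) ≠ 0 := by exact_mod_cast h
    rw [intervalIntegral.integral_comp_mul_left (fun x => Real.cos x) hk]
    simp [Real.sin_int_mul_pi]

lemma toep_one (n : ℕ) : toep n (fun _ => 1) = Real.pi • (1 : Matrix (Fin n) (Fin n) ℝ) := by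
  ext i j
  have := integral_cos_int_mul (((i : ℕ) : ℤ) - ((j : ℕ) : ℤ))
  push_cast at this
  simp only [toep, mul_one, this, Matrix.smul_apply, smul_eq_mul, Matrix.one_apply]
  by_cases h : i = j
  · simp [h]
  · have : ¬ (((i : ℕ) : ℤ) - ((j : ℕ) : ℤ) = 0) := by
      intro h'; apply h; ext; omega
    simp [h, this]

lemma dotProduct_toep_mulVec (n : ℕ) {u : ℝ → ℝ} (hu : Integrable u halfCircle)
    (x y : Fin n → ℝ) :
    x ⬝ᵥ toep n u *ᵥ y = ∫ l, u l * ((x ⬝ᵥ cosVec n l) * (y ⬝ᵥ cosVec n l)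
      + (x ⬝ᵥ sinVec n l) * (y ⬝ᵥ sinVec n l)) ∂halfCircle := by
  have : ∀ l, u l * ((x ⬝ᵥ cosVec n l) * (y ⬝ᵥ cosVec n l)
      + (x ⬝ᵥ sinVec n l) * (y ⬝ᵥ sinVec n l))
      = ∑ i, ∑ j, x i * y j *
        (Real.cos ((((i : ℕ) : ℝ) - ((j : ℕ) : ℝ)) * l) * u l) := by
    intro l
    simp only [dotProduct, cos_sub_mul_eq]
    rw [Finset.sum_mul_sum, Finset.sum_mul_sum]
    simp only [← Finset.sum_add_distrib, Finset.mul_sum]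
    refine Finset.sum_congr rfl fun i _ => Finset.sum_congr rfl fun j _ => ?_
    ring
  simp_rw [this]
  rw [integral_finsetSum _ fun i _ => integrable_finsetSum _ fun j _ =>
    (integrable_cos_mul hu _).const_mul _]
  simp_rw [dotProduct, Matrix.mulVec, dotProduct, Finset.mul_sum]
  refine Finset.sum_congr rfl fun i _ => ?_
  rw [integral_finsetSum _ fun j _ => (integrable_cos_mul hu _).const_mul _]
  refine Finset.sum_congr rfl fun j _ => ?_
  rw [integral_const_mul, toep]; ring

lemma abs_dotProduct_cosVec_le {n : ℕ} (x : Fin n → ℝ) (l : ℝ) :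
    |x ⬝ᵥ cosVec n l| ≤ ∑ i, |x i| := by
  refine (Finset.abs_sum_le_sum_abs _ _).trans (Finset.sum_le_sum fun i _ => ?_)
  rw [abs_mul]
  exact mul_le_of_le_one_right (abs_nonneg _) (Real.abs_cos_le_one _)

lemma abs_dotProduct_sinVec_le {n : ℕ} (x : Fin n → ℝ) (l : ℝ) :
    |x ⬝ᵥ sinVec n l| ≤ ∑ i, |x i| := by
  refine (Finset.abs_sum_le_sum_abs _ _).trans (Finset.sum_le_sum fun i _ => ?_)
  rw [abs_mul]
  exact mul_le_of_le_one_right (abs_nonneg _) (Real.abs_sin_le_one _)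

lemma continuous_dotProduct_cosVec {n : ℕ} (x : Fin n → ℝ) :
    Continuous fun l => x ⬝ᵥ cosVec n l := by
  simp only [dotProduct, cosVec]; fun_prop

lemma continuous_dotProduct_sinVec {n : ℕ} (x : Fin n → ℝ) :
    Continuous fun l => x ⬝ᵥ sinVec n l := by
  simp only [dotProduct, sinVec]; fun_prop

lemma integrable_mul_trig {n : ℕ} {u : ℝ → ℝ} (hu : Integrable u halfCircle)
    (x y : Fin n → ℝ) :
    Integrable (fun l => u l * ((x ⬝ᵥ cosVec n l) * (y ⬝ᵥ cosVec n l)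
      + (x ⬝ᵥ sinVec n l) * (y ⬝ᵥ sinVec n l))) halfCircle := by
  have hc := continuous_dotProduct_cosVec x
  have hs := continuous_dotProduct_sinVec x
  have hc' := continuous_dotProduct_cosVec y
  have hs' := continuous_dotProduct_sinVec y
  refine hu.mul_bdd (c := (∑ i, |x i|) * (∑ i, |y i|) + (∑ i, |x i|) * (∑ i, |y i|))
    (by fun_prop) (Eventually.of_forall fun l => ?_)
  rw [Real.norm_eq_abs]
  refine (abs_add_le _ _).trans (add_le_add ?_ ?_) <;> rw [abs_mul]
  · exact mul_le_mul (abs_dotProduct_cosVec_le x l) (abs_dotProduct_cosVec_le y l)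
      (abs_nonneg _) (Finset.sum_nonneg fun i _ => abs_nonneg _)
  · exact mul_le_mul (abs_dotProduct_sinVec_le x l) (abs_dotProduct_sinVec_le y l)
      (abs_nonneg _) (Finset.sum_nonneg fun i _ => abs_nonneg _)

lemma toep_form_nonneg (n : ℕ) {u : ℝ → ℝ} (hu : Integrable u halfCircle)
    (hu0 : ∀ᵐ l ∂halfCircle, 0 ≤ u l) (x : Fin n → ℝ) : 0 ≤ x ⬝ᵥ toep n u *ᵥ x := by
  rw [dotProduct_toep_mulVec n hu]
  refine integral_nonneg_of_ae ?_
  filter_upwards [hu0] with l hl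
  exact mul_nonneg hl (add_nonneg (mul_self_nonneg _) (mul_self_nonneg _))

/-- Cauchy–Schwarz inequality for Toeplitz forms. -/
lemma toep_cauchy_schwarz (n : ℕ) {u v w : ℝ → ℝ} (hu : Integrable u halfCircle)
    (hv : Integrable v halfCircle) (hw : Integrable w halfCircle)
    (hu0 : ∀ᵐ l ∂halfCircle, 0 ≤ u l) (hv0 : ∀ᵐ l ∂halfCircle, 0 ≤ v l)
    (h : ∀ᵐ l ∂halfCircle, w l ^ 2 ≤ u l * v l) (x y : Fin n → ℝ) :
    (x ⬝ᵥ toep n w *ᵥ y) ^ 2 ≤ (x ⬝ᵥ toep n u *ᵥ x) * (y ⬝ᵥ toep n v *ᵥ y) := by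
  have key : ∀ s : ℝ, 0 ≤ (x ⬝ᵥ toep n u *ᵥ x) * (s * s) + (2 * (x ⬝ᵥ toep n w *ᵥ y)) * s
      + (y ⬝ᵥ toep n v *ᵥ y) := by
    intro s
    rw [dotProduct_toep_mulVec n hu, dotProduct_toep_mulVec n hv, dotProduct_toep_mulVec n hw,
      ← integral_mul_const, ← integral_const_mul, ← integral_mul_const, ← integral_add,
      ← integral_add]
    · refine integral_nonneg_of_ae ?_
      filter_upwards [hu0, hv0, h] with l h1 h2 h3
      simp only [Pi.zero_apply]
      have aux : ∀ a b : ℝ, 0 ≤ u l * (a * a) * (s * s) + 2 * (w l * (a * b)) * s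
          + v l * (b * b) := by
        intro a b
        have hd := discrim (u l) (2 * w l) (v l)
        rcases h1.eq_or_lt with h0 | h0
        · have hw0 : w l = 0 := by
            rw [← h0, zero_mul] at h3
            exact pow_eq_zero_iff (two_ne_zero) |>.1 (le_antisymm h3 (sq_nonneg _))
          rw [hw0]
          nlinarith [mul_nonneg h2 (mul_self_nonneg b), mul_nonneg h1 (mul_self_nonneg (a * s))]
        · have : 0 ≤ u l * (u l * (a * a) * (s * s) + 2 * (w l * (a * b)) * s
              + v l * (b * b)) := by
            nlinarith [sq_nonneg (u l * (a * s) + w l * b),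
              mul_nonneg (sub_nonneg.2 h3) (sq_nonneg b)]
          exact nonneg_of_mul_nonneg_right this h0
      have h4 := aux (x ⬝ᵥ cosVec n l) (y ⬝ᵥ cosVec n l)
      have h5 := aux (x ⬝ᵥ sinVec n l) (y ⬝ᵥ sinVec n l)
      nlinarith [h4, h5]
    · exact ((integrable_mul_trig hu x x).mul_const _).add
        (((integrable_mul_trig hw x y).const_mul _).mul_const _)
    · exact integrable_mul_trig hv y y
    · exact (integrable_mul_trig hu x x).mul_const _
    · exact ((integrable_mul_trig hw x y).const_mul _).mul_const _
  have := discrim_le_zero key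
  rw [discrim] at this
  nlinarith

/-- The weighted Cauchy–Schwarz inequality for reciprocal symbols. -/
lemma sq_dotProduct_le_toep (n : ℕ) {f : ℝ → ℝ} (hf : Integrable f halfCircle)
    (hfi : Integrable (fun l => (f l)⁻¹) halfCircle) (hf0 : ∀ l ∈ Set.Ioc 0 Real.pi, 0 < f l)
    (x y : Fin n → ℝ) :
    (Real.pi * (x ⬝ᵥ y)) ^ 2 ≤ (x ⬝ᵥ toep n f *ᵥ x) * (y ⬝ᵥ toep n (fun l => (f l)⁻¹) *ᵥ y) := by
  have := toep_cauchy_schwarz n hf hfi (integrable_const (1 : ℝ))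
    (by filter_upwards [ae_halfCircle_mem] with l hl using (hf0 l hl).le)
    (by filter_upwards [ae_halfCircle_mem] with l hl using (inv_pos.2 (hf0 l hl)).le)
    (by filter_upwards [ae_halfCircle_mem] with l hl
        rw [mul_inv_cancel₀ (hf0 l hl).ne', one_pow]) x y
  rwa [toep_one, Matrix.smul_mulVec, Matrix.one_mulVec, dotProduct_smul, smul_eq_mul] at this

lemma toep_posDef (n : ℕ) {f : ℝ → ℝ} (hf : Integrable f halfCircle)
    (hfi : Integrable (fun l => (f l)⁻¹) halfCircle) (hf0 : ∀ l ∈ Set.Ioc 0 Real.pi, 0 < f l) :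
    (toep n f).PosDef := by
  refine PosDef.of_dotProduct_mulVec_pos ?_ fun x hx => ?_
  · rw [Matrix.IsHermitian, conjTranspose_eq_transpose_of_trivial, toep_transpose]
  · have h := sq_dotProduct_le_toep n hf hfi hf0 x x
    have hx2 : 0 < x ⬝ᵥ x := by
      have := dotProduct_star_self_pos_iff.2 hx
      simpa using this
    have h0 := toep_form_nonneg n hf
      (by filter_upwards [ae_halfCircle_mem] with l hl using (hf0 l hl).le) x
    rw [star_trivial]
    rcases h0.eq_or_lt with h1 | h1
    · rw [← h1, zero_mul] at h
      have : 0 < (Real.pi * (x ⬝ᵥ x)) ^ 2 := by have := Real.pi_pos; positivity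
      linarith
    · exact h1

lemma toep_inv_form_le (n : ℕ) {f : ℝ → ℝ} (hf : Integrable f halfCircle)
    (hfi : Integrable (fun l => (f l)⁻¹) halfCircle) (hf0 : ∀ l ∈ Set.Ioc 0 Real.pi, 0 < f l)
    (y : Fin n → ℝ) :
    y ⬝ᵥ (toep n f)⁻¹ *ᵥ y ≤ (Real.pi ^ 2)⁻¹ * (y ⬝ᵥ toep n (fun l => (f l)⁻¹) *ᵥ y) := by
  have hT := toep_posDef n hf hfi hf0
  have hdet : IsUnit (toep n f).det := hT.det_pos.ne'.isUnit
  have h := sq_dotProduct_le_toep n hf hfi hf0 ((toep n f)⁻¹ *ᵥ y) y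
  rw [Matrix.mulVec_mulVec, Matrix.mul_nonsing_inv _ hdet, Matrix.one_mulVec,
    dotProduct_comm] at h
  have hp := Real.pi_pos
  set a := y ⬝ᵥ (toep n f)⁻¹ *ᵥ y with ha
  set b := y ⬝ᵥ toep n (fun l => (f l)⁻¹) *ᵥ y
  have hb : 0 ≤ b := toep_form_nonneg n hfi
      (by filter_upwards [ae_halfCircle_mem] with l hl using (inv_pos.2 (hf0 l hl)).le) y
  rw [inv_mul_eq_div, le_div_iff₀ (by positivity)]
  by_contra! hlt
  have ha0 : 0 < a := by
    have : 0 < a * Real.pi ^ 2 := hb.trans_lt hlt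
    exact pos_of_mul_pos_left this (by positivity)
  nlinarith [mul_lt_mul_of_pos_left hlt ha0]

lemma toep_inv_isSymm (n : ℕ) (f : ℝ → ℝ) : ((toep n f)⁻¹)ᵀ = (toep n f)⁻¹ := by
  rw [Matrix.transpose_nonsing_inv, toep_transpose]

lemma abs_toep_inv_apply_le (n : ℕ) {f : ℝ → ℝ} (hf : Integrable f halfCircle)
    (hfi : Integrable (fun l => (f l)⁻¹) halfCircle) (hf0 : ∀ l ∈ Set.Ioc 0 Real.pi, 0 < f l)
    (i j : Fin n) :
    |(toep n f)⁻¹ i j| ≤ (Real.pi ^ 2)⁻¹ * ∫ l, (f l)⁻¹ ∂halfCircle := by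
  have hT := (toep_posDef n hf hfi hf0).inv
  have hd : ∀ i, (toep n f)⁻¹ i i ≤ (Real.pi ^ 2)⁻¹ * ∫ l, (f l)⁻¹ ∂halfCircle := by
    intro i
    have := toep_inv_form_le n hf hfi hf0 (Pi.single i 1)
    simpa [toep] using this
  have hs : (toep n f)⁻¹ j i = (toep n f)⁻¹ i j := by
    conv_lhs => rw [← toep_inv_isSymm]
    rfl
  have hp := hT.posSemidef.dotProduct_mulVec_nonneg (Pi.single i 1 + Pi.single j 1)
  have hm := hT.posSemidef.dotProduct_mulVec_nonneg (Pi.single i 1 - Pi.single j 1)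
  simp [Matrix.mulVec_add, Matrix.mulVec_sub, add_dotProduct, sub_dotProduct, hs] at hp hm
  rw [abs_le]
  constructor <;> linarith [hd i, hd j]

lemma trace_mul_toep (n : ℕ) (A : Matrix (Fin n) (Fin n) ℝ) {u : ℝ → ℝ}
    (hu : Integrable u halfCircle) :
    (A * toep n u).trace = ∫ l, u l * (cosVec n l ⬝ᵥ A *ᵥ cosVec n l
      + sinVec n l ⬝ᵥ A *ᵥ sinVec n l) ∂halfCircle := by
  have : ∀ l, u l * (cosVec n l ⬝ᵥ A *ᵥ cosVec n l + sinVec n l ⬝ᵥ A *ᵥ sinVec n l)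
      = ∑ i, ∑ j, A i j * (Real.cos ((((j : ℕ) : ℝ) - ((i : ℕ) : ℝ)) * l) * u l) := by
    intro l
    simp only [dotProduct, Matrix.mulVec, cos_sub_mul_eq, ← Finset.sum_add_distrib,
      Finset.mul_sum]
    refine Finset.sum_congr rfl fun i _ => Finset.sum_congr rfl fun j _ => ?_
    ring
  simp_rw [this]
  refine Eq.symm ((integral_finsetSum _ fun i _ => integrable_finsetSum _ fun j _ =>
    (integrable_cos_mul hu _).const_mul _).trans ?_)
  simp_rw [Matrix.trace, Matrix.diag, Matrix.mul_apply]
  refine Finset.sum_congr rfl fun i _ => ?_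
  refine (integral_finsetSum _ fun j _ => (integrable_cos_mul hu _).const_mul _).trans ?_
  refine Finset.sum_congr rfl fun j _ => ?_
  rw [integral_const_mul, toep]

lemma integrable_mul_quad {n : ℕ} (A : Matrix (Fin n) (Fin n) ℝ) {u : ℝ → ℝ}
    (hu : Integrable u halfCircle) :
    Integrable (fun l => u l * (cosVec n l ⬝ᵥ A *ᵥ cosVec n l
      + sinVec n l ⬝ᵥ A *ᵥ sinVec n l)) halfCircle := by
  have : ∀ l, u l * (cosVec n l ⬝ᵥ A *ᵥ cosVec n l + sinVec n l ⬝ᵥ A *ᵥ sinVec n l)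
      = ∑ i, ∑ j, A i j * (Real.cos ((((j : ℕ) : ℝ) - ((i : ℕ) : ℝ)) * l) * u l) := by
    intro l
    simp only [dotProduct, Matrix.mulVec, cos_sub_mul_eq, ← Finset.sum_add_distrib,
      Finset.mul_sum]
    refine Finset.sum_congr rfl fun i _ => Finset.sum_congr rfl fun j _ => ?_
    ring
  simp_rw [this]
  exact integrable_finsetSum _ fun i _ => integrable_finsetSum _ fun j _ =>
    (integrable_cos_mul hu _).const_mul _

lemma trace_mul_toep_mono (n : ℕ) {A B : Matrix (Fin n) (Fin n) ℝ}
    (h : ∀ y, y ⬝ᵥ A *ᵥ y ≤ y ⬝ᵥ B *ᵥ y) {u : ℝ → ℝ}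
    (hu : Integrable u halfCircle) (hu0 : ∀ᵐ l ∂halfCircle, 0 ≤ u l) :
    (A * toep n u).trace ≤ (B * toep n u).trace := by
  rw [trace_mul_toep n A hu, trace_mul_toep n B hu]
  refine integral_mono_ae (integrable_mul_quad A hu) (integrable_mul_quad B hu) ?_
  filter_upwards [hu0] with l hl
  exact mul_le_mul_of_nonneg_left (add_le_add (h _) (h _)) hl

/-- Trace of a product of Toeplitz matrices bounded through Young's inequality. -/
lemma trace_toep_mul_toep_le (n : ℕ) {p q : ℝ} (hpq : p.HolderConjugate q) {u v : ℝ → ℝ}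
    (hu : Integrable u halfCircle) (hv : Integrable v halfCircle)
    (hu0 : ∀ᵐ l ∂halfCircle, 0 ≤ u l) (hv0 : ∀ᵐ l ∂halfCircle, 0 ≤ v l)
    (hup : Integrable (fun l => u l ^ p) halfCircle)
    (hvq : Integrable (fun l => v l ^ q) halfCircle) :
    (toep n v * toep n u).trace ≤ n * Real.pi *
      ((∫ l, u l ^ p ∂halfCircle) / p + (∫ l, v l ^ q ∂halfCircle) / q) := by
  set c1 : ℝ → ℝ := fun l => u l ^ p / p
  have hc1 : Integrable c1 halfCircle := hup.div_const p
  have hdiag : ∀ m, cosVec n m ⬝ᵥ cosVec n m + sinVec n m ⬝ᵥ sinVec n m = n := by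
    intro m
    simp only [dotProduct, ← Finset.sum_add_distrib, cosVec, sinVec, ← pow_two]
    simp
  have hmain : ∀ᵐ m ∂halfCircle, v m * (cosVec n m ⬝ᵥ toep n u *ᵥ cosVec n m
      + sinVec n m ⬝ᵥ toep n u *ᵥ sinVec n m) ≤
      (cosVec n m ⬝ᵥ toep n c1 *ᵥ cosVec n m + sinVec n m ⬝ᵥ toep n c1 *ᵥ sinVec n m)
      + v m ^ q / q * (n * Real.pi) := by
    filter_upwards [hv0] with m hm
    have h1 : v m ^ q / q * (n * Real.pi) =
        cosVec n m ⬝ᵥ toep n (fun _ => v m ^ q / q * 1) *ᵥ cosVec n m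
          + sinVec n m ⬝ᵥ toep n (fun _ => v m ^ q / q * 1) *ᵥ sinVec n m := by
      rw [toep_const_mul, toep_one]
      simp only [Matrix.smul_mulVec, Matrix.one_mulVec, dotProduct_smul, smul_eq_mul]
      rw [← hdiag m]; ring
    have h2 : ∀ x, x ⬝ᵥ toep n (fun l => v m * u l) *ᵥ x = v m * (x ⬝ᵥ toep n u *ᵥ x) := by
      intro x
      rw [toep_const_mul, Matrix.smul_mulVec, dotProduct_smul, smul_eq_mul]
    have h3 : ∀ x, x ⬝ᵥ toep n (fun l => v m * u l) *ᵥ x ≤ x ⬝ᵥ toep n c1 *ᵥ x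
        + x ⬝ᵥ toep n (fun _ => v m ^ q / q * 1) *ᵥ x := by
      intro x
      rw [← dotProduct_add, ← Matrix.add_mulVec, ← toep_add n hc1 (integrable_const _),
        ← sub_nonneg, ← dotProduct_sub, ← Matrix.sub_mulVec]
      have hcc : Integrable (fun l => c1 l + v m ^ q / q * 1) halfCircle :=
        hc1.add (integrable_const _)
      have : toep n (fun l => c1 l + v m ^ q / q * 1) - toep n (fun l => v m * u l)
          = toep n (fun l => (c1 l + v m ^ q / q * 1) + (-1) * (v m * u l)) := by
        rw [toep_add n hcc ((hu.const_mul _).const_mul _), toep_const_mul n (-1)]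
        simp [sub_eq_add_neg]
      rw [this]
      refine toep_form_nonneg n (u := fun l => (c1 l + v m ^ q / q * 1) + (-1) * (v m * u l))
        (hcc.add ((hu.const_mul _).const_mul _)) ?_ x
      filter_upwards [hu0] with l hl
      have := Real.young_inequality_of_nonneg hl hm hpq
      simp only [c1]; linarith
    rw [h1, mul_add, ← h2, ← h2]
    linarith [h3 (cosVec n m), h3 (sinVec n m)]
  rw [Matrix.trace_mul_comm, trace_mul_toep n _ hv]
  have hI1 : Integrable (fun m => (cosVec n m ⬝ᵥ toep n c1 *ᵥ cosVec n m
      + sinVec n m ⬝ᵥ toep n c1 *ᵥ sinVec n m)) halfCircle := by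
    simpa using integrable_mul_quad (toep n c1) (integrable_const (1 : ℝ))
  have hI2 : Integrable (fun m => v m ^ q / q * (n * Real.pi)) halfCircle :=
    (hvq.div_const q).mul_const _
  refine (integral_mono_ae (integrable_mul_quad _ hv) (hI1.add hI2) hmain).trans (le_of_eq ?_)
  have e1 : ∫ m, (cosVec n m ⬝ᵥ toep n c1 *ᵥ cosVec n m
      + sinVec n m ⬝ᵥ toep n c1 *ᵥ sinVec n m) ∂halfCircle
      = n * Real.pi * ((∫ l, u l ^ p ∂halfCircle) / p) := by
    have := trace_mul_toep n (toep n c1) (integrable_const (1 : ℝ))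
    simp only [one_mul] at this
    rw [← this, toep_one, Matrix.mul_smul, Matrix.mul_one, Matrix.trace_smul]
    simp [Matrix.trace, toep, c1, integral_div]
    ring
  simp only [Pi.add_apply]
  rw [integral_add hI1 hI2, e1, integral_mul_const, integral_div]
  ring

lemma exists_simultaneous_diagonalization {n : ℕ} {T D : Matrix (Fin n) (Fin n) ℝ}
    (hT : T.PosDef) (hD : Dᵀ = D) :
    ∃ (G : Matrix (Fin n) (Fin n) ℝ) (m : Fin n → ℝ),
      Gᵀ * T * G = 1 ∧ Gᵀ * D * G = Matrix.diagonal m := by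
  have spec : ∀ {A : Matrix (Fin n) (Fin n) ℝ} (hA : A.IsHermitian),
      ∃ U : Matrix (Fin n) (Fin n) ℝ, Uᵀ * U = 1 ∧ Uᵀ * A * U = Matrix.diagonal hA.eigenvalues := by
    intro A hA
    refine ⟨hA.eigenvectorUnitary, ?_, ?_⟩
    · have := Unitary.coe_star_mul_self hA.eigenvectorUnitary
      rwa [star_eq_conjTranspose, conjTranspose_eq_transpose_of_trivial] at this
    · have h1 := Unitary.coe_star_mul_self hA.eigenvectorUnitary
      rw [star_eq_conjTranspose, conjTranspose_eq_transpose_of_trivial] at h1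
      have h2 := hA.spectral_theorem
      rw [Unitary.conjStarAlgAut_apply, star_eq_conjTranspose,
        conjTranspose_eq_transpose_of_trivial] at h2
      set U : Matrix (Fin n) (Fin n) ℝ := (hA.eigenvectorUnitary : Matrix (Fin n) (Fin n) ℝ)
      calc Uᵀ * A * U = Uᵀ * (U * Matrix.diagonal hA.eigenvalues * Uᵀ) * U :=
            congrArg (fun M => Uᵀ * M * U) h2
        _ = (Uᵀ * U) * Matrix.diagonal hA.eigenvalues * (Uᵀ * U) := by
            simp only [Matrix.mul_assoc]
        _ = _ := by rw [h1, Matrix.one_mul, Matrix.mul_one]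
  obtain ⟨U, hU, hUT⟩ := spec hT.isHermitian
  set d := hT.isHermitian.eigenvalues
  have hd : ∀ i, 0 < d i := hT.eigenvalues_pos
  set R : Matrix (Fin n) (Fin n) ℝ := Matrix.diagonal fun i => (Real.sqrt (d i))⁻¹ with hR
  have hRt : Rᵀ = R := Matrix.diagonal_transpose _
  have hRR : R * Matrix.diagonal d * R = 1 := by
    rw [hR, Matrix.diagonal_mul_diagonal, Matrix.diagonal_mul_diagonal, ← Matrix.diagonal_one]
    congr 1; ext i
    have := Real.mul_self_sqrt (hd i).le
    have h0 : Real.sqrt (d i) ≠ 0 := (Real.sqrt_pos.2 (hd i)).ne'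
    field_simp
    rw [pow_two, this]
  have hX : ((U * R)ᵀ * D * (U * R)).IsHermitian := by
    rw [Matrix.IsHermitian, conjTranspose_eq_transpose_of_trivial]
    simp only [Matrix.transpose_mul, Matrix.transpose_transpose, hD, Matrix.mul_assoc]
  obtain ⟨V, hV, hVD⟩ := spec hX
  refine ⟨U * R * V, hX.eigenvalues, ?_, ?_⟩
  · have : (U * R * V)ᵀ * T * (U * R * V) = Vᵀ * (R * (Uᵀ * T * U) * R) * V := by
      simp only [Matrix.transpose_mul, hRt, Matrix.mul_assoc]
    rw [this, hUT, hRR, Matrix.mul_one, hV]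
  · rw [← hVD]
    simp only [Matrix.transpose_mul, Matrix.mul_assoc]

section Diagonalization

variable {n : ℕ} {T G : Matrix (Fin n) (Fin n) ℝ}

lemma inv_eq_mul_transpose_of_congr_one (hG : Gᵀ * T * G = 1) : T⁻¹ = G * Gᵀ := by
  have h1 : G * (Gᵀ * T) = 1 := mul_eq_one_comm.1 hG
  refine Matrix.inv_eq_left_inv ?_
  rw [Matrix.mul_assoc, h1]

lemma trace_inv_mul_eq (hG : Gᵀ * T * G = 1) (X : Matrix (Fin n) (Fin n) ℝ) :
    (T⁻¹ * X).trace = (Gᵀ * X * G).trace := by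
  rw [inv_eq_mul_transpose_of_congr_one hG, Matrix.mul_assoc, Matrix.trace_mul_comm]

lemma congr_apply (X : Matrix (Fin n) (Fin n) ℝ) (k l : Fin n) :
    (Gᵀ * X * G) k l = (G.col k) ⬝ᵥ X *ᵥ (G.col l) := by
  rw [Matrix.mul_assoc, Matrix.mul_apply]
  simp [dotProduct, Matrix.mulVec, Matrix.mul_apply]

lemma trace_inv_mul_inv_mul (hG : Gᵀ * T * G = 1) (X Y : Matrix (Fin n) (Fin n) ℝ) :
    (T⁻¹ * X * T⁻¹ * Yᵀ).trace = ∑ k, ∑ l, (Gᵀ * X * G) k l * (Gᵀ * Y * G) k l := by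
  have h : (T⁻¹ * X * T⁻¹ * Yᵀ).trace = ((Gᵀ * X * G) * (Gᵀ * Y * G)ᵀ).trace := by
    rw [inv_eq_mul_transpose_of_congr_one hG]
    simp only [Matrix.transpose_mul, Matrix.transpose_transpose, Matrix.mul_assoc]
    rw [Matrix.trace_mul_comm]
    simp only [Matrix.mul_assoc]
  rw [h]
  generalize Gᵀ * X * G = P
  generalize Gᵀ * Y * G = Q
  simp [Matrix.trace, Matrix.mul_apply]

lemma trace_inv_form_lower (hG : Gᵀ * T * G = 1) (X Y : Matrix (Fin n) (Fin n) ℝ) :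
    2 * (T⁻¹ * X * T⁻¹ * Yᵀ).trace - (T⁻¹ * Y * T⁻¹ * Yᵀ).trace
      ≤ (T⁻¹ * X * T⁻¹ * Xᵀ).trace := by
  rw [trace_inv_mul_inv_mul hG, trace_inv_mul_inv_mul hG, trace_inv_mul_inv_mul hG,
    Finset.mul_sum, ← Finset.sum_sub_distrib]
  refine Finset.sum_le_sum fun k _ => ?_
  rw [Finset.mul_sum, ← Finset.sum_sub_distrib]
  refine Finset.sum_le_sum fun l _ => ?_
  nlinarith [sq_nonneg ((Gᵀ * X * G) k l - (Gᵀ * Y * G) k l)]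

end Diagonalization

/-- Sum of the absolute values of the entries. -/
def absSum {n : ℕ} (E : Matrix (Fin n) (Fin n) ℝ) : ℝ := ∑ i, ∑ j, |E i j|

lemma absSum_nonneg {n : ℕ} (E : Matrix (Fin n) (Fin n) ℝ) : 0 ≤ absSum E :=
  Finset.sum_nonneg fun _ _ => Finset.sum_nonneg fun _ _ => abs_nonneg _

lemma absSum_add_le {n : ℕ} (E F : Matrix (Fin n) (Fin n) ℝ) :
    absSum (E + F) ≤ absSum E + absSum F := by
  simp only [absSum, ← Finset.sum_add_distrib]
  exact Finset.sum_le_sum fun i _ => Finset.sum_le_sum fun j _ => abs_add_le _ _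

lemma absSum_transpose {n : ℕ} (E : Matrix (Fin n) (Fin n) ℝ) : absSum Eᵀ = absSum E := by
  rw [absSum, Finset.sum_comm]; rfl

lemma absSum_mul_le {n : ℕ} {K E : Matrix (Fin n) (Fin n) ℝ} {C : ℝ}
    (hK : ∀ j, ∑ i, |K i j| ≤ C) : absSum (K * E) ≤ C * absSum E := by
  calc absSum (K * E) ≤ ∑ i, ∑ j, ∑ k, |K i k| * |E k j| := by
        refine Finset.sum_le_sum fun i _ => Finset.sum_le_sum fun j _ => ?_
        rw [Matrix.mul_apply]
        refine (Finset.abs_sum_le_sum_abs _ _).trans (le_of_eq ?_)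
        exact Finset.sum_congr rfl fun k _ => abs_mul _ _
    _ = ∑ k, (∑ i, |K i k|) * ∑ j, |E k j| := by
        simp_rw [Finset.sum_mul_sum]
        rw [Finset.sum_congr rfl fun i _ => Finset.sum_comm, Finset.sum_comm]
    _ ≤ ∑ k, C * ∑ j, |E k j| := by
        refine Finset.sum_le_sum fun k _ => mul_le_mul_of_nonneg_right (hK k) ?_
        exact Finset.sum_nonneg fun _ _ => abs_nonneg _
    _ = C * absSum E := by rw [absSum, Finset.mul_sum]

lemma abs_trace_mul_le {n : ℕ} {A E : Matrix (Fin n) (Fin n) ℝ} {C : ℝ}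
    (hA : ∀ i j, |A i j| ≤ C) : |(A * E).trace| ≤ C * absSum E := by
  rw [Matrix.trace_mul_comm]
  simp only [Matrix.trace, Matrix.diag, Matrix.mul_apply, absSum, Finset.mul_sum]
  refine (Finset.abs_sum_le_sum_abs _ _).trans (Finset.sum_le_sum fun i _ => ?_)
  refine (Finset.abs_sum_le_sum_abs _ _).trans (Finset.sum_le_sum fun j _ => ?_)
  rw [abs_mul, mul_comm]
  exact mul_le_mul_of_nonneg_right (hA _ _) (abs_nonneg _)

/-- A sequence of matrices whose entries sum to `o(n)` in absolute value. -/
def Negl (E : ∀ n : ℕ, Matrix (Fin n) (Fin n) ℝ) : Prop :=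
  Tendsto (fun n : ℕ => absSum (E n) / n) atTop (𝓝 0)

lemma Negl.of_le {E : ∀ n : ℕ, Matrix (Fin n) (Fin n) ℝ} {b : ℕ → ℝ}
    (hb : Tendsto (fun n : ℕ => b n / n) atTop (𝓝 0)) (h : ∀ n, absSum (E n) ≤ b n) :
    Negl E :=
  squeeze_zero (fun n => div_nonneg (absSum_nonneg _) n.cast_nonneg)
    (fun n => div_le_div_of_nonneg_right (h n) n.cast_nonneg) hb

lemma Negl.of_eq' {E F : ∀ n : ℕ, Matrix (Fin n) (Fin n) ℝ} (hE : Negl E)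
    (h : ∀ n, F n = E n) : Negl F := by
  rwa [show F = E from funext h]

lemma Negl.add {E F : ∀ n : ℕ, Matrix (Fin n) (Fin n) ℝ} (hE : Negl E) (hF : Negl F) :
    Negl fun n => E n + F n := by
  refine Negl.of_le (b := fun n => absSum (E n) + absSum (F n)) ?_ fun n => absSum_add_le _ _
  simpa [add_div] using Tendsto.add hE hF

lemma Negl.mul_left {E K : ∀ n : ℕ, Matrix (Fin n) (Fin n) ℝ} {C : ℝ} (hE : Negl E)
    (hK : ∀ n j, ∑ i, |K n i j| ≤ C) : Negl fun n => K n * E n := by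
  refine Negl.of_le (b := fun n => C * absSum (E n)) ?_ fun n => absSum_mul_le (hK n)
  simpa [mul_div_assoc] using Tendsto.const_mul C hE

lemma Negl.transpose {E : ∀ n : ℕ, Matrix (Fin n) (Fin n) ℝ} (hE : Negl E) :
    Negl fun n => (E n)ᵀ := by
  simpa [Negl, absSum_transpose] using hE

lemma Negl.trace_mul {E A : ∀ n : ℕ, Matrix (Fin n) (Fin n) ℝ} {C : ℝ} (hE : Negl E)
    (hA : ∀ n i j, |A n i j| ≤ C) :
    Tendsto (fun n : ℕ => (A n * E n).trace / n) atTop (𝓝 0) := by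
  refine squeeze_zero_norm (a := fun n : ℕ => C * (absSum (E n) / n)) (fun n => ?_)
    (by simpa using Tendsto.const_mul C hE)
  rw [Real.norm_eq_abs, abs_div, Nat.abs_cast, ← mul_div_assoc]
  exact div_le_div_of_nonneg_right (abs_trace_mul_le (hA n)) n.cast_nonneg

/-- Multipliers acting on Toeplitz matrices, up to negligible terms, through a bounded matrix. -/
def IsToepMultiplier (c : ℝ → ℝ) (K : ∀ n : ℕ, Matrix (Fin n) (Fin n) ℝ) : Prop :=
  (∃ C, ∀ n j, ∑ i, |K n i j| ≤ C) ∧ ∀ u, Integrable u halfCircle →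
    Negl fun n => toep n (fun l => c l * u l) - K n * toep n u

lemma tendsto_integral_cos_mul {u : ℝ → ℝ} (hu : Integrable u halfCircle) :
    Tendsto (fun m : ℕ => ∫ l, Real.cos ((m : ℝ) * l) * u l ∂halfCircle) atTop (𝓝 0) := by
  have h := Real.tendsto_integral_exp_smul_cocompact
    (fun l => (((Set.Ioc 0 Real.pi).indicator u l : ℝ) : ℂ))
  have h2 : Tendsto (fun m : ℕ => (m : ℝ) * (2 * Real.pi)⁻¹) atTop (cocompact ℝ) :=
    (tendsto_natCast_atTop_atTop.atTop_mul_const (by have := Real.pi_pos; positivity)).mono_right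
      atTop_le_cocompact
  have h3 := (Complex.continuous_re.tendsto _).comp (h.comp h2)
  rw [Complex.zero_re] at h3
  refine h3.congr fun m => ?_
  simp only [Function.comp_apply]
  have hint : Integrable (fun v : ℝ => Real.fourierChar (-(v * ((m : ℝ) * (2 * Real.pi)⁻¹))) •
      (((Set.Ioc 0 Real.pi).indicator u v : ℝ) : ℂ)) := by
    have : Integrable (fun v => (((Set.Ioc 0 Real.pi).indicator u v : ℝ) : ℂ)) := by
      refine Integrable.ofReal ?_
      exact (integrable_indicator_iff measurableSet_Ioc).2 hu
    have hc := (Real.fourierIntegral_convergent_iff' (innerSL ℝ) ((m : ℝ) * (2 * Real.pi)⁻¹)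
      (μ := volume) (f := fun v => (((Set.Ioc 0 Real.pi).indicator u v : ℝ) : ℂ))).2 this
    refine hc.congr (Eventually.of_forall fun v => ?_)
    have : (innerSL ℝ) v ((m : ℝ) * (2 * Real.pi)⁻¹) = v * ((m : ℝ) * (2 * Real.pi)⁻¹) :=
      mul_comm _ _
    simp only [this]
  have hre := (integral_re (𝕜 := ℂ) hint)
  simp only [RCLike.re_to_complex] at hre
  rw [← hre]
  unfold halfCircle
  rw [← integral_indicator measurableSet_Ioc]
  congr 1; ext v
  rw [Circle.smul_def, Real.fourierChar_apply, smul_eq_mul, Complex.re_mul_ofReal]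
  have : Complex.exp (2 * Real.pi * ((-(v * ((m : ℝ) * (2 * Real.pi)⁻¹)) : ℝ) : ℂ) * Complex.I)
      = Complex.exp (((-(m * v) : ℝ) : ℂ) * Complex.I) := by
    congr 2
    have := Real.pi_ne_zero
    rw [← Complex.ofReal_ofNat, ← Complex.ofReal_mul, ← Complex.ofReal_mul]
    congr 1
    field_simp
  push_cast at this ⊢
  rw [this]
  have e2 := Complex.exp_ofReal_mul_I_re (-(m * v))
  push_cast at e2
  rw [e2, Real.cos_neg]
  by_cases hv : v ∈ Set.Ioc 0 Real.pi <;> simp [hv]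

/-- Half the adjacency matrix of a path. -/
def pathMat (n : ℕ) : Matrix (Fin n) (Fin n) ℝ := fun i j =>
  (if (j : ℕ) = i + 1 then 1 / 2 else 0) + (if (i : ℕ) = j + 1 then 1 / 2 else 0)

lemma sum_ite_val_eq {n : ℕ} (x : Fin n → ℝ) (k : ℕ) :
    ∑ j : Fin n, (if (j : ℕ) = k then x j else 0) = if h : k < n then x ⟨k, h⟩ else 0 := by
  split_ifs with h
  · rw [Finset.sum_eq_single ⟨k, h⟩]
    · simp
    · intro b _ hb
      rw [if_neg]
      intro hbk; apply hb; ext; exact hbk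
    · simp
  · refine Finset.sum_eq_zero fun j _ => if_neg ?_
    have := j.2; omega

lemma sum_ite_val_succ_eq {n : ℕ} (x : Fin n → ℝ) (i : Fin n) :
    ∑ j : Fin n, (if (i : ℕ) = j + 1 then x j else 0)
      = if (i : ℕ) = 0 then 0 else x ⟨i - 1, by omega⟩ := by
  split_ifs with h
  · refine Finset.sum_eq_zero fun j _ => if_neg (by omega)
  · have := sum_ite_val_eq x (i - 1)
    rw [dif_pos (by omega)] at this
    rw [← this]
    refine Finset.sum_congr rfl fun j _ => ?_
    congr 1
    simp only [eq_iff_iff]; omega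

lemma isToepMultiplier_cos : IsToepMultiplier Real.cos pathMat := by
  constructor
  · refine ⟨1, fun n j => ?_⟩
    have : ∀ i, |pathMat n i j| = (if (i : ℕ) = j + 1 then 1 / 2 else 0)
        + (if (j : ℕ) = i + 1 then 1 / 2 else 0) := by
      intro i
      rw [pathMat, abs_of_nonneg (by positivity), add_comm]
    simp_rw [this, Finset.sum_add_distrib]
    rw [sum_ite_val_eq (fun _ => 1 / 2), sum_ite_val_succ_eq (fun _ => 1 / 2)]
    split_ifs <;> norm_num
  · intro u hu
    set a : ℝ → ℝ := fun k => ∫ l, Real.cos (k * l) * u l ∂halfCircle with ha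
    have ha_neg : ∀ k, a (-k) = a k := by
      intro k; simp only [ha, neg_mul, Real.cos_neg]
    have hlim : Tendsto (fun m : ℕ => |a ((m : ℝ) + 1)|) atTop (𝓝 0) := by
      have := ((tendsto_integral_cos_mul hu).comp (tendsto_add_atTop_nat 1)).abs
      simpa [ha, Function.comp_def] using this
    have hces := hlim.cesaro
    refine Negl.of_le (b := fun n => ∑ m ∈ Finset.range n, |a ((m : ℝ) + 1)|)
      (by simpa [div_eq_inv_mul] using hces) fun n => ?_
    have hent : ∀ i j : Fin n, (toep n (fun l => Real.cos l * u l) - pathMat n * toep n u) i j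
        = (if (i : ℕ) + 1 < n then 0 else 1 / 2 * a ((i : ℝ) + 1 - j))
          + (if (i : ℕ) = 0 then 1 / 2 * a ((i : ℝ) - 1 - j) else 0) := by
      intro i j
      have h1 : toep n (fun l => Real.cos l * u l) i j
          = 1 / 2 * a ((i : ℝ) + 1 - j) + 1 / 2 * a ((i : ℝ) - 1 - j) := by
        simp only [toep, ha]
        rw [← integral_const_mul, ← integral_const_mul, ← integral_add
          ((integrable_cos_mul hu _).const_mul _) ((integrable_cos_mul hu _).const_mul _)]
        congr 1; ext l
        have e1 : ((i : ℝ) + 1 - j) * l = ((i : ℝ) - j) * l + l := by ring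
        have e2 : ((i : ℝ) - 1 - j) * l = ((i : ℝ) - j) * l - l := by ring
        rw [e1, e2, Real.cos_add, Real.cos_sub]; ring
      have h2 : (pathMat n * toep n u) i j =
          (if (i : ℕ) + 1 < n then 1 / 2 * a ((i : ℝ) + 1 - j) else 0)
          + (if (i : ℕ) = 0 then 0 else 1 / 2 * a ((i : ℝ) - 1 - j)) := by
        rw [Matrix.mul_apply]
        have : ∀ k : Fin n, pathMat n i k * toep n u k j
            = (if (k : ℕ) = i + 1 then 1 / 2 * toep n u k j else 0)
              + (if (i : ℕ) = k + 1 then 1 / 2 * toep n u k j else 0) := by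
          intro k; rw [pathMat, add_mul]; split_ifs <;> simp
        simp_rw [this, Finset.sum_add_distrib]
        rw [sum_ite_val_eq (fun k => 1 / 2 * toep n u k j),
          sum_ite_val_succ_eq (fun k => 1 / 2 * toep n u k j)]
        congr 1
        · split_ifs
          · simp [toep, ha]
          · rfl
        · split_ifs with h0
          · rfl
          · simp [toep, ha, Nat.cast_sub (Nat.one_le_iff_ne_zero.2 h0)]
      rw [Matrix.sub_apply, h1, h2]
      split_ifs <;> ring
    simp only [absSum, hent]
    calc ∑ i : Fin n, ∑ j : Fin n, |(if (i : ℕ) + 1 < n then 0 else 1 / 2 * a ((i : ℝ) + 1 - j))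
          + (if (i : ℕ) = 0 then 1 / 2 * a ((i : ℝ) - 1 - j) else 0)|
        ≤ ∑ i : Fin n, ∑ j : Fin n, ((if (i : ℕ) = n - 1 then 1 / 2 * |a ((n : ℝ) - j)| else 0)
          + (if (i : ℕ) = 0 then 1 / 2 * |a ((j : ℝ) + 1)| else 0)) := by
          refine Finset.sum_le_sum fun i _ => Finset.sum_le_sum fun j _ => ?_
          refine (abs_add_le _ _).trans (add_le_add ?_ ?_)
          · by_cases h : (i : ℕ) + 1 < n
            · rw [if_pos h, abs_zero]; positivity
            · have hi : (i : ℕ) + 1 = n := by omega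
              have hi' : (i : ℝ) + 1 = n := by exact_mod_cast hi
              rw [if_neg h, if_pos (by omega), abs_mul, hi']
              norm_num
          · split_ifs with h
            · have : (i : ℝ) - 1 - j = -((j : ℝ) + 1) := by rw [h]; push_cast; ring
              rw [this, ha_neg, abs_mul]; norm_num
            · simp
      _ = ∑ j : Fin n, ((if n - 1 < n then 1 / 2 * |a ((n : ℝ) - j)| else 0)
          + (if 0 < n then 1 / 2 * |a ((j : ℝ) + 1)| else 0)) := by
          rw [Finset.sum_comm]
          refine Finset.sum_congr rfl fun j _ => ?_
          rw [Finset.sum_add_distrib, sum_ite_val_eq (fun _ => 1 / 2 * |a ((n : ℝ) - j)|),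
            sum_ite_val_eq (fun _ => 1 / 2 * |a ((j : ℝ) + 1)|)]
          simp
      _ ≤ ∑ j : Fin n, (1 / 2 * |a ((n : ℝ) - j)| + 1 / 2 * |a ((j : ℝ) + 1)|) := by
          refine Finset.sum_le_sum fun j _ => add_le_add ?_ ?_ <;> split_ifs <;> first
            | exact le_rfl | positivity
      _ = ∑ m ∈ Finset.range n, |a ((m : ℝ) + 1)| := by
          rw [Finset.sum_add_distrib, ← Finset.mul_sum, ← Finset.mul_sum,
            Fin.sum_univ_eq_sum_range (fun j => |a ((n : ℝ) - j)|),
            Fin.sum_univ_eq_sum_range (fun j => |a ((j : ℝ) + 1)|),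
            ← Finset.sum_range_reflect (fun j => |a ((n : ℝ) - j)|)]
          have : ∀ j ∈ Finset.range n, |a ((n : ℝ) - ((n - 1 - j : ℕ) : ℝ))|
              = |a ((j : ℝ) + 1)| := by
            intro j hj
            have hj' := Finset.mem_range.1 hj
            congr 2
            rw [Nat.sub_sub, Nat.cast_sub (by omega)]; push_cast; ring
          rw [Finset.sum_congr rfl this]; ring

lemma isToepMultiplier_const (c : ℝ) :
    IsToepMultiplier (fun _ => c) (fun n => c • (1 : Matrix (Fin n) (Fin n) ℝ)) := by
  refine ⟨⟨|c|, fun n j => ?_⟩, fun u _ => ?_⟩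
  · simp [Matrix.one_apply, apply_ite abs]
  · simp [toep_const_mul, Negl, absSum]

lemma IsToepMultiplier.add {c d : ℝ → ℝ} {K M : ∀ n : ℕ, Matrix (Fin n) (Fin n) ℝ}
    (hc : IsToepMultiplier c K) (hd : IsToepMultiplier d M)
    (hci : ∀ u, Integrable u halfCircle → Integrable (fun l => c l * u l) halfCircle)
    (hdi : ∀ u, Integrable u halfCircle → Integrable (fun l => d l * u l) halfCircle) :
    IsToepMultiplier (fun l => c l + d l) (fun n => K n + M n) := by
  obtain ⟨⟨C, hC⟩, hK⟩ := hc
  obtain ⟨⟨D, hD⟩, hM⟩ := hd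
  refine ⟨⟨C + D, fun n j => ?_⟩, fun u hu => ?_⟩
  · refine le_trans ?_ (add_le_add (hC n j) (hD n j))
    rw [← Finset.sum_add_distrib]
    exact Finset.sum_le_sum fun i _ => abs_add_le _ _
  · refine ((hK u hu).add (hM u hu)).of_eq' fun n => ?_
    simp only [add_mul]
    rw [toep_add n (hci u hu) (hdi u hu)]
    abel

lemma IsToepMultiplier.mul {c d : ℝ → ℝ} {K M : ∀ n : ℕ, Matrix (Fin n) (Fin n) ℝ}
    (hc : IsToepMultiplier c K) (hd : IsToepMultiplier d M)
    (hdi : ∀ u, Integrable u halfCircle → Integrable (fun l => d l * u l) halfCircle) :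
    IsToepMultiplier (fun l => c l * d l) (fun n => K n * M n) := by
  obtain ⟨⟨C, hC⟩, hK⟩ := hc
  obtain ⟨⟨D, hD⟩, hM⟩ := hd
  refine ⟨⟨C * D, fun n j => ?_⟩, fun u hu => ?_⟩
  · have hC0 : 0 ≤ C := le_trans (Finset.sum_nonneg fun _ _ => abs_nonneg _) (hC n j)
    calc ∑ i, |(K n * M n) i j| ≤ ∑ i, ∑ k, |K n i k| * |M n k j| := by
          refine Finset.sum_le_sum fun i _ => ?_
          rw [Matrix.mul_apply]
          refine (Finset.abs_sum_le_sum_abs _ _).trans (le_of_eq ?_)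
          exact Finset.sum_congr rfl fun k _ => abs_mul _ _
      _ = ∑ k, (∑ i, |K n i k|) * |M n k j| := by
          rw [Finset.sum_comm]; simp_rw [Finset.sum_mul]
      _ ≤ ∑ k, C * |M n k j| :=
          Finset.sum_le_sum fun k _ => mul_le_mul_of_nonneg_right (hC n k) (abs_nonneg _)
      _ ≤ C * D := by rw [← Finset.mul_sum]; exact mul_le_mul_of_nonneg_left (hD n j) hC0
  · refine ((hK _ (hdi u hu)).add ((hM u hu).mul_left hC)).of_eq' fun n => ?_
    simp only [mul_assoc]
    rw [Matrix.mul_sub]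
    abel

lemma integrable_polynomial_cos_mul (P : Polynomial ℝ) {μ : Measure ℝ} {u : ℝ → ℝ}
    (hu : Integrable u μ) : Integrable (fun l => P.eval (Real.cos l) * u l) μ := by
  obtain ⟨C, hC⟩ := isCompact_Icc.exists_bound_of_continuousOn
    (s := Set.Icc (-1 : ℝ) 1) P.continuous.continuousOn
  exact hu.bdd_mul (c := C) (by fun_prop)
    (Eventually.of_forall fun l => hC _ ⟨Real.neg_one_le_cos l, Real.cos_le_one l⟩)

lemma exists_isToepMultiplier (P : Polynomial ℝ) :
    ∃ K, IsToepMultiplier (fun l => P.eval (Real.cos l)) K := by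
  induction P using Polynomial.induction_on with
  | C a => exact ⟨_, by simpa using isToepMultiplier_const a⟩
  | add p q hp hq =>
    obtain ⟨K, hK⟩ := hp
    obtain ⟨M, hM⟩ := hq
    refine ⟨fun n => K n + M n, ?_⟩
    simp only [Polynomial.eval_add]
    exact hK.add hM (fun u hu => integrable_polynomial_cos_mul p hu)
      (fun u hu => integrable_polynomial_cos_mul q hu)
  | monomial n a hn =>
    obtain ⟨K, hK⟩ := hn
    refine ⟨fun n => K n * pathMat n, ?_⟩
    have := hK.mul isToepMultiplier_cos fun u hu => by
      simpa using integrable_polynomial_cos_mul Polynomial.X hu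
    simpa [pow_succ, mul_assoc] using this

lemma exists_polynomial_cos_approx {μ : Measure ℝ} [IsFiniteMeasure μ]
    (hμ : ∀ᵐ l ∂μ, l ∈ Set.Ioc 0 Real.pi) {h : ℝ → ℝ} (hm : Measurable h) {p : ℝ} (hp : 1 ≤ p)
    (hi : Integrable (fun l => |h l| ^ p) μ) {ε : ℝ} (hε : 0 < ε) :
    ∃ P : Polynomial ℝ, Integrable (fun l => |h l - P.eval (Real.cos l)| ^ p) μ ∧
      ∫ l, |h l - P.eval (Real.cos l)| ^ p ∂μ ≤ ε := by
  have hp0 : 0 < p := by linarith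
  set p' : ENNReal := ENNReal.ofReal p with hp'
  have hp'r : p'.toReal = p := ENNReal.toReal_ofReal hp0.le
  have hp'0 : p' ≠ 0 := by simpa [hp'] using hp0
  have hp't : p' ≠ ⊤ := ENNReal.ofReal_ne_top
  have hp'1 : 1 ≤ p' := by simpa [hp'] using hp
  have hL : MemLp h p' μ := by
    rw [← integrable_norm_rpow_iff hm.aestronglyMeasurable hp'0 hp't, hp'r]
    exact hi
  set δ : ℝ := ε ^ p⁻¹ with hδ
  have hδ0 : 0 < δ := Real.rpow_pos_of_pos hε _
  obtain ⟨g, hg, hgL⟩ := hL.exists_boundedContinuous_eLpNorm_sub_le hp't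
    (ε := ENNReal.ofReal (δ / 2)) (by simpa using hδ0)
  set V : ℝ := (μ Set.univ ^ p'.toReal⁻¹).toReal with hV
  have hVt : μ Set.univ ^ p'.toReal⁻¹ ≠ ⊤ :=
    ENNReal.rpow_ne_top_of_nonneg (by simp [hp'r, hp0.le]) (measure_ne_top _ _)
  obtain ⟨P, hP⟩ := exists_polynomial_near_of_continuousOn (-1) 1 (fun x => g (Real.arccos x))
    (by fun_prop) (δ / 2 / (V + 1)) (by positivity)
  have hb : ∀ᵐ l ∂μ, ‖g l - P.eval (Real.cos l)‖ ≤ δ / 2 / (V + 1) := by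
    filter_upwards [hμ] with l hl
    have := hP (Real.cos l) ⟨Real.neg_one_le_cos l, Real.cos_le_one l⟩
    rw [Real.arccos_cos hl.1.le hl.2, abs_sub_comm] at this
    exact this.le
  have h2 : eLpNorm (fun l => g l - P.eval (Real.cos l)) p' μ ≤ ENNReal.ofReal (δ / 2) := by
    refine (eLpNorm_le_of_ae_bound hb).trans ?_
    rw [← ENNReal.ofReal_toReal hVt, ← ENNReal.ofReal_mul ENNReal.toReal_nonneg]
    refine ENNReal.ofReal_le_ofReal ?_
    have hV0 : 0 ≤ V := ENNReal.toReal_nonneg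
    rw [← hV, mul_div_assoc', div_le_iff₀ (by positivity)]
    nlinarith
  have hcm : AEStronglyMeasurable (fun l => P.eval (Real.cos l)) μ := by
    have : Continuous fun l => P.eval (Real.cos l) := by fun_prop
    exact this.aestronglyMeasurable
  have hgc : MemLp (fun l => g l - P.eval (Real.cos l)) p' μ :=
    ⟨hgL.1.sub hcm, h2.trans_lt ENNReal.ofReal_lt_top⟩
  have heq : (fun l => h l - P.eval (Real.cos l))
      = (h - ⇑g) + fun l => g l - P.eval (Real.cos l) := by
    ext l; simp
  have hM : MemLp (fun l => h l - P.eval (Real.cos l)) p' μ := by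
    rw [heq]; exact (hL.sub hgL).add hgc
  have hN : eLpNorm (fun l => h l - P.eval (Real.cos l)) p' μ ≤ ENNReal.ofReal δ := by
    rw [heq]
    refine (eLpNorm_add_le (hL.sub hgL).1 hgc.1 hp'1).trans ?_
    refine (add_le_add hg h2).trans ?_
    rw [← ENNReal.ofReal_add (by positivity) (by positivity), add_halves]
  refine ⟨P, ?_, ?_⟩
  · have := hM.integrable_norm_rpow hp'0 hp't
    rwa [hp'r] at this
  · rw [hM.eLpNorm_eq_integral_rpow_norm hp'0 hp't, hp'r,
      ENNReal.ofReal_le_ofReal_iff hδ0.le, hδ] at hN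
    have h0 : 0 ≤ ∫ l, |h l - P.eval (Real.cos l)| ^ p ∂μ :=
      integral_nonneg fun l => by positivity
    exact (Real.rpow_le_rpow_iff h0 hε.le (by positivity)).1 hN

/-- A positive symbol whose `p`-th power, and the `q`-th power of whose inverse, are integrable. -/
structure IsAdmissibleSymbol (f : ℝ → ℝ) (p q : ℝ) : Prop where
  conj : p.HolderConjugate q
  meas : Measurable f
  pos : ∀ l ∈ Set.Ioc 0 Real.pi, 0 < f l
  int_rpow : Integrable (fun l => f l ^ p) halfCircle
  int_inv_rpow : Integrable (fun l => (f l)⁻¹ ^ q) halfCircle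

lemma integrable_of_integrable_rpow {μ : Measure ℝ} [IsFiniteMeasure μ] {u : ℝ → ℝ} {p : ℝ}
    (hp : 1 ≤ p) (hm : Measurable u) (hi : Integrable (fun l => |u l| ^ p) μ) :
    Integrable u μ := by
  refine Integrable.mono' (hi.add (integrable_const 1)) hm.aestronglyMeasurable
    (Eventually.of_forall fun l => ?_)
  simp only [Pi.add_apply, Real.norm_eq_abs]
  have h0 : 0 ≤ |u l| ^ p := by positivity
  rcases le_total |u l| 1 with h | h
  · linarith
  · have := Real.rpow_le_rpow_of_exponent_le h hp
    rw [Real.rpow_one] at this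
    linarith

namespace IsAdmissibleSymbol

variable {f : ℝ → ℝ} {p q : ℝ} (hf : IsAdmissibleSymbol f p q)
include hf

lemma ae_pos : ∀ᵐ l ∂halfCircle, 0 < f l := by
  filter_upwards [ae_halfCircle_mem] with l hl using hf.pos l hl

lemma int : Integrable f halfCircle := by
  refine integrable_of_integrable_rpow hf.conj.lt.le hf.meas (hf.int_rpow.congr ?_)
  filter_upwards [hf.ae_pos] with l hl
  rw [abs_of_pos hl]

lemma int_inv : Integrable (fun l => (f l)⁻¹) halfCircle := by
  refine integrable_of_integrable_rpow hf.conj.symm.lt.le hf.meas.inv (hf.int_inv_rpow.congr ?_)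
  filter_upwards [hf.ae_pos] with l hl
  rw [abs_of_pos (inv_pos.2 hl)]

lemma posDef (n : ℕ) : (toep n f).PosDef := toep_posDef n hf.int hf.int_inv hf.pos

lemma exists_abs_inv_le : ∃ C, ∀ n i j, |(toep n f)⁻¹ i j| ≤ C :=
  ⟨_, fun n i j => abs_toep_inv_apply_le n hf.int hf.int_inv hf.pos i j⟩

lemma trace_inv_mono (n : ℕ) {u v : ℝ → ℝ} (hu : Integrable u halfCircle)
    (hv : Integrable v halfCircle) (huv : ∀ᵐ l ∂halfCircle, u l ≤ v l) :
    ((toep n f)⁻¹ * toep n u).trace ≤ ((toep n f)⁻¹ * toep n v).trace := by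
  rw [trace_mul_toep n _ hu, trace_mul_toep n _ hv]
  refine integral_mono_ae (integrable_mul_quad _ hu) (integrable_mul_quad _ hv) ?_
  filter_upwards [huv] with l hl
  have := (hf.posDef n).inv.posSemidef
  have h1 := this.dotProduct_mulVec_nonneg (cosVec n l)
  have h2 := this.dotProduct_mulVec_nonneg (sinVec n l)
  simp only [star_trivial] at h1 h2
  exact mul_le_mul_of_nonneg_right hl (add_nonneg h1 h2)

/-- Uniform bound for normalized traces and means by `L^p` norms. -/
lemma exists_bound {ε : ℝ} (hε : 0 < ε) : ∃ C, 0 ≤ C ∧ ∀ r : ℝ → ℝ, Measurable r → (∀ l, 0 ≤ r l) →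
    Integrable (fun l => |r l * f l| ^ p) halfCircle →
    (∀ n : ℕ, ((toep n f)⁻¹ * toep n (fun l => r l * f l)).trace
      ≤ n * (ε + C * ∫ l, |r l * f l| ^ p ∂halfCircle)) ∧
    Integrable r halfCircle ∧
    ∫ l, r l ∂halfCircle ≤ ε + C * ∫ l, |r l * f l| ^ p ∂halfCircle := by
  have hp0 := hf.conj.pos
  have hq0 := hf.conj.symm.pos
  set J := ∫ l, (f l)⁻¹ ^ q ∂halfCircle
  have hlim : Tendsto (fun s : ℝ => s ^ (-q) * (J / q)) atTop (𝓝 0) := by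
    simpa using (tendsto_rpow_neg_atTop hq0).mul_const (J / q)
  obtain ⟨s, hs, hs0⟩ := ((hlim.eventually (gt_mem_nhds hε)).and (eventually_gt_atTop 0)).exists
  have hpi : (Real.pi ^ 2)⁻¹ * Real.pi ≤ 1 := by
    have h3 := Real.pi_gt_three
    rw [pow_two, mul_inv, mul_assoc, inv_mul_cancel₀ Real.pi_ne_zero, mul_one]
    exact inv_le_one_of_one_le₀ (by linarith)
  refine ⟨s ^ p / p, by positivity, fun r hrm hr0 hri => ?_⟩
  have hu0 : ∀ᵐ l ∂halfCircle, 0 ≤ r l * f l := by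
    filter_upwards [hf.ae_pos] with l hl using mul_nonneg (hr0 l) hl.le
  have hrf : Integrable (fun l => r l * f l) halfCircle :=
    integrable_of_integrable_rpow hf.conj.lt.le (hrm.mul hf.meas) hri
  have e1 : ∀ᵐ l ∂halfCircle, (s * (r l * f l)) ^ p = s ^ p * |r l * f l| ^ p := by
    filter_upwards [hu0] with l hl
    rw [Real.mul_rpow hs0.le hl, abs_of_nonneg hl]
  have e2 : ∀ᵐ l ∂halfCircle, (s⁻¹ * (f l)⁻¹) ^ q = s ^ (-q) * (f l)⁻¹ ^ q := by
    filter_upwards [hf.ae_pos] with l hl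
    rw [Real.mul_rpow (by positivity) (by positivity), Real.inv_rpow hs0.le, Real.rpow_neg hs0.le]
  have i1 : Integrable (fun l => (s * (r l * f l)) ^ p) halfCircle :=
    (hri.const_mul (s ^ p)).congr (e1.mono fun l hl => hl.symm)
  have i2 : Integrable (fun l => (s⁻¹ * (f l)⁻¹) ^ q) halfCircle :=
    (hf.int_inv_rpow.const_mul (s ^ (-q))).congr (e2.mono fun l hl => hl.symm)
  have v1 : ∫ l, (s * (r l * f l)) ^ p ∂halfCircle = s ^ p * ∫ l, |r l * f l| ^ p ∂halfCircle := by
    rw [integral_congr_ae e1, integral_const_mul]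
  have v2 : ∫ l, (s⁻¹ * (f l)⁻¹) ^ q ∂halfCircle = s ^ (-q) * J := by
    rw [integral_congr_ae e2, integral_const_mul]
  have hI0 : 0 ≤ ∫ l, |r l * f l| ^ p ∂halfCircle := integral_nonneg fun l => by positivity
  have hY : (∫ l, (s * (r l * f l)) ^ p ∂halfCircle) / p
      + (∫ l, (s⁻¹ * (f l)⁻¹) ^ q ∂halfCircle) / q
      ≤ ε + s ^ p / p * ∫ l, |r l * f l| ^ p ∂halfCircle := by
    rw [v1, v2]
    have : s ^ p * (∫ l, |r l * f l| ^ p ∂halfCircle) / p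
      = s ^ p / p * ∫ l, |r l * f l| ^ p ∂halfCircle := by ring
    rw [this, mul_div_assoc]
    linarith
  refine ⟨fun n => ?_, ?_⟩
  · calc ((toep n f)⁻¹ * toep n (fun l => r l * f l)).trace
        ≤ (((Real.pi ^ 2)⁻¹ • toep n (fun l => (f l)⁻¹)) * toep n (fun l => r l * f l)).trace := by
          refine trace_mul_toep_mono n (fun y => ?_) hrf hu0
          simpa [Matrix.smul_mulVec] using toep_inv_form_le n hf.int hf.int_inv hf.pos y
      _ = (Real.pi ^ 2)⁻¹ * (toep n (fun l => s⁻¹ * (f l)⁻¹)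
            * toep n (fun l => s * (r l * f l))).trace := by
          rw [toep_const_mul, toep_const_mul]
          simp only [Matrix.smul_mul, Matrix.mul_smul, smul_smul, Matrix.trace_smul, smul_eq_mul]
          rw [mul_inv_cancel₀ hs0.ne', one_mul]
      _ ≤ (Real.pi ^ 2)⁻¹ * (n * Real.pi * (ε + s ^ p / p * ∫ l, |r l * f l| ^ p ∂halfCircle)) := by
          refine mul_le_mul_of_nonneg_left ?_ (by positivity)
          refine (trace_toep_mul_toep_le n hf.conj (hrf.const_mul s) (hf.int_inv.const_mul s⁻¹)
            ?_ ?_ i1 i2).trans (mul_le_mul_of_nonneg_left hY (by positivity))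
          · filter_upwards [hu0] with l hl using mul_nonneg hs0.le hl
          · filter_upwards [hf.ae_pos] with l hl using by positivity
      _ = ((Real.pi ^ 2)⁻¹ * Real.pi)
          * (n * (ε + s ^ p / p * ∫ l, |r l * f l| ^ p ∂halfCircle)) := by ring
      _ ≤ _ := mul_le_of_le_one_left (by positivity) hpi
  · have hyoung : ∀ᵐ l ∂halfCircle, r l
        ≤ (s * (r l * f l)) ^ p / p + (s⁻¹ * (f l)⁻¹) ^ q / q := by
      filter_upwards [hf.ae_pos, hu0] with l hl hl0
      have := Real.young_inequality_of_nonneg (a := s * (r l * f l)) (b := s⁻¹ * (f l)⁻¹)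
        (by positivity) (by positivity) hf.conj
      convert this using 1
      field_simp
    have hri' : Integrable r halfCircle := by
      refine Integrable.mono' ((i1.div_const p).add (i2.div_const q)) hrm.aestronglyMeasurable ?_
      filter_upwards [hyoung] with l hl
      rw [Real.norm_eq_abs, abs_of_nonneg (hr0 l)]
      exact hl
    refine ⟨hri', le_trans ?_ hY⟩
    rw [← integral_div, ← integral_div, ← integral_add (i1.div_const p) (i2.div_const q)]
    exact integral_mono_ae hri' ((i1.div_const p).add (i2.div_const q)) hyoung

end IsAdmissibleSymbol

lemma abs_polynomial_cos_le (P : Polynomial ℝ) : ∃ M, 0 ≤ M ∧ ∀ l, |P.eval (Real.cos l)| ≤ M := by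
  obtain ⟨C, hC⟩ := isCompact_Icc.exists_bound_of_continuousOn
    (s := Set.Icc (-1 : ℝ) 1) P.continuous.continuousOn
  have h : ∀ l, |P.eval (Real.cos l)| ≤ C :=
    fun l => hC _ ⟨Real.neg_one_le_cos l, Real.cos_le_one l⟩
  exact ⟨C, (abs_nonneg _).trans (h 0), h⟩

lemma measurable_polynomial_cos (P : Polynomial ℝ) :
    Measurable fun l => P.eval (Real.cos l) := by
  have : Continuous fun l => P.eval (Real.cos l) := by fun_prop
  exact this.measurable

namespace IsAdmissibleSymbol

variable {f : ℝ → ℝ} {p q : ℝ} (hf : IsAdmissibleSymbol f p q)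
include hf

lemma integrable_rpow_of_le {r s : ℝ → ℝ} (hr : Measurable r)
    (hri : Integrable (fun l => |r l * f l| ^ p) halfCircle) (hs : Measurable s) {a b : ℝ}
    (h : ∀ l, |s l| ≤ a * |r l| + b) :
    Integrable (fun l => |s l * f l| ^ p) halfCircle := by
  have hp0 := hf.conj.pos
  have hp'r : (ENNReal.ofReal p).toReal = p := ENNReal.toReal_ofReal hp0.le
  have hp'0 : ENNReal.ofReal p ≠ 0 := by simpa using hp0
  have key : ∀ {u : ℝ → ℝ}, Measurable u → (Integrable (fun l => |u l| ^ p) halfCircle ↔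
      MemLp u (ENNReal.ofReal p) halfCircle) := by
    intro u hu
    rw [← integrable_norm_rpow_iff hu.aestronglyMeasurable hp'0 ENNReal.ofReal_ne_top, hp'r]
    rfl
  have hfm : MemLp f (ENNReal.ofReal p) halfCircle := by
    rw [← key hf.meas]
    refine hf.int_rpow.congr ?_
    filter_upwards [hf.ae_pos] with l hl
    rw [abs_of_pos hl]
  have hrL := (key (hr.mul hf.meas)).1 hri
  refine (key (hs.mul hf.meas)).2 ?_
  refine ((hrL.norm.const_mul a).add (hfm.norm.const_mul b)).mono'
    (hs.mul hf.meas).aestronglyMeasurable (Eventually.of_forall fun l => ?_)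
  simp only [Pi.add_apply, Pi.mul_apply, Real.norm_eq_abs, abs_mul]
  nlinarith [mul_le_mul_of_nonneg_right (h l) (abs_nonneg (f l))]

lemma integrable_rpow_of_bounded {s : ℝ → ℝ} (hs : Measurable s) {b : ℝ}
    (h : ∀ l, |s l| ≤ b) : Integrable (fun l => |s l * f l| ^ p) halfCircle := by
  refine hf.integrable_rpow_of_le (r := fun _ => 0) (a := 0) (b := b) measurable_const ?_ hs ?_
  · simp [Real.zero_rpow hf.conj.pos.ne']
  · simpa using h

lemma integrable_mul_of_rpow {r : ℝ → ℝ} (hr : Measurable r)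
    (hri : Integrable (fun l => |r l * f l| ^ p) halfCircle) :
    Integrable (fun l => r l * f l) halfCircle :=
  integrable_of_integrable_rpow hf.conj.lt.le (hr.mul hf.meas) hri

lemma exists_polynomial_approx {r : ℝ → ℝ} (hr : Measurable r)
    (hri : Integrable (fun l => |r l * f l| ^ p) halfCircle) {ε : ℝ} (hε : 0 < ε) :
    ∃ P : Polynomial ℝ, Integrable (fun l => |(r l - P.eval (Real.cos l)) * f l| ^ p) halfCircle ∧
      ∫ l, |(r l - P.eval (Real.cos l)) * f l| ^ p ∂halfCircle ≤ ε := by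
  set w : ℝ → ENNReal := fun l => ENNReal.ofReal (f l ^ p)
  have hw : Measurable w := (hf.meas.pow_const p).ennreal_ofReal
  have hwt : ∀ᵐ l ∂halfCircle, w l < ⊤ := Eventually.of_forall fun l => ENNReal.ofReal_lt_top
  have key : ∀ u : ℝ → ℝ, (fun l => (w l).toReal • |u l| ^ p)
      =ᵐ[halfCircle] fun l => |u l * f l| ^ p := by
    intro u
    filter_upwards [hf.ae_pos] with l hl
    rw [smul_eq_mul, ENNReal.toReal_ofReal (by positivity), abs_mul, abs_of_pos hl,
      Real.mul_rpow (by positivity) hl.le, mul_comm]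
  have : IsFiniteMeasure (halfCircle.withDensity w) :=
    isFiniteMeasure_withDensity_ofReal hf.int_rpow.2
  obtain ⟨P, hP, hP2⟩ := exists_polynomial_cos_approx (μ := halfCircle.withDensity w)
    ((withDensity_absolutelyContinuous _ _).ae_le ae_halfCircle_mem) hr hf.conj.lt.le
    (by rw [integrable_withDensity_iff_integrable_smul' hw hwt]; exact hri.congr (key r).symm) hε
  rw [integrable_withDensity_iff_integrable_smul' hw hwt] at hP
  rw [integral_withDensity_eq_integral_toReal_smul hw hwt] at hP2
  exact ⟨P, hP.congr (key _), by rwa [← integral_congr_ae (key _)]⟩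

lemma tendsto_trace_inv_polynomial (P : Polynomial ℝ) :
    Tendsto (fun n : ℕ => ((toep n f)⁻¹ * toep n (fun l => P.eval (Real.cos l) * f l)).trace / n)
      atTop (𝓝 (Real.pi⁻¹ * ∫ l, P.eval (Real.cos l) ∂halfCircle)) := by
  obtain ⟨K, -, hK⟩ := exists_isToepMultiplier P
  obtain ⟨C, hC⟩ := hf.exists_abs_inv_le
  have h1 := (hK f hf.int).trace_mul hC
  have h2 := (hK (fun _ => 1) (integrable_const 1)).trace_mul
    (A := fun n => 1) (C := 1) (fun n i j => by
      rw [Matrix.one_apply]; split_ifs <;> simp)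
  have h3 := (h1.sub (h2.const_mul Real.pi⁻¹)).add_const
    (Real.pi⁻¹ * ∫ l, P.eval (Real.cos l) ∂halfCircle)
  rw [mul_zero, sub_zero, zero_add] at h3
  refine h3.congr' ?_
  filter_upwards [eventually_gt_atTop 0] with n hn
  have hn' : (n : ℝ) ≠ 0 := by exact_mod_cast hn.ne'
  have hdet : IsUnit (toep n f).det := (hf.posDef n).det_pos.ne'.isUnit
  have e1 : ((toep n f)⁻¹ * (K n * toep n f)).trace = (K n).trace := by
    rw [← Matrix.mul_assoc, Matrix.trace_mul_comm, ← Matrix.mul_assoc,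
      Matrix.mul_nonsing_inv _ hdet, Matrix.one_mul]
  have e2 : (toep n fun l => P.eval (Real.cos l) * 1).trace
      = n * ∫ l, P.eval (Real.cos l) ∂halfCircle := by
    simp [Matrix.trace, toep]
  rw [Matrix.mul_sub, Matrix.trace_sub, e1, toep_one, Matrix.one_mul, Matrix.trace_sub, e2,
    Matrix.mul_smul, Matrix.mul_one, Matrix.trace_smul, smul_eq_mul]
  field_simp
  ring

lemma tendsto_trace_inv {r : ℝ → ℝ} (hr : Measurable r)
    (hri : Integrable (fun l => |r l * f l| ^ p) halfCircle) :
    Tendsto (fun n : ℕ => ((toep n f)⁻¹ * toep n (fun l => r l * f l)).trace / n)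
      atTop (𝓝 (Real.pi⁻¹ * ∫ l, r l ∂halfCircle)) := by
  rw [Metric.tendsto_atTop]
  intro ε hε
  obtain ⟨C, hC0, hC⟩ := hf.exists_bound (ε := ε / 8) (by positivity)
  obtain ⟨P, hP, hP2⟩ := hf.exists_polynomial_approx hr hri (ε := ε / 8 / (C + 1)) (by positivity)
  set c : ℝ → ℝ := fun l => P.eval (Real.cos l) with hc
  have hcm : Measurable c := measurable_polynomial_cos P
  obtain ⟨M, -, hM⟩ := abs_polynomial_cos_le P
  have hdm : Measurable fun l => |r l - c l| := (hr.sub hcm).abs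
  have hdi : Integrable (fun l => |(|r l - c l|) * f l| ^ p) halfCircle := by
    simpa [abs_mul] using hP
  have hdI : ∫ l, |(|r l - c l|) * f l| ^ p ∂halfCircle ≤ ε / 8 / (C + 1) := by
    simpa [abs_mul] using hP2
  obtain ⟨b1, b2, b3⟩ := hC _ hdm (fun l => abs_nonneg _) hdi
  have hsmall : ε / 8 + C * ∫ l, |(|r l - c l|) * f l| ^ p ∂halfCircle ≤ ε / 4 := by
    have h1 := mul_le_mul_of_nonneg_left hdI hC0
    have : C * (ε / 8 / (C + 1)) ≤ ε / 8 := by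
      rw [mul_div_assoc', div_le_iff₀ (by positivity)]; nlinarith
    linarith
  have hci : Integrable c halfCircle :=
    (integrable_const M).mono' hcm.aestronglyMeasurable (Eventually.of_forall hM)
  have hcf := hf.integrable_mul_of_rpow hcm (hf.integrable_rpow_of_bounded hcm hM)
  have hrf := hf.integrable_mul_of_rpow hr hri
  have hdf := hf.integrable_mul_of_rpow hdm hdi
  have hrci : Integrable (fun l => r l - c l) halfCircle :=
    (integrable_norm_iff (hr.sub hcm).aestronglyMeasurable).1 b2
  have hri' : Integrable r halfCircle := (hrci.add hci).congr (Eventually.of_forall fun l => sub_add_cancel (r l) (c l))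
  have hint : |(∫ l, r l ∂halfCircle) - ∫ l, c l ∂halfCircle| ≤ ε / 4 := by
    rw [← integral_sub hri' hci]
    exact (abs_integral_le_integral_abs).trans (b3.trans hsmall)
  obtain ⟨N, hN⟩ := Metric.tendsto_atTop.1 (hf.tendsto_trace_inv_polynomial P) (ε / 4)
    (by positivity)
  refine ⟨max N 1, fun n hn => ?_⟩
  have hn1 : 0 < (n : ℝ) := by
    have : 1 ≤ n := le_trans (le_max_right _ _) hn
    exact_mod_cast this
  have hNn := hN n (le_trans (le_max_left _ _) hn)
  rw [Real.dist_eq] at hNn ⊢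
  have htr : |((toep n f)⁻¹ * toep n (fun l => r l * f l)).trace
      - ((toep n f)⁻¹ * toep n (fun l => c l * f l)).trace| ≤ n * (ε / 4) := by
    have hup : ((toep n f)⁻¹ * toep n (fun l => r l * f l)).trace
        ≤ ((toep n f)⁻¹ * toep n (fun l => c l * f l)).trace
          + ((toep n f)⁻¹ * toep n (fun l => |r l - c l| * f l)).trace := by
      rw [← Matrix.trace_add, ← Matrix.mul_add, ← toep_add n hcf hdf]
      refine hf.trace_inv_mono n hrf (hcf.add hdf) ?_
      filter_upwards [hf.ae_pos] with l hl
      nlinarith [le_abs_self (r l - c l)]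
    have hlo : ((toep n f)⁻¹ * toep n (fun l => c l * f l)).trace
        ≤ ((toep n f)⁻¹ * toep n (fun l => r l * f l)).trace
          + ((toep n f)⁻¹ * toep n (fun l => |r l - c l| * f l)).trace := by
      rw [← Matrix.trace_add, ← Matrix.mul_add, ← toep_add n hrf hdf]
      refine hf.trace_inv_mono n hcf (hrf.add hdf) ?_
      filter_upwards [hf.ae_pos] with l hl
      nlinarith [neg_abs_le (r l - c l)]
    have := (b1 n).trans (mul_le_mul_of_nonneg_left hsmall hn1.le)
    rw [abs_le]
    constructor <;> linarith
  have htr' : |((toep n f)⁻¹ * toep n (fun l => r l * f l)).trace / n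
      - ((toep n f)⁻¹ * toep n (fun l => c l * f l)).trace / n| ≤ ε / 4 := by
    rw [← sub_div, abs_div, abs_of_pos hn1, div_le_iff₀ hn1]
    linarith
  have hint' : |Real.pi⁻¹ * (∫ l, r l ∂halfCircle) - Real.pi⁻¹ * ∫ l, c l ∂halfCircle|
      ≤ ε / 4 := by
    rw [← mul_sub, abs_mul, abs_of_pos (by have := Real.pi_pos; positivity)]
    refine le_trans (mul_le_of_le_one_left (abs_nonneg _) ?_) hint
    exact inv_le_one_of_one_le₀ (by linarith [Real.pi_gt_three])
  rw [abs_le] at htr' hint'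
  rw [abs_lt] at hNn ⊢
  constructor <;> linarith [htr'.1, htr'.2, hint'.1, hint'.2, hNn.1, hNn.2]

end IsAdmissibleSymbol

namespace IsAdmissibleSymbol

variable {f : ℝ → ℝ} {p q : ℝ} (hf : IsAdmissibleSymbol f p q)
include hf

lemma integrable_rpow_mul_of_sq {h : ℝ → ℝ} (hm : Measurable h)
    (hi : Integrable (fun l => |h l ^ 2 * f l| ^ p) halfCircle) {s : ℝ → ℝ} (hs : Measurable s)
    {a b c : ℝ} (hb : 0 ≤ b) (hsle : ∀ l, |s l| ≤ a * h l ^ 2 + b * |h l| + c) :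
    Integrable (fun l => |s l * f l| ^ p) halfCircle := by
  refine hf.integrable_rpow_of_le (hm.pow_const 2) hi hs (a := a + b) (b := b + c) fun l => ?_
  have h1 : |h l ^ 2| = h l ^ 2 := abs_of_nonneg (sq_nonneg _)
  have h2 : |h l| ≤ h l ^ 2 + 1 := by
    rw [← sq_abs]; nlinarith [sq_nonneg (|h l| - 1), abs_nonneg (h l)]
  rw [h1]
  nlinarith [hsle l, mul_le_mul_of_nonneg_left h2 hb]

/-- The weighted form of `g ↦ ⟨g, toep (h f) g⟩` is controlled by that of `h² f`. -/
lemma sq_form_le (n : ℕ) {h : ℝ → ℝ} (hm : Measurable h)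
    (hi : Integrable (fun l => |h l ^ 2 * f l| ^ p) halfCircle) {g : Fin n → ℝ}
    (hg : g ⬝ᵥ toep n f *ᵥ g = 1) :
    (g ⬝ᵥ toep n (fun l => h l * f l) *ᵥ g) ^ 2 ≤ g ⬝ᵥ toep n (fun l => h l ^ 2 * f l) *ᵥ g := by
  have h1 := hf.integrable_mul_of_rpow (hm.pow_const 2) hi
  have h2 := hf.integrable_mul_of_rpow hm (hf.integrable_rpow_mul_of_sq hm hi hm (a := 0) (b := 1)
    (c := 0) zero_le_one fun l => by simp)
  have := toep_cauchy_schwarz n hf.int h1 h2 (by filter_upwards [hf.ae_pos] with l hl using hl.le)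
    (by filter_upwards [hf.ae_pos] with l hl using by positivity)
    (by filter_upwards [hf.ae_pos] with l hl using le_of_eq (by ring)) g g
  rwa [hg, one_mul] at this

omit hf in
lemma form_col_eq_one {n : ℕ} {G : Matrix (Fin n) (Fin n) ℝ} (hG : Gᵀ * toep n f * G = 1)
    (k : Fin n) : G.col k ⬝ᵥ toep n f *ᵥ G.col k = 1 := by
  rw [← congr_apply, hG, Matrix.one_apply_eq]

lemma sq_form_col_sum_le (n : ℕ) {h : ℝ → ℝ} (hm : Measurable h)
    (hi : Integrable (fun l => |h l ^ 2 * f l| ^ p) halfCircle)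
    {G : Matrix (Fin n) (Fin n) ℝ} (hG : Gᵀ * toep n f * G = 1) :
    ∑ k, ((Gᵀ * toep n (fun l => h l * f l) * G) k k) ^ 2
      ≤ ((toep n f)⁻¹ * toep n (fun l => h l ^ 2 * f l)).trace := by
  rw [trace_inv_mul_eq hG, Matrix.trace]
  refine Finset.sum_le_sum fun k _ => ?_
  rw [Matrix.diag, congr_apply, congr_apply]
  exact hf.sq_form_le n hm hi (form_col_eq_one hG k)

lemma exists_polynomial_sq_approx {h : ℝ → ℝ} (hm : Measurable h)
    (hi : Integrable (fun l => |h l ^ 2 * f l| ^ p) halfCircle) {ε : ℝ} (hε : 0 < ε) :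
    ∃ P : Polynomial ℝ,
      Integrable (fun l => |(h l - P.eval (Real.cos l)) ^ 2 * f l| ^ p) halfCircle ∧
      Integrable (fun l => (h l - P.eval (Real.cos l)) ^ 2) halfCircle ∧
      ∫ l, (h l - P.eval (Real.cos l)) ^ 2 ∂halfCircle ≤ ε := by
  obtain ⟨C, -, hC⟩ := hf.exists_bound zero_lt_one
  have hsq : ∀ x : ℝ, |x| ^ (2 : ℝ) = x ^ 2 := fun x => by
    rw [show (2 : ℝ) = ((2 : ℕ) : ℝ) by norm_num, Real.rpow_natCast, sq_abs]
  obtain ⟨P, hP, hP2⟩ := exists_polynomial_cos_approx ae_halfCircle_mem hm (p := 2) (by norm_num)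
    (by simpa only [hsq] using (hC _ (hm.pow_const 2) (fun l => sq_nonneg _) hi).2.1) hε
  simp only [hsq] at hP hP2
  refine ⟨P, ?_, hP, hP2⟩
  obtain ⟨M, hM0, hM⟩ := abs_polynomial_cos_le P
  refine hf.integrable_rpow_mul_of_sq hm hi ((hm.sub (measurable_polynomial_cos P)).pow_const 2)
    (a := 2) (b := 0) (c := 2 * M ^ 2) le_rfl fun l => ?_
  rw [abs_of_nonneg (sq_nonneg _)]
  have := sq_le_sq' (by linarith [neg_abs_le (P.eval (Real.cos l)), hM l])
    ((le_abs_self _).trans (hM l))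
  nlinarith [sq_nonneg (h l + P.eval (Real.cos l))]

/-- Szegő-type limit of the normalized sum of squares of generalized eigenvalues. -/
theorem tendsto_sum_sq {h : ℝ → ℝ} (hm : Measurable h)
    (hi : Integrable (fun l => |h l ^ 2 * f l| ^ p) halfCircle)
    {G : ∀ n : ℕ, Matrix (Fin n) (Fin n) ℝ} {m : ∀ n : ℕ, Fin n → ℝ}
    (hG : ∀ n, (G n)ᵀ * toep n f * G n = 1)
    (hGm : ∀ n, (G n)ᵀ * toep n (fun l => h l * f l) * G n = Matrix.diagonal (m n)) :
    Tendsto (fun n : ℕ => (∑ k, m n k ^ 2) / n) atTop (𝓝 (Real.pi⁻¹ * ∫ l, h l ^ 2 ∂halfCircle)) := by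
  have hup : ∀ n : ℕ, ∑ k, m n k ^ 2
      ≤ ((toep n f)⁻¹ * toep n (fun l => h l ^ 2 * f l)).trace := by
    intro n
    refine le_trans (le_of_eq ?_) (hf.sq_form_col_sum_le n hm hi (hG n))
    simp [hGm]
  have hlimup := hf.tendsto_trace_inv (hm.pow_const 2) hi
  have hi1 := hf.integrable_rpow_mul_of_sq hm hi hm (a := 0) (b := 1)
    (c := 0) zero_le_one fun l => by simp
  have hhf := hf.integrable_mul_of_rpow hm hi1
  have h2i : Integrable (fun l => h l ^ 2) halfCircle := by
    obtain ⟨C, -, hC⟩ := hf.exists_bound zero_lt_one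
    exact (hC _ (hm.pow_const 2) (fun l => sq_nonneg _) hi).2.1
  have h1i : Integrable h halfCircle := by
    obtain ⟨C, -, hC⟩ := hf.exists_bound zero_lt_one
    refine (integrable_norm_iff hm.aestronglyMeasurable).1
      (hC _ hm.norm (fun l => norm_nonneg _) ?_).2.1
    simpa [abs_mul] using hi1
  rw [Metric.tendsto_atTop]
  intro ε hε
  obtain ⟨P, hP, hPi, hP2⟩ := hf.exists_polynomial_sq_approx hm hi (ε := ε / 4) (by positivity)
  set c : ℝ → ℝ := fun l => P.eval (Real.cos l) with hc
  have hcm : Measurable c := measurable_polynomial_cos P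
  obtain ⟨M, hM0, hM⟩ := abs_polynomial_cos_le P
  obtain ⟨K, ⟨CK, hCK⟩, hK⟩ := exists_isToepMultiplier P
  obtain ⟨C, hC⟩ := hf.exists_abs_inv_le
  have hM2 : ∀ l, |c l ^ 2| ≤ M ^ 2 := fun l => by
    rw [abs_pow]; exact pow_le_pow_left₀ (abs_nonneg _) (hM l) 2
  have hchi := hf.integrable_rpow_mul_of_sq hm hi (hcm.mul hm) (a := 0) (b := M) (c := 0)
    hM0 (fun l => by
      simp only [Pi.mul_apply, abs_mul, zero_mul, zero_add, add_zero]
      exact mul_le_mul_of_nonneg_right (hM l) (abs_nonneg _))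
  have l1 := hf.tendsto_trace_inv (hcm.mul hm) hchi
  have l2 := hf.tendsto_trace_inv (hcm.pow_const 2)
    (hf.integrable_rpow_of_bounded (hcm.pow_const 2) hM2)
  have hci : Integrable c halfCircle :=
    (integrable_const M).mono' hcm.aestronglyMeasurable (Eventually.of_forall hM)
  have hcf : Integrable (fun l => c l * f l) halfCircle :=
    hf.integrable_mul_of_rpow hcm (hf.integrable_rpow_of_bounded hcm hM)
  have r1 := (hK _ hhf).transpose.trace_mul hC
  have r2 := ((hK _ hf.int).transpose.mul_left hCK).transpose.trace_mul hC
  have r3 := (hK _ hcf).transpose.trace_mul hC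
  have hlow : ∀ n : ℕ,
      2 * (((toep n f)⁻¹ * toep n (fun l => (c * h) l * f l)).trace / n
        - ((toep n f)⁻¹ * (toep n (fun l => c l * (h l * f l))
          - K n * toep n (fun l => h l * f l))ᵀ).trace / n)
      - (((toep n f)⁻¹ * toep n (fun l => c l ^ 2 * f l)).trace / n
        - ((toep n f)⁻¹ * (toep n (fun l => c l * (c l * f l))
          - K n * toep n (fun l => c l * f l))ᵀ).trace / n
        - ((toep n f)⁻¹ * (K n * (toep n (fun l => c l * f l) - K n * toep n f)ᵀ)ᵀ).trace / n)
      ≤ (∑ k, m n k ^ 2) / n := by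
    intro n
    have hdet : IsUnit (toep n f).det := (hf.posDef n).det_pos.ne'.isUnit
    have hTT : (toep n f)⁻¹ * toep n f = 1 := Matrix.nonsing_inv_mul _ hdet
    have key := trace_inv_form_lower (hG n) (toep n (fun l => h l * f l)) (K n * toep n f)
    have e0 : ((toep n f)⁻¹ * toep n (fun l => h l * f l) * (toep n f)⁻¹
        * (toep n (fun l => h l * f l))ᵀ).trace = ∑ k, m n k ^ 2 := by
      rw [trace_inv_mul_inv_mul (hG n), hGm]
      refine Finset.sum_congr rfl fun k _ => ?_
      rw [Finset.sum_eq_single k]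
      · simp [pow_two]
      · intro b _ hb
        simp [Matrix.diagonal_apply_ne' _ hb]
      · simp
    have hTK : (K n * toep n f)ᵀ = toep n f * (K n)ᵀ := by
      rw [Matrix.transpose_mul, toep_transpose]
    have ech : (fun l => (c * h) l * f l) = fun l => c l * (h l * f l) := by
      ext l; simp [mul_assoc]
    have ecc : (fun l => c l ^ 2 * f l) = fun l => c l * (c l * f l) := by
      ext l; ring
    have e1 : ((toep n f)⁻¹ * toep n (fun l => h l * f l) * (toep n f)⁻¹
        * (K n * toep n f)ᵀ).trace
        = ((toep n f)⁻¹ * toep n (fun l => (c * h) l * f l)).trace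
        - ((toep n f)⁻¹ * (toep n (fun l => c l * (h l * f l))
          - K n * toep n (fun l => h l * f l))ᵀ).trace := by
      rw [hTK, Matrix.transpose_sub, Matrix.mul_sub, Matrix.trace_sub, toep_transpose,
        Matrix.transpose_mul, toep_transpose, ech, sub_sub_cancel]
      simp only [Matrix.mul_assoc]
      rw [← Matrix.mul_assoc (toep n f)⁻¹ (toep n f), hTT, Matrix.one_mul]
    have e2 : ((toep n f)⁻¹ * (K n * toep n f) * (toep n f)⁻¹ * (K n * toep n f)ᵀ).trace
        = ((toep n f)⁻¹ * toep n (fun l => c l ^ 2 * f l)).trace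
        - ((toep n f)⁻¹ * (toep n (fun l => c l * (c l * f l))
          - K n * toep n (fun l => c l * f l))ᵀ).trace
        - ((toep n f)⁻¹ * (K n * (toep n (fun l => c l * f l) - K n * toep n f)ᵀ)ᵀ).trace := by
      rw [hTK, ecc, ← Matrix.trace_sub, ← Matrix.trace_sub, ← Matrix.mul_sub, ← Matrix.mul_sub]
      congr 1
      simp only [Matrix.transpose_sub, Matrix.transpose_mul, toep_transpose, Matrix.mul_sub,
        Matrix.transpose_transpose, Matrix.mul_assoc]
      rw [← Matrix.mul_assoc (toep n f)⁻¹ (toep n f), hTT, Matrix.one_mul]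
      abel
    rw [e0, e1, e2] at key
    have := div_le_div_of_nonneg_right key n.cast_nonneg
    refine le_trans (le_of_eq ?_) this
    ring
  have hlimlow := ((l1.sub r1).const_mul 2).sub ((l2.sub r3).sub r2)
  simp only [sub_zero] at hlimlow
  have hpi : Real.pi⁻¹ ≤ 1 := inv_le_one_of_one_le₀ (by linarith [Real.pi_gt_three])
  have hpi0 : 0 < Real.pi⁻¹ := inv_pos.2 Real.pi_pos
  have hval : Real.pi⁻¹ * (∫ l, h l ^ 2 ∂halfCircle) - ε / 4
      ≤ 2 * (Real.pi⁻¹ * ∫ l, (c * h) l ∂halfCircle)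
        - Real.pi⁻¹ * ∫ l, c l ^ 2 ∂halfCircle := by
    have hchI : Integrable (fun l => (c * h) l) halfCircle :=
      h1i.bdd_mul (c := M) hcm.aestronglyMeasurable (Eventually.of_forall hM)
    have hcI : Integrable (fun l => c l ^ 2) halfCircle :=
      (integrable_const (M ^ 2)).mono' (hcm.pow_const 2).aestronglyMeasurable
        (Eventually.of_forall hM2)
    have : ∫ l, (h l - c l) ^ 2 ∂halfCircle = (∫ l, h l ^ 2 ∂halfCircle)
        - 2 * (∫ l, (c * h) l ∂halfCircle) + ∫ l, c l ^ 2 ∂halfCircle := by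
      rw [← integral_const_mul, ← integral_sub h2i (hchI.const_mul 2),
        ← integral_add (f := fun l => h l ^ 2 - 2 * (c * h) l) (h2i.sub (hchI.const_mul 2)) hcI]
      congr 1; ext l; simp only [Pi.mul_apply]; ring
    have h4 : Real.pi⁻¹ * ∫ l, (h l - c l) ^ 2 ∂halfCircle ≤ ε / 4 := by
      refine le_trans (mul_le_of_le_one_left (integral_nonneg fun l => sq_nonneg _) hpi) hP2
    rw [this, mul_add, mul_sub] at h4
    linarith
  have ev1 := hlimlow.eventually (lt_mem_nhds (a := Real.pi⁻¹ * (∫ l, h l ^ 2 ∂halfCircle) - ε / 2)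
    (by linarith))
  have ev2 := hlimup.eventually_lt_const (u := Real.pi⁻¹ * (∫ l, h l ^ 2 ∂halfCircle) + ε / 2)
    (by linarith)
  obtain ⟨N, hN⟩ := eventually_atTop.1 (ev1.and ev2)
  refine ⟨N, fun n hn => ?_⟩
  obtain ⟨h1, h2⟩ := hN n hn
  rw [Real.dist_eq, abs_lt]
  have h3 := div_le_div_of_nonneg_right (hup n) (n.cast_nonneg (α := ℝ))
  constructor
  · linarith [hlow n]
  · linarith

/-- The generalized eigenvalues are uniformly `o(√n)`. -/
theorem eventually_abs_le {h : ℝ → ℝ} (hm : Measurable h)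
    (hi : Integrable (fun l => |h l ^ 2 * f l| ^ p) halfCircle)
    {G : ∀ n : ℕ, Matrix (Fin n) (Fin n) ℝ} {m : ∀ n : ℕ, Fin n → ℝ}
    (hG : ∀ n, (G n)ᵀ * toep n f * G n = 1)
    (hGm : ∀ n, (G n)ᵀ * toep n (fun l => h l * f l) * G n = Matrix.diagonal (m n))
    {ε : ℝ} (hε : 0 < ε) : ∀ᶠ n : ℕ in atTop, ∀ k, |m n k| ≤ ε * Real.sqrt n := by
  obtain ⟨P, hP, hPi, hP2⟩ := hf.exists_polynomial_sq_approx hm hi (ε := (ε / 2) ^ 2 / 2)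
    (by positivity)
  set c : ℝ → ℝ := fun l => P.eval (Real.cos l) with hc
  have hcm : Measurable c := measurable_polynomial_cos P
  have hdm : Measurable fun l => h l - c l := hm.sub hcm
  obtain ⟨M, hM0, hM⟩ := abs_polynomial_cos_le P
  have hlim := hf.tendsto_trace_inv (hdm.pow_const 2) hP
  have hpi : Real.pi⁻¹ ≤ 1 := inv_le_one_of_one_le₀ (by linarith [Real.pi_gt_three])
  have hlt : Real.pi⁻¹ * ∫ l, (h l - c l) ^ 2 ∂halfCircle < (ε / 2) ^ 2 := by
    have := mul_le_of_le_one_left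
      (integral_nonneg fun l => sq_nonneg (h l - c l) : 0 ≤ ∫ l, (h l - c l) ^ 2 ∂halfCircle) hpi
    have h0 : 0 < (ε / 2) ^ 2 := by positivity
    linarith
  have hMlim : Tendsto (fun n : ℕ => ε / 2 * Real.sqrt n) atTop atTop :=
    (Real.tendsto_sqrt_atTop.comp tendsto_natCast_atTop_atTop).const_mul_atTop (by positivity)
  have hdi : Integrable (fun l => |(h l - c l) * f l| ^ p) halfCircle :=
    hf.integrable_rpow_mul_of_sq hdm hP hdm (a := 0) (b := 1) (c := 0) zero_le_one
      fun l => by simp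
  filter_upwards [hlim.eventually (gt_mem_nhds hlt), hMlim.eventually_ge_atTop M,
    eventually_gt_atTop 0] with n hn hnM hn0 k
  have hn0' : (0 : ℝ) < n := by exact_mod_cast hn0
  rw [div_lt_iff₀ hn0'] at hn
  have hgk := form_col_eq_one (hG n) k
  have hsplit : m n k = (G n).col k ⬝ᵥ toep n (fun l => c l * f l) *ᵥ (G n).col k
      + (G n).col k ⬝ᵥ toep n (fun l => (h l - c l) * f l) *ᵥ (G n).col k := by
    rw [← dotProduct_add, ← Matrix.add_mulVec, ← toep_add n
      (hf.integrable_mul_of_rpow hcm (hf.integrable_rpow_of_bounded hcm hM))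
      (hf.integrable_mul_of_rpow hdm hdi)]
    have : (fun l => c l * f l + (h l - c l) * f l) = fun l => h l * f l := by ext l; ring
    rw [this, ← congr_apply, hGm, Matrix.diagonal_apply_eq]
  have b1 : |(G n).col k ⬝ᵥ toep n (fun l => c l * f l) *ᵥ (G n).col k| ≤ M := by
    refine abs_le_of_sq_le_sq ?_ hM0
    have := toep_cauchy_schwarz n hf.int (hf.int.const_mul (M ^ 2))
      (hf.integrable_mul_of_rpow hcm (hf.integrable_rpow_of_bounded hcm hM))
      (by filter_upwards [hf.ae_pos] with l hl using hl.le)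
      (by filter_upwards [hf.ae_pos] with l hl using by positivity)
      (by filter_upwards with l
          have : c l ^ 2 ≤ M ^ 2 := by
            rw [← sq_abs]; exact pow_le_pow_left₀ (abs_nonneg _) (hM l) 2
          nlinarith [mul_le_mul_of_nonneg_right this (sq_nonneg (f l))])
      ((G n).col k) ((G n).col k)
    rw [toep_const_mul, Matrix.smul_mulVec, dotProduct_smul, hgk] at this
    simpa using this
  have b2 : |(G n).col k ⬝ᵥ toep n (fun l => (h l - c l) * f l) *ᵥ (G n).col k|
      ≤ ε / 2 * Real.sqrt n := by
    refine abs_le_of_sq_le_sq ?_ (by positivity)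
    have h1 := hf.sq_form_col_sum_le n hdm hP (hG n)
    have h2 := Finset.single_le_sum (f := fun k =>
      ((G n)ᵀ * toep n (fun l => (h l - c l) * f l) * G n) k k ^ 2) (fun _ _ => sq_nonneg _)
      (Finset.mem_univ k)
    simp only [congr_apply] at h1 h2
    rw [mul_pow, Real.sq_sqrt hn0'.le]
    linarith
  rw [hsplit]
  refine (abs_add_le _ _).trans ?_
  linarith

end IsAdmissibleSymbol

section GaussianIntegral

open ProbabilityTheory

variable {n : ℕ} {S G : Matrix (Fin n) (Fin n) ℝ}

lemma qForm_eq_dotProduct (M : Matrix (Fin n) (Fin n) ℝ) (x : Fin n → ℝ) :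
    qForm M x = x ⬝ᵥ M *ᵥ x := by
  simp only [qForm, dotProduct, Matrix.mulVec, Finset.mul_sum, mul_assoc]

lemma qForm_mul_mul_transpose (G D : Matrix (Fin n) (Fin n) ℝ) (x : Fin n → ℝ) :
    qForm (G * D * Gᵀ) x = qForm D (Gᵀ *ᵥ x) := by
  rw [qForm_eq_dotProduct, qForm_eq_dotProduct, ← Matrix.mulVec_mulVec, ← Matrix.mulVec_mulVec,
    Matrix.dotProduct_mulVec, Matrix.mulVec_transpose]

lemma qForm_diagonal (m x : Fin n → ℝ) : qForm (Matrix.diagonal m) x = ∑ k, m k * x k ^ 2 := by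
  rw [qForm_eq_dotProduct]
  simp only [dotProduct, Matrix.mulVec_diagonal]
  exact Finset.sum_congr rfl fun k _ => by ring

lemma det_sq_mul_det_of_congr_one (hG : Gᵀ * S * G = 1) : G.det ^ 2 * S.det = 1 := by
  have := congrArg Matrix.det hG
  rw [Matrix.det_mul, Matrix.det_mul, Matrix.det_transpose, Matrix.det_one] at this
  linarith

lemma integral_gaussianPi_prod (hG : Gᵀ * S * G = 1) (g : Fin n → ℝ → ℂ) :
    ∫ x, ∏ k, g k ((Gᵀ *ᵥ x) k) ∂gaussianPi n S = ∏ k, ∫ z, g k z ∂gaussianReal 0 1 := by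
  have hdet := det_sq_mul_det_of_congr_one hG
  have hG0 : G.det ≠ 0 := by
    intro h; rw [h] at hdet; simp at hdet
  have hGt : Gᵀ.det ≠ 0 := by rwa [Matrix.det_transpose]
  have hq : ∀ x, qForm S⁻¹ x = ∑ k, (Gᵀ *ᵥ x) k ^ 2 := by
    intro x
    have h := qForm_mul_mul_transpose G (Matrix.diagonal fun _ => 1) x
    rw [qForm_diagonal, Matrix.diagonal_one, Matrix.mul_one] at h
    rw [inv_eq_mul_transpose_of_congr_one hG, h]
    simp
  have hmeas : Measurable fun x : Fin n → ℝ => Gᵀ *ᵥ x :=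
    (Continuous.matrix_mulVec continuous_const continuous_id).measurable
  have hS : S.det ^ (-(1 : ℝ) / 2) = |G.det| := by
    have h1 : S.det = (|G.det| ^ 2)⁻¹ := by
      rw [sq_abs]; exact eq_inv_of_mul_eq_one_right hdet
    have h0 : 0 < |G.det| := abs_pos.2 hG0
    rw [h1, Real.inv_rpow (by positivity), ← Real.rpow_natCast, ← Real.rpow_mul h0.le,
      ← Real.rpow_neg h0.le]
    norm_num
  unfold gaussianPi
  rw [integral_withDensity_eq_integral_toReal_smul]
  · simp only [hq]
    have hemb : MeasurableEmbedding (Matrix.toLin' Gᵀ) := by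
      have hc : Continuous (Matrix.toLin' Gᵀ) := LinearMap.continuous_of_finiteDimensional _
      refine hc.measurableEmbedding ?_
      intro x y hxy
      have hu : IsUnit Gᵀ := (Matrix.isUnit_iff_isUnit_det _).2 (isUnit_iff_ne_zero.2 hGt)
      exact Matrix.mulVec_injective_of_isUnit hu (by simpa using hxy)
    have hmap := hemb.integral_map (μ := volume) (fun z : Fin n → ℝ =>
      (ENNReal.ofReal ((2 * Real.pi) ^ (-(n : ℝ) / 2) * S.det ^ (-(1 : ℝ) / 2) *
        Real.exp (-(∑ k, z k ^ 2) / 2))).toReal • ∏ k, g k (z k))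
    simp only [Matrix.toLin'_apply] at hmap
    rw [← hmap, Real.map_matrix_volume_pi_eq_smul_volume_pi hGt, integral_smul_measure,
      Matrix.det_transpose, ENNReal.toReal_ofReal (abs_nonneg _)]
    have hpt : ∀ z : Fin n → ℝ, (ENNReal.ofReal ((2 * Real.pi) ^ (-(n : ℝ) / 2) *
        S.det ^ (-(1 : ℝ) / 2) * Real.exp (-(∑ k, z k ^ 2) / 2))).toReal • ∏ k, g k (z k)
        = |G.det| • ∏ k, (gaussianPDFReal 0 1 (z k) • g k (z k)) := by
      intro z
      rw [ENNReal.toReal_ofReal (by rw [hS]; positivity), hS]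
      simp only [Complex.real_smul, Finset.prod_mul_distrib]
      rw [← mul_assoc, ← Complex.ofReal_prod, ← Complex.ofReal_mul]
      congr 2
      rw [mul_comm ((2 * Real.pi) ^ (-(n : ℝ) / 2)), mul_assoc]
      congr 1
      simp only [gaussianPDFReal_def, Finset.prod_mul_distrib, ← Real.exp_sum]
      congr 1
      · simp only [NNReal.coe_one, mul_one, Finset.prod_const, Finset.card_univ, Fintype.card_fin]
        rw [Real.sqrt_eq_rpow, ← Real.rpow_neg (by positivity), ← Real.rpow_natCast,
          ← Real.rpow_mul (by positivity)]
        congr 1; ring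
      · simp [Finset.sum_div, Finset.sum_neg_distrib, neg_div]
    simp_rw [hpt]
    rw [integral_smul, integral_fintype_prod_volume_eq_prod
      (fun k z => gaussianPDFReal 0 1 z • g k z), smul_smul, abs_inv,
      inv_mul_cancel₀ (abs_ne_zero.2 hG0), one_smul]
    exact Finset.prod_congr rfl fun k _ =>
      (integral_gaussianReal_eq_integral_smul one_ne_zero).symm
  · refine ENNReal.measurable_ofReal.comp (measurable_const.mul (Real.measurable_exp.comp ?_))
    simp only [hq]
    refine Measurable.div_const (Measurable.neg ?_) _
    exact Finset.measurable_sum _ fun k _ => ((measurable_pi_apply k).comp hmeas).pow_const 2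
  · simp

lemma isProbabilityMeasure_gaussianPi (hG : Gᵀ * S * G = 1) :
    IsProbabilityMeasure (gaussianPi n S) := by
  have h := integral_gaussianPi_prod hG (fun _ _ => 1)
  simp only [Finset.prod_const_one, integral_const, probReal_univ, one_smul] at h
  have h2 : (gaussianPi n S).real Set.univ = 1 := by
    have := congrArg Complex.re h
    simpa using this
  constructor
  rw [measureReal_def] at h2
  exact (ENNReal.toReal_eq_one_iff _).1 h2

lemma charFun_map_gaussianPi (hG : Gᵀ * S * G = 1) {X : (Fin n → ℝ) → ℝ} (hX : Measurable X)
    (a : Fin n → ℝ) (hXa : ∀ x, X x = ∑ k, a k * ((Gᵀ *ᵥ x) k ^ 2 - 1)) (s : ℝ) :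
    charFun ((gaussianPi n S).map X) s
      = ∏ k, charFun ((gaussianReal 0 1).map fun z => z ^ 2 - 1) (s * a k) := by
  have hc : ∀ t : ℝ, Continuous fun y : ℝ => Complex.exp (t * y * Complex.I) := by
    intro t; fun_prop
  rw [charFun_apply_real, integral_map hX.aemeasurable (hc s).aestronglyMeasurable]
  have : ∀ x, Complex.exp (s * X x * Complex.I)
      = ∏ k, Complex.exp (((s * a k : ℝ) : ℂ) * (((Gᵀ *ᵥ x) k ^ 2 - 1 : ℝ) : ℂ) * Complex.I) := by
    intro x
    rw [← Complex.exp_sum, hXa, ← Finset.sum_mul]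
    congr 2
    rw [← Complex.ofReal_mul, Finset.mul_sum]
    push_cast
    exact Finset.sum_congr rfl fun k _ => by ring
  simp_rw [this]
  rw [integral_gaussianPi_prod hG
    (fun k z => Complex.exp (((s * a k : ℝ) : ℂ) * ((z ^ 2 - 1 : ℝ) : ℂ) * Complex.I))]
  refine Finset.prod_congr rfl fun k _ => ?_
  rw [charFun_apply_real, integral_map (by fun_prop) (hc _).aestronglyMeasurable]

end GaussianIntegral

section ChiSquare

open ProbabilityTheory

lemma integral_even_pow_gaussianReal (k : ℕ) :
    ∫ z, z ^ (2 * k) ∂gaussianReal 0 1 = ((2 * k - 1).doubleFactorial : ℝ) := by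
  rw [integral_gaussianReal_eq_integral_smul one_ne_zero]
  have h1 : ∀ x : ℝ, gaussianPDFReal 0 1 x • x ^ (2 * k)
      = (fun y : ℝ => (√(2 * Real.pi))⁻¹ * (y ^ ((2 * k : ℕ) : ℝ) *
        Real.exp (-(1 / 2) * y ^ (2 : ℝ)))) |x| := by
    intro x
    simp only [gaussianPDFReal_def, smul_eq_mul, NNReal.coe_one, mul_one, sub_zero]
    rw [Real.rpow_natCast, Even.pow_abs (even_two_mul k), Real.rpow_two, sq_abs]
    ring_nf
  simp_rw [h1]
  rw [integral_comp_abs (f := fun y : ℝ => (√(2 * Real.pi))⁻¹ * (y ^ ((2 * k : ℕ) : ℝ) *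
        Real.exp (-(1 / 2) * y ^ (2 : ℝ)))), integral_const_mul, integral_rpow_mul_exp_neg_mul_rpow (by norm_num)
    (by have : (0 : ℝ) ≤ ((2 * k : ℕ) : ℝ) := Nat.cast_nonneg _
        linarith) (by norm_num)]
  have h2 : (((2 * k : ℕ) : ℝ) + 1) / 2 = k + 1 / 2 := by push_cast; ring
  rw [neg_div, h2, Real.Gamma_nat_add_half, neg_add, Real.rpow_add (by norm_num), one_div,
    Real.inv_rpow (by norm_num), Real.inv_rpow (by norm_num), Real.rpow_neg (by norm_num),
    Real.rpow_neg (by norm_num), Real.rpow_natCast, Real.sqrt_mul (by norm_num), inv_inv, inv_inv,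
    show (2 : ℝ) ^ (2⁻¹ : ℝ) = √2 by rw [Real.sqrt_eq_rpow, one_div]]
  have := Real.sqrt_pos.2 Real.pi_pos
  field_simp

lemma integrable_pow_gaussianReal (k : ℕ) : Integrable (fun z => z ^ k) (gaussianReal 0 1) := by
  have := (memLp_id_gaussianReal (μ := 0) (v := 1) (k : NNReal)).integrable_norm_pow'
  rw [← integrable_norm_iff (by fun_prop)]
  simpa using this

lemma charFun_sq_sub_one_isLittleO :
    (fun t : ℝ => charFun ((gaussianReal 0 1).map fun z => z ^ 2 - 1) t
      - Complex.exp (-(t ^ 2 : ℝ))) =o[𝓝 0] fun t => t ^ 2 := by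
  have hi2 := integrable_pow_gaussianReal 2
  have hi4 := integrable_pow_gaussianReal 4
  have m2 := integral_even_pow_gaussianReal 1
  have m4 := integral_even_pow_gaussianReal 2
  norm_num [Nat.doubleFactorial] at m2 m4
  have h2 : √2 ^ 2 = (2 : ℝ) := Real.sq_sqrt (by norm_num)
  have hs : √2 ≠ 0 := by positivity
  have key := taylor_charFun_two (P := gaussianReal 0 1) (X := fun z => (√2)⁻¹ * (z ^ 2 - 1))
    (by fun_prop)
    (by rw [integral_const_mul, integral_sub hi2 (integrable_const _), m2]; simp)
    (by
      have : ∀ x : ℝ, ((fun z : ℝ => (√2)⁻¹ * (z ^ 2 - 1)) ^ 2) x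
          = 1 / 2 * (x ^ 4 - 2 * x ^ 2 + 1) := by
        intro x; simp only [Pi.pow_apply, mul_pow, inv_pow, h2]; ring
      simp_rw [this]
      have hi : Integrable (fun z : ℝ => z ^ 4 - 2 * z ^ 2) (gaussianReal 0 1) :=
        hi4.sub (hi2.const_mul 2)
      rw [integral_const_mul, integral_add hi (integrable_const _),
        integral_sub hi4 (hi2.const_mul 2), integral_const_mul, m2, m4]
      norm_num)
  have hlim : Tendsto (fun t : ℝ => √2 * t) (𝓝 0) (𝓝 0) := by
    have : Continuous fun t : ℝ => √2 * t := by fun_prop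
    simpa using this.tendsto 0
  have key2 := key.comp_tendsto hlim
  have e1 : (fun t : ℝ => charFun ((gaussianReal 0 1).map fun z => z ^ 2 - 1) t
      - (1 - ((t ^ 2 : ℝ) : ℂ))) =o[𝓝 0] fun t => t ^ 2 := by
    have : (fun t : ℝ => (√2 * t) ^ 2) =O[𝓝 0] fun t => t ^ 2 := by
      simp_rw [mul_pow]
      exact Asymptotics.isBigO_const_mul_self _ _ _
    refine (key2.trans_isBigO this).congr_left fun t => ?_
    simp only [Function.comp_apply]
    congr 1
    · have : (gaussianReal 0 1).map (fun z => (√2)⁻¹ * (z ^ 2 - 1))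
          = ((gaussianReal 0 1).map fun z => z ^ 2 - 1).map ((√2)⁻¹ * ·) := by
        rw [Measure.map_map (by fun_prop) (by fun_prop)]; rfl
      rw [this, charFun_map_mul, inv_mul_cancel_left₀ hs]
    · rw [← Complex.ofReal_pow, mul_pow, h2]; push_cast; ring
  have e2 : (fun t : ℝ => Complex.exp (-(t ^ 2 : ℝ)) - 1 - (-((t ^ 2 : ℝ) : ℂ)))
      =o[𝓝 0] fun t : ℝ => t ^ 2 := by
    have h := Complex.hasDerivAt_exp 0
    rw [hasDerivAt_iff_isLittleO] at h
    have hl : Tendsto (fun t : ℝ => (-(t ^ 2 : ℝ) : ℂ)) (𝓝 0) (𝓝 0) := by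
      have : Continuous (fun t : ℝ => (-(t ^ 2 : ℝ) : ℂ)) := by fun_prop
      simpa using this.tendsto 0
    have := h.comp_tendsto hl
    simp only [Function.comp_def, sub_zero, Complex.exp_zero, smul_eq_mul, mul_one] at this
    refine this.trans_isBigO (Asymptotics.isBigO_of_le _ fun t => ?_)
    simp
  refine (e1.sub e2).congr_left fun t => ?_
  ring

lemma norm_prod_sub_prod_le {ι : Type*} (s : Finset ι) {u v : ι → ℂ} (hu : ∀ i, ‖u i‖ ≤ 1)
    (hv : ∀ i, ‖v i‖ ≤ 1) : ‖∏ i ∈ s, u i - ∏ i ∈ s, v i‖ ≤ ∑ i ∈ s, ‖u i - v i‖ := by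
  classical
  induction s using Finset.induction_on with
  | empty => simp
  | insert a s ha ih =>
    rw [Finset.prod_insert ha, Finset.prod_insert ha, Finset.sum_insert ha]
    have : u a * ∏ i ∈ s, u i - v a * ∏ i ∈ s, v i
        = (u a - v a) * ∏ i ∈ s, u i + v a * (∏ i ∈ s, u i - ∏ i ∈ s, v i) := by ring
    rw [this]
    refine (norm_add_le _ _).trans (add_le_add ?_ ?_)
    · rw [norm_mul, norm_prod]
      exact mul_le_of_le_one_right (norm_nonneg _)
        (Finset.prod_le_one (fun _ _ => norm_nonneg _) fun i _ => hu i)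
    · rw [norm_mul]
      exact (mul_le_of_le_one_left (norm_nonneg _) (hv a)).trans ih

lemma tendsto_prod_charFun {m : ∀ n : ℕ, Fin n → ℝ} {v : ℝ}
    (hv : Tendsto (fun n : ℕ => (∑ k, m n k ^ 2) / n) atTop (𝓝 v))
    (hmax : ∀ ε > 0, ∀ᶠ n : ℕ in atTop, ∀ k, |m n k| ≤ ε * √n) (s : ℝ) :
    Tendsto (fun n : ℕ => ∏ k, charFun ((gaussianReal 0 1).map fun z => z ^ 2 - 1)
      (s * (m n k / √n))) atTop (𝓝 (Complex.exp (-(s ^ 2 * v : ℝ)))) := by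
  set φ := charFun ((gaussianReal 0 1).map fun z => z ^ 2 - 1) with hφ
  have : IsProbabilityMeasure ((gaussianReal 0 1).map fun z => z ^ 2 - 1) :=
    Measure.isProbabilityMeasure_map (by fun_prop)
  have hsum : Tendsto (fun n : ℕ => ∑ k, (s * (m n k / √n)) ^ 2) atTop (𝓝 (s ^ 2 * v)) := by
    refine (hv.const_mul (s ^ 2)).congr fun n => ?_
    rw [Finset.sum_div, Finset.mul_sum]
    refine Finset.sum_congr rfl fun k _ => ?_
    rw [mul_pow, div_pow, Real.sq_sqrt n.cast_nonneg]
  have hg : Tendsto (fun n : ℕ => ∏ k, Complex.exp (-((s * (m n k / √n)) ^ 2 : ℝ))) atTop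
      (𝓝 (Complex.exp (-(s ^ 2 * v : ℝ)))) := by
    have hcont : Continuous fun x : ℝ => Complex.exp (-(x : ℂ)) := by fun_prop
    refine ((hcont.tendsto _).comp hsum).congr fun n => ?_
    simp only [Function.comp_apply]
    rw [← Complex.exp_sum, Finset.sum_neg_distrib, Complex.ofReal_sum]
  have hd : Tendsto (fun n : ℕ => ∏ k, φ (s * (m n k / √n))
      - ∏ k, Complex.exp (-((s * (m n k / √n)) ^ 2 : ℝ))) atTop (𝓝 0) := by
    rw [Metric.tendsto_nhds]
    intro ε hε
    obtain ⟨c, hc0, hc⟩ : ∃ c > 0, c * (s ^ 2 * v + 1) < ε := by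
      have hv0 : 0 ≤ s ^ 2 * v := ge_of_tendsto' hsum fun n =>
        Finset.sum_nonneg fun _ _ => sq_nonneg _
      refine ⟨ε / (2 * (s ^ 2 * v + 1)), by positivity, ?_⟩
      field_simp
      norm_num
    have hlo := (charFun_sq_sub_one_isLittleO.def hc0)
    rw [Metric.eventually_nhds_iff] at hlo
    obtain ⟨δ, hδ, hlo⟩ := hlo
    filter_upwards [hmax (δ / (2 * (|s| + 1))) (by positivity),
      hsum.eventually_lt_const (lt_add_one _), eventually_gt_atTop 0] with n hn hsn hn0
    rw [dist_zero_right]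
    refine lt_of_le_of_lt (norm_prod_sub_prod_le _ (fun i => norm_charFun_le_one _)
      fun i => ?_) ?_
    · rw [Complex.norm_exp]
      simp only [Complex.neg_re, Complex.ofReal_re, Real.exp_le_one_iff, neg_nonpos]
      exact sq_nonneg _
    · refine lt_of_le_of_lt (Finset.sum_le_sum (g := fun k => c * (s * (m n k / √n)) ^ 2)
        fun k _ => ?_) ?_
      · have h3 : dist (s * (m n k / √n)) 0 < δ := by
          rw [dist_zero_right, Real.norm_eq_abs, abs_mul, abs_div, abs_of_nonneg (Real.sqrt_nonneg _)]
          have hsq : 0 < √(n : ℝ) := Real.sqrt_pos.2 (by exact_mod_cast hn0)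
          have : |m n k| / √n ≤ δ / (2 * (|s| + 1)) := by
            rw [div_le_iff₀ hsq]; exact hn k
          calc |s| * (|m n k| / √n) ≤ |s| * (δ / (2 * (|s| + 1))) :=
                mul_le_mul_of_nonneg_left this (abs_nonneg _)
            _ ≤ (|s| + 1) * (δ / (2 * (|s| + 1))) := by
                refine mul_le_mul_of_nonneg_right (by linarith) (by positivity)
            _ = δ / 2 := by field_simp
            _ < δ := by linarith
        have := hlo h3
        rwa [Real.norm_of_nonneg (sq_nonneg (s * (m n k / √n)))] at this
      · rw [← Finset.mul_sum]
        exact lt_of_le_of_lt (mul_le_mul_of_nonneg_left hsn.le hc0.le) hc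
  simpa using hd.add hg

/-- Central limit theorem for centered quadratic forms in Gaussian vectors, written in
coordinates diagonalizing the form. -/
theorem tendstoInLaw_quadratic {S G : ∀ n : ℕ, Matrix (Fin n) (Fin n) ℝ}
    (hG : ∀ n, (G n)ᵀ * S n * G n = 1) {X : ∀ n : ℕ, (Fin n → ℝ) → ℝ}
    (hX : ∀ n, Measurable (X n)) {m : ∀ n : ℕ, Fin n → ℝ}
    (hXm : ∀ n x, X n x = ∑ k, m n k / √n * (((G n)ᵀ *ᵥ x) k ^ 2 - 1)) {v : ℝ}
    (hv : Tendsto (fun n : ℕ => (∑ k, m n k ^ 2) / n) atTop (𝓝 v))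
    (hmax : ∀ ε > 0, ∀ᶠ n : ℕ in atTop, ∀ k, |m n k| ≤ ε * √n) :
    TendstoInLaw (fun n => (gaussianPi n (S n)).map (X n))
      (gaussianReal 0 (2 * v).toNNReal) := by
  have hP : ∀ n, IsProbabilityMeasure ((gaussianPi n (S n)).map (X n)) := fun n =>
    have := isProbabilityMeasure_gaussianPi (hG n)
    Measure.isProbabilityMeasure_map (hX n).aemeasurable
  let μ : ℕ → ProbabilityMeasure ℝ := fun n => ⟨_, hP n⟩
  let ν : ProbabilityMeasure ℝ := ⟨gaussianReal 0 (2 * v).toNNReal, inferInstance⟩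
  have hv0 : 0 ≤ v := ge_of_tendsto' hv fun n =>
    div_nonneg (Finset.sum_nonneg fun _ _ => sq_nonneg _) n.cast_nonneg
  have : Tendsto μ atTop (𝓝 ν) := by
    rw [ProbabilityMeasure.tendsto_iff_tendsto_charFun]
    intro s
    have h := tendsto_prod_charFun hv hmax s
    have e : charFun (ν : Measure ℝ) s = Complex.exp (-(s ^ 2 * v : ℝ)) := by
      change charFun (gaussianReal 0 (2 * v).toNNReal) s = _
      rw [charFun_gaussianReal, Real.coe_toNNReal _ (by positivity)]
      push_cast; ring_nf
    rw [e]
    refine h.congr fun n => ?_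
    exact (charFun_map_gaussianPi (hG n) (hX n) _ (hXm n) s).symm
  exact ProbabilityMeasure.tendsto_iff_forall_integral_tendsto.1 this

end ChiSquare

section FractionalIntegral

open Set

lemma integral_Ioi_swap {f : ℝ → ℝ → ℝ} (hf : Measurable (Function.uncurry f)) {A B : ℝ → ℝ}
    (h0 : ∀ x > 0, ∀ t > 0, 0 ≤ f x t)
    (hA : ∀ x > 0, IntegrableOn (f x) (Ioi 0) ∧ ∫ t in Ioi 0, f x t = A x)
    (hB : ∀ t > 0, IntegrableOn (fun x => f x t) (Ioi 0) ∧ ∫ x in Ioi 0, f x t = B t)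
    (hBi : IntegrableOn B (Ioi 0)) (hAm : Measurable A) :
    IntegrableOn A (Ioi 0) ∧ ∫ x in Ioi 0, A x = ∫ t in Ioi 0, B t := by
  have hA0 : ∀ x > 0, 0 ≤ A x := fun x hx => by
    rw [← (hA x hx).2]; exact setIntegral_nonneg measurableSet_Ioi fun t ht => h0 x hx t ht
  have hB0 : ∀ t > 0, 0 ≤ B t := fun t ht => by
    rw [← (hB t ht).2]; exact setIntegral_nonneg measurableSet_Ioi fun x hx => h0 x hx t ht
  have hA0' : 0 ≤ᵐ[volume.restrict (Ioi 0)] A :=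
    (ae_restrict_iff' measurableSet_Ioi).2 (Eventually.of_forall hA0)
  have hB0' : 0 ≤ᵐ[volume.restrict (Ioi 0)] B :=
    (ae_restrict_iff' measurableSet_Ioi).2 (Eventually.of_forall hB0)
  have key : ∫⁻ x in Ioi 0, ENNReal.ofReal (A x) = ∫⁻ t in Ioi 0, ENNReal.ofReal (B t) := by
    calc ∫⁻ x in Ioi 0, ENNReal.ofReal (A x)
        = ∫⁻ x in Ioi 0, ∫⁻ t in Ioi 0, ENNReal.ofReal (f x t) := by
          refine setLIntegral_congr_fun measurableSet_Ioi fun x hx => ?_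
          rw [← (hA x hx).2, ofReal_integral_eq_lintegral_ofReal (hA x hx).1]
          exact (ae_restrict_iff' measurableSet_Ioi).2 (Eventually.of_forall (h0 x hx))
      _ = ∫⁻ t in Ioi 0, ∫⁻ x in Ioi 0, ENNReal.ofReal (f x t) :=
          lintegral_lintegral_swap (ENNReal.measurable_ofReal.comp hf).aemeasurable
      _ = ∫⁻ t in Ioi 0, ENNReal.ofReal (B t) := by
          refine setLIntegral_congr_fun measurableSet_Ioi fun t ht => ?_
          rw [← (hB t ht).2, ofReal_integral_eq_lintegral_ofReal (hB t ht).1]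
          exact (ae_restrict_iff' measurableSet_Ioi).2
            (Eventually.of_forall fun x hx => h0 x hx t ht)
  have hAi : IntegrableOn A (Ioi 0) := by
    refine ⟨hAm.aestronglyMeasurable, ?_⟩
    rw [hasFiniteIntegral_iff_ofReal hA0', key]
    exact (hasFiniteIntegral_iff_ofReal hB0').1 hBi.2
  refine ⟨hAi, ?_⟩
  rw [integral_eq_lintegral_of_nonneg_ae hA0' hAm.aestronglyMeasurable, key,
    ← integral_eq_lintegral_of_nonneg_ae hB0' hBi.1]

lemma integrableOn_and_integral_eq {f : ℝ → ℝ} {s : Set ℝ} {c : ℝ} (h : ∫ x in s, f x = c)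
    (hc : c ≠ 0) : IntegrableOn f s ∧ ∫ x in s, f x = c :=
  ⟨by_contra fun hf => hc (by rw [← h]; exact integral_undef hf), h⟩

lemma integral_rpow_div_one_add_sq {H : ℝ} (hH : H ∈ Ioo (0 : ℝ) 1) :
    IntegrableOn (fun t : ℝ => t ^ (2 * H - 1) / (1 + t ^ 2)) (Ioi 0) ∧
      ∫ t in Ioi 0, t ^ (2 * H - 1) / (1 + t ^ 2) = Real.pi / (2 * Real.sin (Real.pi * H)) := by
  obtain ⟨h0, h1⟩ := hH
  have hG : 0 < Real.Gamma H := Real.Gamma_pos_of_pos h0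
  have hG1 : 0 < Real.Gamma (1 - H) := Real.Gamma_pos_of_pos (by linarith)
  have hBint := integrableOn_and_integral_eq
    (Real.integral_rpow_mul_exp_neg_mul_Ioi (a := 1 - H) (r := 1) (by linarith) one_pos)
    (by simp [hG1.ne'])
  have hB : IntegrableOn (fun u : ℝ => 1 / 2 * Real.Gamma H *
      (u ^ (1 - H - 1) * Real.exp (-(1 * u)))) (Ioi 0) ∧
      ∫ u in Ioi 0, 1 / 2 * Real.Gamma H * (u ^ (1 - H - 1) * Real.exp (-(1 * u)))
        = Real.pi / (2 * Real.sin (Real.pi * H)) := by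
    refine ⟨hBint.1.const_mul _, ?_⟩
    rw [integral_const_mul, hBint.2, div_one, Real.one_rpow, one_mul]
    have := Real.Gamma_mul_Gamma_one_sub H
    rw [mul_assoc, this, div_mul_eq_mul_div, one_mul, div_div, mul_comm]
  rw [← hB.2]
  refine integral_Ioi_swap (f := fun t u => t ^ (2 * H - 1) * Real.exp (-((1 + t ^ 2) * u)))
    ?_ ?_ ?_ ?_ hB.1 ?_
  · simp only [Function.uncurry_def]; fun_prop
  · intro x hx t _; positivity
  · intro t ht
    have ht' : (0 : ℝ) < t := ht
    have := integrableOn_and_integral_eq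
      (Real.integral_rpow_mul_exp_neg_mul_Ioi (a := 1) (r := 1 + t ^ 2) one_pos (by positivity))
      (by rw [Real.Gamma_one, Real.rpow_one]; positivity)
    simp only [sub_self, Real.rpow_zero, one_mul, Real.rpow_one, Real.Gamma_one, mul_one] at this
    refine ⟨this.1.const_mul _, ?_⟩
    rw [integral_const_mul, this.2, mul_one_div]
  · intro u hu
    have hu' : (0 : ℝ) < u := hu
    have := integrableOn_and_integral_eq (integral_rpow_mul_exp_neg_mul_rpow (p := 2)
      (q := 2 * H - 1) (b := u) two_pos (by linarith) hu')
      (by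
        have e : (2 * H - 1 + 1) / 2 = H := by ring
        rw [e]; positivity)
    have e : (fun t : ℝ => t ^ (2 * H - 1) * Real.exp (-((1 + t ^ 2) * u)))
        = fun t => Real.exp (-u) * (t ^ (2 * H - 1) * Real.exp (-u * t ^ (2 : ℝ))) := by
      ext t
      rw [mul_left_comm, ← Real.exp_add, Real.rpow_two]
      congr 2; ring
    rw [e]
    refine ⟨this.1.const_mul _, ?_⟩
    rw [integral_const_mul, this.2]
    have e1 : (2 * H - 1 + 1) / 2 = H := by ring
    have e2 : -(2 * H - 1 + 1) / 2 = 1 - H - 1 := by ring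
    rw [e1, e2, one_mul]; ring
  · fun_prop

lemma integral_one_sub_cos_mul_exp {t : ℝ} (ht : 0 < t) :
    IntegrableOn (fun x : ℝ => (1 - Real.cos x) * Real.exp (-(t * x))) (Ioi 0) ∧
      ∫ x in Ioi 0, (1 - Real.cos x) * Real.exp (-(t * x)) = 1 / (t * (1 + t ^ 2)) := by
  have h1 := integrableOn_and_integral_eq
    (Real.integral_rpow_mul_exp_neg_mul_Ioi (a := 1) (r := t) one_pos ht)
    (by rw [Real.Gamma_one, Real.rpow_one]; positivity)
  simp only [sub_self, Real.rpow_zero, one_mul, Real.rpow_one, Real.Gamma_one, mul_one] at h1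
  have hre : (-(t : ℂ) + Complex.I).re < 0 := by simpa using ht
  have h2i := integrableOn_exp_mul_complex_Ioi hre 0
  have h2 := integral_exp_mul_complex_Ioi hre 0
  have h3 : ∀ x : ℝ, (Complex.exp ((-(t : ℂ) + Complex.I) * x)).re
      = Real.cos x * Real.exp (-(t * x)) := by
    intro x
    rw [Complex.exp_re]
    simp [mul_comm]
  have h4 := integral_re (𝕜 := ℂ) h2i
  simp only [RCLike.re_to_complex, h3] at h4
  have h2ire := h2i.re
  simp only [RCLike.re_to_complex, h3] at h2ire
  rw [h2] at h4
  have h5 : (-Complex.exp ((-(t : ℂ) + Complex.I) * (0 : ℝ)) / (-(t : ℂ) + Complex.I)).re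
      = t / (1 + t ^ 2) := by
    simp [Complex.div_re, Complex.normSq_apply]
    ring
  rw [h5] at h4
  simp only [sub_mul, one_mul]
  refine ⟨h1.1.sub h2ire, ?_⟩
  rw [integral_sub h1.1 h2ire, h1.2, h4]
  field_simp
  ring

lemma integral_one_sub_cos_mul_rpow {H : ℝ} (hH : H ∈ Ioo (0 : ℝ) 1) :
    IntegrableOn (fun x : ℝ => (1 - Real.cos x) * x ^ (-2 * H - 1)) (Ioi 0) ∧
      ∫ x in Ioi 0, (1 - Real.cos x) * x ^ (-2 * H - 1)
        = Real.pi / (2 * Real.Gamma (2 * H + 1) * Real.sin (Real.pi * H)) := by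
  have hB := integral_rpow_div_one_add_sq hH
  obtain ⟨h0, h1⟩ := hH
  have hG : 0 < Real.Gamma (2 * H + 1) := Real.Gamma_pos_of_pos (by linarith)
  have key := integral_Ioi_swap
    (f := fun x t => (1 - Real.cos x) * t ^ (2 * H) * Real.exp (-(x * t)))
    (A := fun x => Real.Gamma (2 * H + 1) * ((1 - Real.cos x) * x ^ (-2 * H - 1)))
    (B := fun t => t ^ (2 * H - 1) / (1 + t ^ 2))
    (by simp only [Function.uncurry_def]; fun_prop) ?_ ?_ ?_ hB.1 (by fun_prop)
  · rw [hB.2, integral_const_mul] at key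
    refine ⟨?_, ?_⟩
    · have := key.1.const_mul (Real.Gamma (2 * H + 1))⁻¹
      refine this.congr (Eventually.of_forall fun x => ?_)
      simp only [inv_mul_cancel_left₀ hG.ne']
    · rw [← mul_right_inj' hG.ne', key.2]
      field_simp
  · intro x _ t ht
    have := Real.cos_le_one x
    have : 0 ≤ 1 - Real.cos x := by linarith
    have ht' : (0 : ℝ) < t := ht
    positivity
  · intro x hx
    have hx' : (0 : ℝ) < x := hx
    have := integrableOn_and_integral_eq
      (Real.integral_rpow_mul_exp_neg_mul_Ioi (a := 2 * H + 1) (r := x) (by linarith) hx)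
      (by positivity)
    rw [add_sub_cancel_right] at this
    simp only [mul_assoc]
    refine ⟨(this.1.const_mul _), ?_⟩
    rw [integral_const_mul, this.2, one_div, Real.inv_rpow hx'.le, ← Real.rpow_neg hx'.le]
    ring_nf
  · intro t ht
    have ht' : (0 : ℝ) < t := ht
    have := integral_one_sub_cos_mul_exp ht'
    have e : (fun x : ℝ => (1 - Real.cos x) * t ^ (2 * H) * Real.exp (-(x * t)))
        = fun x => t ^ (2 * H) * ((1 - Real.cos x) * Real.exp (-(t * x))) := by
      ext x; rw [mul_comm x t]; ring
    rw [e]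
    refine ⟨this.1.const_mul _, ?_⟩
    rw [integral_const_mul, this.2, Real.rpow_sub_one ht'.ne']
    field_simp

end FractionalIntegral

section Spectral

open Set

lemma integrable_comp_abs_of_integrableOn {f : ℝ → ℝ} (hf : IntegrableOn f (Ioi 0)) :
    Integrable fun x => f |x| := by
  have h1 : IntegrableOn (fun x => f |x|) (Ioi 0) :=
    hf.congr_fun (fun x hx => by rw [abs_of_pos hx]) measurableSet_Ioi
  have h2 : IntegrableOn (fun x => f |x|) (Iic 0) := by
    rw [integrableOn_Iic_iff_integrableOn_Iio,
      ← (Measure.measurePreserving_neg (volume : Measure ℝ)).integrableOn_comp_preimage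
        (Homeomorph.neg ℝ).measurableEmbedding]
    simpa [Function.comp_def] using h1
  rw [← integrableOn_univ, ← Iic_union_Ioi (a := (0 : ℝ))]
  exact h2.union h1

lemma setIntegral_even {P : ℝ → ℝ} (hP : ∀ x, P (-x) = P x) (a : ℝ) :
    ∫ x in Ioc (-a) a, P x = 2 * ∫ x in Ioc 0 a, P x := by
  have h := integral_comp_abs (f := (Iic a).indicator P)
  have e : ∀ x, (Iic a).indicator P |x| = (Icc (-a) a).indicator P x := by
    intro x
    have hx : P |x| = P x := by
      rcases abs_choice x with h | h <;> rw [h]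
      exact hP x
    by_cases hx2 : |x| ≤ a
    · rw [indicator_of_mem (show |x| ∈ Iic a from hx2),
        indicator_of_mem (show x ∈ Icc (-a) a from abs_le.1 hx2), hx]
    · rw [indicator_of_notMem (show |x| ∉ Iic a from hx2),
        indicator_of_notMem (show x ∉ Icc (-a) a from fun h => hx2 (abs_le.2 h))]
  simp_rw [e] at h
  rw [integral_indicator measurableSet_Icc, setIntegral_indicator measurableSet_Iic,
    Ioi_inter_Iic, integral_Icc_eq_integral_Ioc] at h
  exact h

lemma integral_eq_setIntegral_tsum_two_pi {F : ℝ → ℝ} (hF : Integrable F) :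
    ∫ x, F x = ∫ l in Ioc (-Real.pi) Real.pi, ∑' k : ℤ, F (l + 2 * (k : ℝ) * Real.pi) := by
  have hpi := Real.pi_pos
  have key : ∀ {F : ℝ → ℝ}, Integrable F → HasSum
      (fun k : ℤ => ∫ l in Ioc (-Real.pi) Real.pi, F (l + 2 * (k : ℝ) * Real.pi)) (∫ x, F x) := by
    intro F hF
    have hG : Integrable fun u => F (2 * Real.pi * u) := hF.comp_mul_left' (by positivity)
    have h := (hG.hasSum_intervalIntegral (-1 / 2)).mul_left (2 * Real.pi)
    have e : 2 * Real.pi * ∫ u, F (2 * Real.pi * u) = ∫ x, F x := by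
      rw [Measure.integral_comp_mul_left, smul_eq_mul, abs_inv, abs_of_pos (by positivity),
        mul_inv_cancel_left₀ (by positivity)]
    rw [e] at h
    have e2 : ∀ k : ℤ, ∫ l in Ioc (-Real.pi) Real.pi, F (l + 2 * (k : ℝ) * Real.pi)
        = 2 * Real.pi * ∫ u in (-1 / 2 + (k : ℝ))..(-1 / 2 + (k : ℝ) + 1), F (2 * Real.pi * u) := by
      intro k
      rw [intervalIntegral.integral_comp_mul_left _ (by positivity), smul_eq_mul,
        mul_inv_cancel_left₀ (by positivity), ← intervalIntegral.integral_of_le (by linarith),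
        intervalIntegral.integral_comp_add_right]
      congr 1 <;> ring
    simpa only [e2] using h
  have h2 := hasSum_integral_of_summable_integral_norm
    (μ := volume.restrict (Ioc (-Real.pi) Real.pi))
    (F := fun (k : ℤ) l => F (l + 2 * (k : ℝ) * Real.pi))
    (fun k => (hF.comp_add_right _).integrableOn) (key hF.norm).summable
  exact (key hF).unique h2

/-- The normalizing constant of the spectral density. -/
def specConst (H : ℝ) : ℝ := Real.Gamma (2 * H + 1) * Real.sin (Real.pi * H) / (2 * Real.pi)

lemma specConst_pos {H : ℝ} (hH : H ∈ Ioo (0 : ℝ) 1) : 0 < specConst H := by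
  have h1 : 0 < Real.Gamma (2 * H + 1) := Real.Gamma_pos_of_pos (by linarith [hH.1])
  have h2 : 0 < Real.sin (Real.pi * H) := Real.sin_pos_of_pos_of_lt_pi
    (mul_pos Real.pi_pos hH.1) (by nlinarith [Real.pi_pos, hH.2])
  have := Real.pi_pos
  unfold specConst; positivity

lemma integral_one_sub_cos_mul_abs_rpow {H : ℝ} (hH : H ∈ Ioo (0 : ℝ) 1) (m : ℝ) :
    Integrable (fun x : ℝ => (1 - Real.cos (m * x)) * |x| ^ (-2 * H - 1)) ∧
      2 * specConst H * ∫ x : ℝ, (1 - Real.cos (m * x)) * |x| ^ (-2 * H - 1) = |m| ^ (2 * H) := by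
  have hpi := Real.pi_pos
  have hI := integral_one_sub_cos_mul_rpow hH
  have hc := specConst_pos hH
  have hH0 := hH.1
  rcases eq_or_ne m 0 with rfl | hm
  · simp [Real.zero_rpow (by linarith : 2 * H ≠ 0)]
  have hm0 : 0 < |m| := abs_pos.2 hm
  set g : ℝ → ℝ := fun x => (1 - Real.cos x) * x ^ (-2 * H - 1) with hg
  have e1 : EqOn (fun x => |m| ^ (2 * H + 1) * g (|m| * x))
      (fun x => (1 - Real.cos (m * x)) * x ^ (-2 * H - 1)) (Ioi 0) := by
    intro x hx
    have hx' : (0 : ℝ) < x := hx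
    have e : Real.cos (|m| * x) = Real.cos (m * x) := by
      rw [← Real.cos_abs (m * x), abs_mul, abs_of_pos hx']
    simp only [hg]
    rw [e, Real.mul_rpow hm0.le hx'.le, show -2 * H - 1 = -(2 * H + 1) by ring,
      Real.rpow_neg hm0.le]
    field_simp
  have hgi : IntegrableOn (fun x => g (|m| * x)) (Ioi 0) :=
    (integrableOn_Ioi_comp_mul_left_iff g 0 hm0).2 (by simpa using hI.1)
  have h1 : IntegrableOn (fun x => (1 - Real.cos (m * x)) * x ^ (-2 * H - 1)) (Ioi 0) :=
    IntegrableOn.congr_fun (hgi.const_mul _) e1 measurableSet_Ioi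
  have h2 : ∫ x in Ioi 0, (1 - Real.cos (m * x)) * x ^ (-2 * H - 1)
      = |m| ^ (2 * H) * (Real.pi / (2 * Real.Gamma (2 * H + 1) * Real.sin (Real.pi * H))) := by
    rw [← setIntegral_congr_fun measurableSet_Ioi e1, integral_const_mul,
      integral_comp_mul_left_Ioi g 0 hm0, mul_zero, hI.2, smul_eq_mul, Real.rpow_add_one hm0.ne']
    field_simp
  have e3 : (fun x : ℝ => (1 - Real.cos (m * x)) * |x| ^ (-2 * H - 1))
      = fun x => (fun y => (1 - Real.cos (m * y)) * y ^ (-2 * H - 1)) |x| := by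
    ext x
    have e : Real.cos (m * |x|) = Real.cos (m * x) := by
      rw [← Real.cos_abs (m * x), ← Real.cos_abs (m * |x|), abs_mul, abs_mul, abs_abs]
    simp only [e]
  rw [e3]
  refine ⟨integrable_comp_abs_of_integrableOn h1, ?_⟩
  rw [integral_comp_abs (f := fun y => (1 - Real.cos (m * y)) * y ^ (-2 * H - 1)), h2]
  have : Real.sin (Real.pi * H) ≠ 0 := by
    intro h; simp [specConst, h] at hc
  have : Real.Gamma (2 * H + 1) ≠ 0 := (Real.Gamma_pos_of_pos (by linarith)).ne'
  unfold specConst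
  generalize Real.sin (Real.pi * H) = S at *
  field_simp

lemma fgnSpec_neg (H l : ℝ) : fgnSpec H (-l) = fgnSpec H l := by
  unfold fgnSpec
  rw [Real.cos_neg]
  congr 1
  rw [← (Equiv.neg ℤ).tsum_eq]
  refine tsum_congr fun k => ?_
  rw [← abs_neg]
  congr 2
  simp only [Equiv.neg_apply]; push_cast; ring

/-- The covariance matrix of fractional Gaussian noise is the Toeplitz matrix of its spectral
density. -/
lemma fgnT_eq_toep {H : ℝ} (hH : H ∈ Ioo (0 : ℝ) 1) (n : ℕ) :
    fgnT n H = toep n fun l => 2 * fgnSpec H l := by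
  ext i j
  set m : ℤ := (i : ℤ) - (j : ℤ) with hm
  have hmr : ((i : ℕ) : ℝ) - ((j : ℕ) : ℝ) = m := by rw [hm]; push_cast; rfl
  simp only [fgnT, toep, hmr]
  obtain ⟨i0, s0⟩ := integral_one_sub_cos_mul_abs_rpow hH m
  obtain ⟨i1, s1⟩ := integral_one_sub_cos_mul_abs_rpow hH (m + 1)
  obtain ⟨i2, s2⟩ := integral_one_sub_cos_mul_abs_rpow hH (m - 1)
  set F : ℝ → ℝ := fun x => Real.cos (m * x) * (2 * (1 - Real.cos x)) * |x| ^ (-2 * H - 1) with hF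
  have hFe : F = fun x => (1 - Real.cos ((m + 1) * x)) * |x| ^ (-2 * H - 1)
      + (1 - Real.cos ((m - 1) * x)) * |x| ^ (-2 * H - 1)
      - 2 * ((1 - Real.cos (m * x)) * |x| ^ (-2 * H - 1)) := by
    ext x
    simp only [hF]
    have a1 : ((m : ℝ) + 1) * x = m * x + x := by ring
    have a2 : ((m : ℝ) - 1) * x = m * x - x := by ring
    rw [a1, a2, Real.cos_add, Real.cos_sub]; ring
  have hFi : Integrable F := by rw [hFe]; exact (i1.add i2).sub (i0.const_mul 2)
  have hFs : specConst H * ∫ x, F x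
      = (|(m : ℝ) + 1| ^ (2 * H) - 2 * |(m : ℝ)| ^ (2 * H) + |(m : ℝ) - 1| ^ (2 * H)) / 2 := by
    have i12 : Integrable fun x : ℝ => (1 - Real.cos ((m + 1) * x)) * |x| ^ (-2 * H - 1)
      + (1 - Real.cos ((m - 1) * x)) * |x| ^ (-2 * H - 1) := i1.add i2
    simp only [hFe]
    rw [integral_sub i12 (i0.const_mul 2), integral_add i1 i2, integral_const_mul, ← s0, ← s1, ← s2]
    ring
  rw [← hFs, integral_eq_setIntegral_tsum_two_pi hFi, ← integral_const_mul]
  have e : ∀ l, specConst H * ∑' k : ℤ, F (l + 2 * (k : ℝ) * Real.pi)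
      = Real.cos (m * l) * fgnSpec H l := by
    intro l
    have : ∀ k : ℤ, F (l + 2 * (k : ℝ) * Real.pi) = Real.cos (m * l) * (2 * (1 - Real.cos l)) *
        |l + 2 * (k : ℝ) * Real.pi| ^ (-2 * H - 1) := by
      intro k
      have c1 : Real.cos (m * (l + 2 * (k : ℝ) * Real.pi)) = Real.cos (m * l) := by
        have := Real.cos_add_int_mul_two_pi (m * l) (m * k)
        rw [← this]; congr 1; push_cast; ring
      have c2 : Real.cos (l + 2 * (k : ℝ) * Real.pi) = Real.cos l := by
        rw [← Real.cos_add_int_mul_two_pi l k]; congr 1; ring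
      simp only [hF, c1, c2]
    simp_rw [this]
    rw [tsum_mul_left, fgnSpec, ← specConst]
    ring
  simp_rw [e]
  rw [setIntegral_even fun l => by rw [mul_neg, Real.cos_neg, fgnSpec_neg], ← integral_const_mul]
  refine integral_congr_ae (Eventually.of_forall fun l => ?_)
  simp only
  ring

end Spectral

section SpectralDerivative

open Set

lemma integrable_rpow_halfCircle {r : ℝ} (hr : -1 < r) :
    Integrable (fun l : ℝ => l ^ r) halfCircle := by
  have := intervalIntegral.intervalIntegrable_rpow' (a := 0) (b := Real.pi) hr
  exact (intervalIntegrable_iff_integrableOn_Ioc_of_le Real.pi_pos.le).1 this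

lemma abs_log_le_rpow {η : ℝ} (hη : 0 < η) :
    ∃ C, 0 ≤ C ∧ ∀ l ∈ Ioc 0 Real.pi, |Real.log l| ≤ C * l ^ (-η) := by
  refine ⟨(Real.pi ^ (2 * η) + 1) / η, by have := Real.pi_pos; positivity, fun l hl => ?_⟩
  have hl0 : 0 < l := hl.1
  have h1 := Real.log_le_rpow_div hl0.le hη
  have h2 := Real.log_le_rpow_div (inv_pos.2 hl0).le hη
  rw [Real.log_inv, Real.inv_rpow hl0.le, ← Real.rpow_neg hl0.le] at h2
  have h3 : l ^ η ≤ Real.pi ^ (2 * η) * l ^ (-η) := by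
    have : l ^ η = l ^ (2 * η) * l ^ (-η) := by
      rw [← Real.rpow_add hl0]; congr 1; ring
    rw [this]
    exact mul_le_mul_of_nonneg_right (Real.rpow_le_rpow hl0.le hl.2 (by positivity)) (by positivity)
  have h4 : 0 ≤ l ^ (-η) / η := by positivity
  have h5 : 0 ≤ l ^ η / η := by positivity
  have h6 : l ^ η / η ≤ Real.pi ^ (2 * η) * l ^ (-η) / η := div_le_div_of_nonneg_right h3 hη.le
  have e : (Real.pi ^ (2 * η) + 1) / η * l ^ (-η)
      = Real.pi ^ (2 * η) * l ^ (-η) / η + l ^ (-η) / η := by ring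
  rw [e]
  exact abs_le.2 ⟨by linarith, by linarith⟩

lemma le_abs_add_two_mul_pi {l : ℝ} (hl : l ∈ Ioc 0 Real.pi) {k : ℤ} (hk : k ≠ 0) :
    |(k : ℝ)| ≤ |l + 2 * (k : ℝ) * Real.pi| := by
  have hp := Real.pi_gt_three
  rcases lt_or_gt_of_ne hk with h | h
  · have h' : (k : ℝ) ≤ -1 := by exact_mod_cast Int.le_sub_one_of_lt h
    rw [abs_of_neg (by linarith), abs_of_nonpos (by nlinarith [hl.2])]
    nlinarith [hl.2]
  · have h' : (1 : ℝ) ≤ k := by exact_mod_cast h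
    rw [abs_of_pos (by linarith), abs_of_nonneg (by nlinarith [hl.1])]
    nlinarith [hl.1]

lemma one_le_abs_intCast {k : ℤ} (hk : k ≠ 0) : (1 : ℝ) ≤ |(k : ℝ)| := by
  rw [← Int.cast_abs]; exact_mod_cast Int.one_le_abs hk

/-- Contribution of the nonzero frequencies to the periodized power. -/
def specRem (h l : ℝ) : ℝ :=
  ∑' k : ℤ, if k = 0 then 0 else |l + 2 * (k : ℝ) * Real.pi| ^ (-2 * h - 1)

lemma specRem_nonneg (h l : ℝ) : 0 ≤ specRem h l := by
  refine tsum_nonneg fun k => ?_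
  split_ifs <;> positivity

/-- Derivative of `specRem` with respect to its first argument. -/
def specRemDeriv (h l : ℝ) : ℝ :=
  ∑' k : ℤ, if k = 0 then 0 else
    |l + 2 * (k : ℝ) * Real.pi| ^ (-2 * h - 1) * Real.log |l + 2 * (k : ℝ) * Real.pi| * (-2)

/-- A summable majorant. -/
def specMajorant (a : ℝ) (k : ℤ) : ℝ := 2 / a * |(k : ℝ)| ^ (-(a + 1))

lemma summable_specMajorant {a : ℝ} (ha : 0 < a) : Summable (specMajorant a) :=
  (Real.summable_abs_int_rpow (by linarith)).mul_left _

lemma specMajorant_nonneg {a : ℝ} (ha : 0 < a) (k : ℤ) : 0 ≤ specMajorant a k := by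
  unfold specMajorant; positivity

section

variable {a h l : ℝ} (ha : 0 < a) (ha1 : a ≤ 1) (hah : a ≤ h) (hl : l ∈ Ioc 0 Real.pi)

include ha ha1 hah hl

lemma abs_specRem_term_le (k : ℤ) :
    ‖(if k = 0 then 0 else |l + 2 * (k : ℝ) * Real.pi| ^ (-2 * h - 1) : ℝ)‖ ≤ specMajorant a k := by
  split_ifs with hk
  · rw [norm_zero]; exact specMajorant_nonneg ha k
  have h1 := one_le_abs_intCast hk
  have h2 := le_abs_add_two_mul_pi hl hk
  set x := |l + 2 * (k : ℝ) * Real.pi|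
  have hx : 1 ≤ x := h1.trans h2
  rw [Real.norm_of_nonneg (by positivity)]
  calc x ^ (-2 * h - 1) ≤ x ^ (-(a + 1)) := Real.rpow_le_rpow_of_exponent_le hx (by linarith)
    _ ≤ |(k : ℝ)| ^ (-(a + 1)) :=
        Real.rpow_le_rpow_of_nonpos (by linarith) h2 (by linarith)
    _ ≤ specMajorant a k := by
        refine le_mul_of_one_le_left (by positivity) ?_
        rw [le_div_iff₀ ha]; linarith

omit ha1 in
lemma abs_specRemDeriv_term_le (k : ℤ) :
    ‖(if k = 0 then 0 else |l + 2 * (k : ℝ) * Real.pi| ^ (-2 * h - 1) *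
      Real.log |l + 2 * (k : ℝ) * Real.pi| * (-2) : ℝ)‖ ≤ specMajorant a k := by
  split_ifs with hk
  · rw [norm_zero]; exact specMajorant_nonneg ha k
  have h1 := one_le_abs_intCast hk
  have h2 := le_abs_add_two_mul_pi hl hk
  set x := |l + 2 * (k : ℝ) * Real.pi|
  have hx : 1 ≤ x := h1.trans h2
  have hx0 : 0 < x := by linarith
  have hlog := Real.log_nonneg hx
  rw [norm_mul, norm_neg, Real.norm_ofNat, Real.norm_of_nonneg (by positivity)]
  calc x ^ (-2 * h - 1) * Real.log x * 2 ≤ x ^ (-2 * h - 1) * (x ^ a / a) * 2 := by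
        have := Real.log_le_rpow_div hx0.le ha
        gcongr
    _ = 2 / a * x ^ (-2 * h - 1 + a) := by rw [Real.rpow_add hx0]; ring
    _ ≤ 2 / a * x ^ (-(a + 1)) := by
        refine mul_le_mul_of_nonneg_left ?_ (by positivity)
        exact Real.rpow_le_rpow_of_exponent_le hx (by linarith)
    _ ≤ specMajorant a k := by
        refine mul_le_mul_of_nonneg_left ?_ (by positivity)
        exact Real.rpow_le_rpow_of_nonpos (by linarith) h2 (by linarith)

lemma summable_specRem : Summable fun k : ℤ =>
    (if k = 0 then 0 else |l + 2 * (k : ℝ) * Real.pi| ^ (-2 * h - 1) : ℝ) :=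
  Summable.of_norm_bounded (summable_specMajorant ha) (abs_specRem_term_le ha ha1 hah hl)

lemma abs_specRem_le : |specRem h l| ≤ ∑' k, specMajorant a k :=
  tsum_of_norm_bounded (summable_specMajorant ha).hasSum (abs_specRem_term_le ha ha1 hah hl)

omit ha1 in
lemma abs_specRemDeriv_le : |specRemDeriv h l| ≤ ∑' k, specMajorant a k :=
  tsum_of_norm_bounded (summable_specMajorant ha).hasSum (abs_specRemDeriv_term_le ha hah hl)

end

lemma hasDerivAt_rpow_exponent {x : ℝ} (hx : 0 < x) (h : ℝ) :
    HasDerivAt (fun y => x ^ (-2 * y - 1)) (x ^ (-2 * h - 1) * Real.log x * (-2)) h := by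
  have h1 : HasDerivAt (fun y : ℝ => -2 * y - 1) (-2) h := by
    simpa using ((hasDerivAt_id h).const_mul (-2)).sub_const 1
  have := h1.const_rpow hx
  refine this.congr_deriv ?_
  ring

lemma hasDerivAt_specRem {h l : ℝ} (hh : h ∈ Ioo (0 : ℝ) 1) (hl : l ∈ Ioc 0 Real.pi) :
    HasDerivAt (fun y => specRem y l) (specRemDeriv h l) h := by
  have ha : 0 < h / 2 := by linarith [hh.1]
  have ha1 : h / 2 ≤ 1 := by linarith [hh.2]
  refine hasDerivAt_tsum_of_isPreconnected (t := Ioi (h / 2)) (summable_specMajorant ha) isOpen_Ioi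
    isPreconnected_Ioi ?_ (fun k y hy => abs_specRemDeriv_term_le ha (le_of_lt hy) hl k)
    (y₀ := h) (by simpa using hh.1) (summable_specRem ha ha1 (by linarith) hl) (by simpa using hh.1)
  intro k y _
  split_ifs with hk
  · exact hasDerivAt_const _ _
  · refine hasDerivAt_rpow_exponent ?_ y
    linarith [one_le_abs_intCast hk, le_abs_add_two_mul_pi hl hk]

lemma continuousOn_specRem {h : ℝ} (hh : h ∈ Ioo (0 : ℝ) 1) :
    ContinuousOn (specRem h) (Ioc 0 Real.pi) := by
  refine continuousOn_tsum (fun k => ?_) (summable_specMajorant hh.1)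
    (fun k l hl => abs_specRem_term_le hh.1 hh.2.le le_rfl hl k)
  split_ifs with hk
  · exact continuousOn_const
  · refine ContinuousOn.rpow_const (by fun_prop) fun l hl => Or.inl ?_
    linarith [one_le_abs_intCast hk, le_abs_add_two_mul_pi hl hk]

lemma continuousOn_specRemDeriv {h : ℝ} (hh : h ∈ Ioo (0 : ℝ) 1) :
    ContinuousOn (specRemDeriv h) (Ioc 0 Real.pi) := by
  refine continuousOn_tsum (fun k => ?_) (summable_specMajorant hh.1)
    (fun k l hl => abs_specRemDeriv_term_le hh.1 le_rfl hl k)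
  split_ifs with hk
  · exact continuousOn_const
  · have hp : ∀ l ∈ Ioc 0 Real.pi, |l + 2 * (k : ℝ) * Real.pi| ≠ 0 := fun l hl => by
      linarith [one_le_abs_intCast hk, le_abs_add_two_mul_pi hl hk]
    refine ContinuousOn.mul (ContinuousOn.mul ?_ ?_) continuousOn_const
    · exact ContinuousOn.rpow_const (by fun_prop) fun l hl => Or.inl (hp l hl)
    · exact ContinuousOn.log (by fun_prop) hp

lemma two_mul_one_sub_cos_bounds {l : ℝ} (hl : l ∈ Ioc 0 Real.pi) :
    4 / Real.pi ^ 2 * l ^ 2 ≤ 2 * (1 - Real.cos l) ∧ 2 * (1 - Real.cos l) ≤ l ^ 2 := by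
  have h1 := Real.cos_le_one_sub_mul_cos_sq (x := l) (by rw [abs_of_pos hl.1]; exact hl.2)
  have h2 := Real.one_sub_sq_div_two_le_cos (x := l)
  constructor
  · have : 4 / Real.pi ^ 2 * l ^ 2 = 2 * (2 / Real.pi ^ 2 * l ^ 2) := by ring
    linarith
  · linarith

/-- The unnormalized spectral density. -/
def specShape (h l : ℝ) : ℝ := 2 * (1 - Real.cos l) * (l ^ (-2 * h - 1) + specRem h l)

/-- Derivative of `specShape` with respect to its first argument. -/
def specShapeDeriv (h l : ℝ) : ℝ :=
  2 * (1 - Real.cos l) * (l ^ (-2 * h - 1) * Real.log l * (-2) + specRemDeriv h l)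

section

variable {h l : ℝ} (hh : h ∈ Ioo (0 : ℝ) 1) (hl : l ∈ Ioc 0 Real.pi)

include hh

lemma continuousOn_specShape : ContinuousOn (specShape h) (Ioc 0 Real.pi) := by
  refine ContinuousOn.mul (by fun_prop) (ContinuousOn.add ?_ (continuousOn_specRem hh))
  exact ContinuousOn.rpow_const (by fun_prop) fun l hl => Or.inl hl.1.ne'

lemma continuousOn_specShapeDeriv : ContinuousOn (specShapeDeriv h) (Ioc 0 Real.pi) := by
  refine ContinuousOn.mul (by fun_prop) (ContinuousOn.add ?_ (continuousOn_specRemDeriv hh))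
  refine ContinuousOn.mul (ContinuousOn.mul ?_ ?_) continuousOn_const
  · exact ContinuousOn.rpow_const (by fun_prop) fun l hl => Or.inl hl.1.ne'
  · exact ContinuousOn.log (by fun_prop) fun l hl => hl.1.ne'

include hl

lemma fgnSpec_eq : fgnSpec h l = specConst h * specShape h l := by
  have hs := summable_specRem hh.1 hh.2.le le_rfl hl
  have hsum : Summable fun k : ℤ => |l + 2 * (k : ℝ) * Real.pi| ^ (-2 * h - 1) := by
    refine (hs.add ((hasSum_ite_eq (0 : ℤ) (l ^ (-2 * h - 1))).summable)).congr fun k => ?_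
    split_ifs with hk
    · simp [hk, abs_of_pos hl.1]
    · simp
  have := hsum.tsum_eq_add_tsum_ite 0
  rw [fgnSpec, this, ← specConst, specShape, specRem]
  simp only [Int.cast_zero, mul_zero, zero_mul, add_zero, abs_of_pos hl.1]
  ring

lemma hasDerivAt_specShape : HasDerivAt (fun y => specShape y l) (specShapeDeriv h l) h :=
  ((hasDerivAt_rpow_exponent hl.1 h).add (hasDerivAt_specRem hh hl)).const_mul _

end

lemma specShape_lower (h : ℝ) {l : ℝ} (hl : l ∈ Ioc 0 Real.pi) :
    4 / Real.pi ^ 2 * l ^ (1 - 2 * h) ≤ specShape h l := by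
  have h1 := (two_mul_one_sub_cos_bounds hl).1
  have h2 := specRem_nonneg h l
  have hl0 := hl.1
  have e : l ^ (1 - 2 * h) = l ^ 2 * l ^ (-2 * h - 1) := by
    rw [← Real.rpow_natCast, ← Real.rpow_add hl0]; congr 1; push_cast; ring
  have := Real.pi_pos
  rw [e, specShape, ← mul_assoc]
  have h3 : l ^ (-2 * h - 1) ≤ l ^ (-2 * h - 1) + specRem h l := by linarith
  exact mul_le_mul h1 h3 (by positivity) (le_trans (by positivity) h1)

lemma specShape_pos (h : ℝ) {l : ℝ} (hl : l ∈ Ioc 0 Real.pi) : 0 < specShape h l := by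
  have := Real.pi_pos
  have := Real.rpow_pos_of_pos hl.1 (1 - 2 * h)
  exact lt_of_lt_of_le (by positivity) (specShape_lower h hl)

lemma rpow_le_pi_rpow {l r s : ℝ} (hl : l ∈ Ioc 0 Real.pi) (hr : 0 ≤ r) (hrs : r ≤ s) :
    l ^ r ≤ Real.pi ^ s :=
  (Real.rpow_le_rpow hl.1.le hl.2 hr).trans
    (Real.rpow_le_rpow_of_exponent_le (by linarith [Real.pi_gt_three]) hrs)

lemma specShape_upper {h : ℝ} (hh : h ∈ Ioo (0 : ℝ) 1) :
    ∃ C, 0 ≤ C ∧ ∀ l ∈ Ioc 0 Real.pi, specShape h l ≤ C * l ^ (1 - 2 * h) := by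
  set K := ∑' k, specMajorant h k
  have hK : 0 ≤ K := tsum_nonneg (specMajorant_nonneg hh.1)
  refine ⟨1 + K * Real.pi ^ (3 : ℝ), by have := Real.pi_pos; positivity, fun l hl => ?_⟩
  have hl0 := hl.1
  have h1 := (two_mul_one_sub_cos_bounds hl).2
  have h2 : specRem h l ≤ K := (le_abs_self _).trans (abs_specRem_le hh.1 hh.2.le le_rfl hl)
  have h2' := specRem_nonneg h l
  have h3 := rpow_le_pi_rpow hl (r := 2 * h + 1) (s := 3) (by linarith [hh.1]) (by linarith [hh.2])
  have e1 : l ^ (1 - 2 * h) = l ^ 2 * l ^ (-2 * h - 1) := by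
    rw [← Real.rpow_natCast, ← Real.rpow_add hl0]; congr 1; push_cast; ring
  have e2 : (1 : ℝ) = l ^ (-2 * h - 1) * l ^ (2 * h + 1) := by
    rw [← Real.rpow_add hl0, ← Real.rpow_zero l]; congr 1; ring
  have hp : 0 < l ^ (-2 * h - 1) := Real.rpow_pos_of_pos hl0 _
  calc specShape h l ≤ l ^ 2 * (l ^ (-2 * h - 1) + K) :=
        mul_le_mul h1 (by linarith) (by positivity) (by positivity)
    _ = l ^ 2 * (l ^ (-2 * h - 1) + K * (l ^ (-2 * h - 1) * l ^ (2 * h + 1))) := by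
        rw [← e2, mul_one]
    _ ≤ l ^ 2 * (l ^ (-2 * h - 1) + K * (l ^ (-2 * h - 1) * Real.pi ^ (3 : ℝ))) := by gcongr
    _ = _ := by rw [e1]; ring

lemma specShapeDeriv_div_le {h : ℝ} (hh : h ∈ Ioo (0 : ℝ) 1) :
    ∃ C, 0 ≤ C ∧ ∀ l ∈ Ioc 0 Real.pi,
      |specShapeDeriv h l / specShape h l| ≤ 2 * |Real.log l| + C := by
  set K := ∑' k, specMajorant h k
  have hK : 0 ≤ K := tsum_nonneg (specMajorant_nonneg hh.1)
  refine ⟨K * Real.pi ^ (3 : ℝ), by have := Real.pi_pos; positivity, fun l hl => ?_⟩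
  have hl0 := hl.1
  have h2 := abs_specRemDeriv_le hh.1 le_rfl hl
  have h2' := specRem_nonneg h l
  have h3 := rpow_le_pi_rpow hl (r := 2 * h + 1) (s := 3) (by linarith [hh.1]) (by linarith [hh.2])
  have e2 : (1 : ℝ) = l ^ (-2 * h - 1) * l ^ (2 * h + 1) := by
    rw [← Real.rpow_add hl0, ← Real.rpow_zero l]; congr 1; ring
  have hp : 0 < l ^ (-2 * h - 1) := Real.rpow_pos_of_pos hl0 _
  have hpos := specShape_pos h hl
  have hc : 0 ≤ 2 * (1 - Real.cos l) := by linarith [Real.cos_le_one l]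
  rw [abs_div, abs_of_pos hpos, div_le_iff₀ hpos, specShapeDeriv, abs_mul, abs_of_nonneg hc,
    specShape, mul_left_comm]
  refine mul_le_mul_of_nonneg_left ?_ hc
  calc |l ^ (-2 * h - 1) * Real.log l * (-2) + specRemDeriv h l|
      ≤ l ^ (-2 * h - 1) * |Real.log l| * 2 + K := by
        refine (abs_add_le _ _).trans (add_le_add (le_of_eq ?_) h2)
        rw [abs_mul, abs_mul, abs_of_pos hp, abs_neg, abs_two]
    _ = l ^ (-2 * h - 1) * |Real.log l| * 2 + K * (l ^ (-2 * h - 1) * l ^ (2 * h + 1)) := by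
        rw [← e2, mul_one]
    _ ≤ l ^ (-2 * h - 1) * |Real.log l| * 2 + K * (l ^ (-2 * h - 1) * Real.pi ^ (3 : ℝ)) := by
        gcongr
    _ = (2 * |Real.log l| + K * Real.pi ^ (3 : ℝ)) * l ^ (-2 * h - 1) := by ring
    _ ≤ _ := by
        have := Real.pi_pos
        refine mul_le_mul_of_nonneg_left (by linarith) (by positivity)

lemma exists_specShapeDeriv_bound {H : ℝ} (hH : H ∈ Ioo (0 : ℝ) 1) :
    ∃ bound : ℝ → ℝ, Integrable bound halfCircle ∧ ∀ l ∈ Ioc 0 Real.pi,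
      ∀ h ∈ Ioo (H / 2) ((H + 1) / 2), |specShapeDeriv h l| ≤ bound l := by
  obtain ⟨hH0, hH1⟩ := hH
  set b := (H + 1) / 2 with hb
  set K := ∑' k, specMajorant (H / 2) k
  have ha : 0 < H / 2 := by linarith
  have hK : 0 ≤ K := tsum_nonneg (specMajorant_nonneg ha)
  obtain ⟨C, hC, hlog⟩ := abs_log_le_rpow (η := 1 - b) (by rw [hb]; linarith)
  have hpi := Real.pi_pos
  refine ⟨fun l => Real.pi ^ (2 : ℝ) * C * 2 * l ^ (-b) + K * l ^ (2 : ℝ), ?_, ?_⟩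
  · exact ((integrable_rpow_halfCircle (by rw [hb]; linarith)).const_mul _).add
      ((integrable_rpow_halfCircle (by norm_num)).const_mul _)
  · intro l hl h hh
    have hl0 := hl.1
    have hh' : h ∈ Ioo (0 : ℝ) 1 := ⟨by linarith [hh.1], by have := hh.2; rw [hb] at this; linarith⟩
    have h1 := (two_mul_one_sub_cos_bounds hl).2
    have h2 := abs_specRemDeriv_le ha hh.1.le hl
    have hc : 0 ≤ 2 * (1 - Real.cos l) := by linarith [Real.cos_le_one l]
    have hp : 0 < l ^ (-2 * h - 1) := Real.rpow_pos_of_pos hl0 _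
    have h3 := rpow_le_pi_rpow hl (r := 2 * b - 2 * h) (s := 2) (by linarith [hh.2])
      (by rw [hb]; linarith [hh'.1])
    have e1 : l ^ (2 : ℝ) * (l ^ (-2 * h - 1) * (C * l ^ (-(1 - b))))
        = C * l ^ (2 * b - 2 * h) * l ^ (-b) := by
      have : l ^ (2 : ℝ) * l ^ (-2 * h - 1) * l ^ (-(1 - b)) = l ^ (2 * b - 2 * h) * l ^ (-b) := by
        rw [← Real.rpow_add hl0, ← Real.rpow_add hl0, ← Real.rpow_add hl0]; congr 1; ring
      linear_combination C * this
    rw [specShapeDeriv, abs_mul, abs_of_nonneg hc]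
    rw [← Real.rpow_two] at h1
    calc 2 * (1 - Real.cos l) * |l ^ (-2 * h - 1) * Real.log l * (-2) + specRemDeriv h l|
        ≤ l ^ (2 : ℝ) * (l ^ (-2 * h - 1) * (C * l ^ (-(1 - b))) * 2 + K) := by
          refine mul_le_mul h1 ?_ (abs_nonneg _) (by positivity)
          refine (abs_add_le _ _).trans (add_le_add ?_ h2)
          rw [abs_mul, abs_mul, abs_of_pos hp, abs_neg, abs_two]
          have := hlog l hl
          gcongr
      _ = C * l ^ (2 * b - 2 * h) * l ^ (-b) * 2 + K * l ^ (2 : ℝ) := by rw [← e1]; ring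
      _ ≤ C * Real.pi ^ (2 : ℝ) * l ^ (-b) * 2 + K * l ^ (2 : ℝ) := by gcongr
      _ = _ := by ring

end SpectralDerivative

section FgnSymbol

open Set

lemma differentiableAt_specConst {H : ℝ} (hH : H ∈ Ioo (0 : ℝ) 1) :
    DifferentiableAt ℝ specConst H := by
  have h1 : DifferentiableAt ℝ (fun h : ℝ => Real.Gamma (2 * h + 1)) H := by
    refine DifferentiableAt.comp (g := Real.Gamma) (f := fun h : ℝ => 2 * h + 1) H
      (Real.differentiableAt_Gamma fun m hm => ?_) (by fun_prop)
    have : (0 : ℝ) ≤ m := m.cast_nonneg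
    linarith [hH.1]
  exact (h1.mul (by fun_prop)).div_const _

/-- The spectral density as a Toeplitz symbol on the half circle. -/
def symF (H : ℝ) : ℝ → ℝ := (Ioc 0 Real.pi).indicator fun l => 2 * (specConst H * specShape H l)

/-- The logarithmic derivative of the spectral density on the half circle. -/
def symG (H : ℝ) : ℝ → ℝ := (Ioc 0 Real.pi).indicator fun l =>
  deriv specConst H / specConst H + specShapeDeriv H l / specShape H l

variable {H : ℝ} (hH : H ∈ Ioo (0 : ℝ) 1)

lemma measurable_indicator_of_continuousOn {f : ℝ → ℝ} (hf : ContinuousOn f (Ioc 0 Real.pi)) :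
    Measurable ((Ioc 0 Real.pi).indicator f) := by
  classical
  rw [← piecewise_eq_indicator]
  exact hf.measurable_piecewise continuousOn_const measurableSet_Ioc

include hH

lemma measurable_symF : Measurable (symF H) :=
  measurable_indicator_of_continuousOn
    (continuousOn_const.mul (continuousOn_const.mul (continuousOn_specShape hH)))

lemma measurable_symG : Measurable (symG H) :=
  measurable_indicator_of_continuousOn (continuousOn_const.add
    ((continuousOn_specShapeDeriv hH).div (continuousOn_specShape hH)
      fun _ hl => (specShape_pos H hl).ne'))

lemma fgnSpec_ae_eq_symF : (fun l => 2 * fgnSpec H l) =ᵐ[halfCircle] symF H := by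
  filter_upwards [ae_halfCircle_mem] with l hl
  rw [symF, indicator_of_mem hl, fgnSpec_eq hH hl]

lemma dlogSpec_eq_symG {l : ℝ} (hl : l ∈ Ioc 0 Real.pi) : dlogSpec H l = symG H l := by
  have hev : (fun h => Real.log (fgnSpec h l)) =ᶠ[𝓝 H]
      fun h => Real.log (specConst h * specShape h l) := by
    filter_upwards [Ioo_mem_nhds hH.1 hH.2] with h hh
    rw [fgnSpec_eq hh hl]
  have hc := specConst_pos hH
  have hs := specShape_pos H hl
  have h1 := ((differentiableAt_specConst hH).hasDerivAt.fun_mul (hasDerivAt_specShape hH hl)).log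
    (mul_pos hc hs).ne'
  rw [dlogSpec, hev.deriv_eq, h1.deriv, symG, indicator_of_mem hl]
  field_simp

lemma symF_pos {l : ℝ} (hl : l ∈ Ioc 0 Real.pi) : 0 < symF H l := by
  have hc := specConst_pos hH
  have hs := specShape_pos H hl
  rw [symF, indicator_of_mem hl]
  positivity

lemma exists_symF_le : ∃ C, 0 ≤ C ∧ ∀ l ∈ Ioc 0 Real.pi, symF H l ≤ C * l ^ (1 - 2 * H) := by
  obtain ⟨C, hC, h⟩ := specShape_upper hH
  have hc := specConst_pos hH
  refine ⟨2 * specConst H * C, by positivity, fun l hl => ?_⟩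
  rw [symF, indicator_of_mem hl]
  have := mul_le_mul_of_nonneg_left (h l hl) hc.le
  linarith

lemma exists_inv_symF_le :
    ∃ C, 0 ≤ C ∧ ∀ l ∈ Ioc 0 Real.pi, (symF H l)⁻¹ ≤ C * l ^ (2 * H - 1) := by
  have hc := specConst_pos hH
  have hpi := Real.pi_pos
  refine ⟨(2 * specConst H * (4 / Real.pi ^ 2))⁻¹, by positivity, fun l hl => ?_⟩
  have hl0 := hl.1
  have h1 := mul_le_mul_of_nonneg_left (specShape_lower H hl) hc.le
  have e : (2 * specConst H * (4 / Real.pi ^ 2))⁻¹ * l ^ (2 * H - 1)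
      = (2 * specConst H * (4 / Real.pi ^ 2) * l ^ (1 - 2 * H))⁻¹ := by
    have : l ^ (2 * H - 1) = (l ^ (1 - 2 * H))⁻¹ := by
      rw [← Real.rpow_neg hl0.le]; congr 1; ring
    rw [this, ← mul_inv]
  rw [e, symF, indicator_of_mem hl]
  refine inv_anti₀ ?_ (by linarith)
  have := Real.rpow_pos_of_pos hl0 (1 - 2 * H)
  positivity

lemma exists_abs_symG_le : ∃ C, 0 ≤ C ∧ ∀ l ∈ Ioc 0 Real.pi, |symG H l| ≤ 2 * |Real.log l| + C := by
  obtain ⟨C, hC, h⟩ := specShapeDeriv_div_le hH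
  refine ⟨C + |deriv specConst H / specConst H|, by positivity, fun l hl => ?_⟩
  rw [symG, indicator_of_mem hl]
  refine (abs_add_le _ _).trans ?_
  linarith [h l hl]

lemma exists_abs_symG_le_rpow {η : ℝ} (hη : 0 < η) :
    ∃ C, 0 ≤ C ∧ ∀ l ∈ Ioc 0 Real.pi, |symG H l| ≤ C * l ^ (-η) := by
  obtain ⟨C, hC, h⟩ := exists_abs_symG_le hH
  obtain ⟨K, hK, hlog⟩ := abs_log_le_rpow hη
  have hpi := Real.pi_pos
  refine ⟨2 * K + C * Real.pi ^ η, by positivity, fun l hl => (h l hl).trans ?_⟩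
  have hl0 := hl.1
  have h1 : (1 : ℝ) ≤ Real.pi ^ η * l ^ (-η) := by
    have : (1 : ℝ) = l ^ η * l ^ (-η) := by rw [← Real.rpow_add hl0, add_neg_cancel, Real.rpow_zero]
    nth_rw 1 [this]
    exact mul_le_mul_of_nonneg_right (Real.rpow_le_rpow hl0.le hl.2 hη.le) (by positivity)
  have h2 := hlog l hl
  have h3 := mul_le_mul_of_nonneg_left h1 hC
  calc 2 * |Real.log l| + C ≤ 2 * (K * l ^ (-η)) + C * (Real.pi ^ η * l ^ (-η)) := by linarith
    _ = _ := by ring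

omit hH in
lemma integrable_of_abs_le_rpow {u : ℝ → ℝ} (hu : Measurable u) {C r : ℝ} (hr : -1 < r)
    (h : ∀ l ∈ Ioc 0 Real.pi, |u l| ≤ C * l ^ r) : Integrable u halfCircle := by
  refine ((integrable_rpow_halfCircle hr).const_mul C).mono' hu.aestronglyMeasurable ?_
  filter_upwards [ae_halfCircle_mem] with l hl using h l hl

lemma isAdmissibleSymbol_symF : IsAdmissibleSymbol (symF H) (1 / H) (1 / (1 - H)) where
  conj := by
    have h0 := hH.1
    have h1 := hH.2
    rw [Real.holderConjugate_iff]
    refine ⟨by rw [lt_div_iff₀ h0]; linarith, ?_⟩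
    simp
  meas := measurable_symF hH
  pos := fun l hl => symF_pos hH hl
  int_rpow := by
    obtain ⟨C, hC, h⟩ := exists_symF_le hH
    have h0 := hH.1
    have h1 := hH.2
    refine integrable_of_abs_le_rpow ((measurable_symF hH).pow_const _) (C := C ^ (1 / H))
      (r := (1 - 2 * H) * (1 / H)) ?_ fun l hl => ?_
    · rw [mul_one_div, lt_div_iff₀ h0]; linarith
    · have hp := (symF_pos hH hl).le
      rw [abs_of_nonneg (by positivity), Real.rpow_mul hl.1.le,
        ← Real.mul_rpow hC (Real.rpow_nonneg hl.1.le _)]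
      exact Real.rpow_le_rpow hp (h l hl) (by positivity)
  int_inv_rpow := by
    obtain ⟨C, hC, h⟩ := exists_inv_symF_le hH
    have h0 := hH.1
    have h1 : 0 < 1 - H := by linarith [hH.2]
    refine integrable_of_abs_le_rpow ((measurable_symF hH).inv.pow_const _) (C := C ^ (1 / (1 - H)))
      (r := (2 * H - 1) * (1 / (1 - H))) ?_ fun l hl => ?_
    · rw [mul_one_div, lt_div_iff₀ h1]; linarith
    · have hp := (inv_pos.2 (symF_pos hH hl)).le
      rw [abs_of_nonneg (by positivity), Real.rpow_mul hl.1.le,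
        ← Real.mul_rpow hC (Real.rpow_nonneg hl.1.le _)]
      exact Real.rpow_le_rpow hp (h l hl) (by positivity)

lemma integrable_sq_mul_symF_rpow (α β : ℝ) :
    Integrable (fun l => |(α + β * symG H l) ^ 2 * symF H l| ^ (1 / H)) halfCircle := by
  have h0 := hH.1
  have h1 : 0 < (1 - H) / 4 := by linarith [hH.2]
  obtain ⟨C, hC, hF⟩ := exists_symF_le hH
  obtain ⟨K, hK, hG⟩ := exists_abs_symG_le_rpow hH h1
  have hpi := Real.pi_pos
  set η := (1 - H) / 4 with hη
  set A := |α| * Real.pi ^ η + |β| * K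
  have hA : 0 ≤ A := by positivity
  have hm : Measurable fun l => |(α + β * symG H l) ^ 2 * symF H l| ^ (1 / H) := by
    have := measurable_symG hH
    have := measurable_symF hH
    have hm' : Measurable fun l => |(α + β * symG H l) ^ 2 * symF H l| :=
      continuous_abs.measurable.comp (by fun_prop)
    exact hm'.pow_const _
  refine integrable_of_abs_le_rpow hm (C := (A ^ 2 * C) ^ (1 / H))
    (r := (-η * 2 + (1 - 2 * H)) * (1 / H)) ?_ fun l hl => ?_
  · rw [mul_one_div, lt_div_iff₀ h0]; linarith
  · have hl0 := hl.1
    have hp := (symF_pos hH hl).le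
    have h2 : (1 : ℝ) ≤ Real.pi ^ η * l ^ (-η) := by
      have : (1 : ℝ) = l ^ η * l ^ (-η) := by
        rw [← Real.rpow_add hl0, add_neg_cancel, Real.rpow_zero]
      nth_rw 1 [this]
      exact mul_le_mul_of_nonneg_right (Real.rpow_le_rpow hl0.le hl.2 h1.le) (by positivity)
    have h3 : |α + β * symG H l| ≤ A * l ^ (-η) := by
      refine (abs_add_le _ _).trans ?_
      rw [abs_mul]
      have := mul_le_mul_of_nonneg_left h2 (abs_nonneg α)
      have := mul_le_mul_of_nonneg_left (hG l hl) (abs_nonneg β)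
      calc |α| + |β| * |symG H l| ≤ |α| * (Real.pi ^ η * l ^ (-η)) + |β| * (K * l ^ (-η)) := by
            linarith
        _ = _ := by simp only [A]; ring
    have h4 : (α + β * symG H l) ^ 2 ≤ A ^ 2 * l ^ (-η * 2) := by
      rw [← sq_abs, Real.rpow_mul hl0.le, Real.rpow_two, ← mul_pow]
      exact pow_le_pow_left₀ (abs_nonneg _) h3 2
    rw [abs_of_nonneg (by positivity), abs_of_nonneg (by positivity), Real.rpow_mul hl0.le,
      ← Real.mul_rpow (by positivity) (Real.rpow_nonneg hl0.le _)]
    refine Real.rpow_le_rpow (by positivity) ?_ (by positivity)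
    calc (α + β * symG H l) ^ 2 * symF H l
        ≤ A ^ 2 * l ^ (-η * 2) * (C * l ^ (1 - 2 * H)) :=
          mul_le_mul h4 (hF l hl) hp (by positivity)
      _ = A ^ 2 * C * (l ^ (-η * 2) * l ^ (1 - 2 * H)) := by ring
      _ = _ := by rw [← Real.rpow_add hl0]

lemma integrable_symG : Integrable (symG H) halfCircle := by
  obtain ⟨K, hK, hG⟩ := exists_abs_symG_le_rpow hH (η := 1 / 4) (by norm_num)
  exact integrable_of_abs_le_rpow (measurable_symG hH) (by norm_num) hG

lemma integrable_symG_sq : Integrable (fun l => symG H l ^ 2) halfCircle := by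
  obtain ⟨K, hK, hG⟩ := exists_abs_symG_le_rpow hH (η := 1 / 4) (by norm_num)
  refine integrable_of_abs_le_rpow ((measurable_symG hH).pow_const 2) (C := K ^ 2)
    (r := -(1 / 4) * 2) (by norm_num) fun l hl => ?_
  rw [abs_of_nonneg (sq_nonneg _), ← sq_abs, Real.rpow_mul hl.1.le, Real.rpow_two, ← mul_pow]
  exact pow_le_pow_left₀ (abs_nonneg _) (hG l hl) 2

omit hH in
lemma dlogSpec_neg (H l : ℝ) : dlogSpec H (-l) = dlogSpec H l := by
  simp only [dlogSpec, fgnSpec_neg]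

omit hH in
lemma intervalIntegral_even {P : ℝ → ℝ} (hP : ∀ x, P (-x) = P x) :
    ∫ x in (-Real.pi)..Real.pi, P x = 2 * ∫ x, P x ∂halfCircle := by
  rw [intervalIntegral.integral_of_le (by linarith [Real.pi_pos]), setIntegral_even hP, halfCircle]

lemma jH_eq : jH H = -(Real.pi⁻¹ * ∫ l, symG H l ∂halfCircle) := by
  have : ∫ l, dlogSpec H l ∂halfCircle = ∫ l, symG H l ∂halfCircle :=
    integral_congr_ae (by filter_upwards [ae_halfCircle_mem] with l hl using dlogSpec_eq_symG hH hl)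
  rw [jH, intervalIntegral_even (dlogSpec_neg H), this]
  have := Real.pi_pos
  field_simp

lemma eH_eq : eH H = 2⁻¹ * (Real.pi⁻¹ * ∫ l, symG H l ^ 2 ∂halfCircle) := by
  have : ∫ l, dlogSpec H l ^ 2 ∂halfCircle = ∫ l, symG H l ^ 2 ∂halfCircle :=
    integral_congr_ae (by
      filter_upwards [ae_halfCircle_mem] with l hl
      rw [dlogSpec_eq_symG hH hl])
  rw [eH, intervalIntegral_even (fun l => by rw [dlogSpec_neg]), this]
  have := Real.pi_pos
  field_simp
  norm_num

lemma fgnT_eq_toep_symF (n : ℕ) : fgnT n H = toep n (symF H) := by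
  rw [fgnT_eq_toep hH, toep_congr n (fgnSpec_ae_eq_symF hH)]

lemma integrable_specShape : Integrable (specShape H) halfCircle := by
  obtain ⟨C, hC, h⟩ := specShape_upper hH
  refine ((integrable_rpow_halfCircle (r := 1 - 2 * H) (by linarith [hH.2])).const_mul C).mono'
    ((continuousOn_specShape hH).aestronglyMeasurable measurableSet_Ioc) ?_
  filter_upwards [ae_halfCircle_mem] with l hl
  rw [Real.norm_of_nonneg (specShape_pos H hl).le]
  exact h l hl

lemma hasDerivAt_toep_specShape (n : ℕ) (i j : Fin n) :
    Integrable (specShapeDeriv H) halfCircle ∧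
    HasDerivAt (fun h => toep n (specShape h) i j) (toep n (specShapeDeriv H) i j) H := by
  obtain ⟨bound, hb, hbound⟩ := exists_specShapeDeriv_bound hH
  have h0 := hH.1
  have h1 := hH.2
  have hI : Ioo (H / 2) ((H + 1) / 2) ∈ 𝓝 H := Ioo_mem_nhds (by linarith) (by linarith)
  have hsub : ∀ h ∈ Ioo (H / 2) ((H + 1) / 2), h ∈ Ioo (0 : ℝ) 1 :=
    fun h hh => ⟨by linarith [hh.1], by linarith [hh.2]⟩
  have hd : AEStronglyMeasurable (specShapeDeriv H) halfCircle :=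
    (continuousOn_specShapeDeriv hH).aestronglyMeasurable measurableSet_Ioc
  refine ⟨hb.mono' hd ?_, ?_⟩
  · filter_upwards [ae_halfCircle_mem] with l hl
    exact hbound l hl H (mem_of_mem_nhds hI)
  refine (hasDerivAt_integral_of_dominated_loc_of_deriv_le (bound := bound) hI ?_
    (integrable_cos_mul (integrable_specShape hH) _)
    (F' := fun h l => Real.cos ((((i : ℕ) : ℝ) - ((j : ℕ) : ℝ)) * l) * specShapeDeriv h l)
    ?_ ?_ hb ?_).2
  · filter_upwards [hI] with h hh
    exact (integrable_cos_mul (integrable_specShape (hsub h hh)) _).aestronglyMeasurable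
  · exact AEStronglyMeasurable.mul (by fun_prop) hd
  · filter_upwards [ae_halfCircle_mem] with l hl h hh
    rw [norm_mul]
    refine (mul_le_of_le_one_left (norm_nonneg _) (Real.abs_cos_le_one _)).trans ?_
    exact hbound l hl h hh
  · filter_upwards [ae_halfCircle_mem] with l hl h hh
    exact (hasDerivAt_specShape (hsub h hh) hl).const_mul _

/-- Derivative of the covariance matrix in the Hurst parameter. -/
lemma hasDerivAt_fgnT (n : ℕ) (i j : Fin n) :
    HasDerivAt (fun h => fgnT n h i j) (toep n (fun l => symG H l * symF H l) i j) H := by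
  obtain ⟨hint, hder⟩ := hasDerivAt_toep_specShape hH n i j
  have hc := specConst_pos hH
  have h1 := ((differentiableAt_specConst hH).hasDerivAt.fun_mul hder).const_mul 2
  have hev : (fun h => fgnT n h i j) =ᶠ[𝓝 H]
      fun h => 2 * (specConst h * toep n (specShape h) i j) := by
    filter_upwards [Ioo_mem_nhds hH.1 hH.2] with h hh
    have : symF h =ᵐ[halfCircle] fun l => 2 * specConst h * specShape h l := by
      filter_upwards [ae_halfCircle_mem] with l hl
      rw [symF, indicator_of_mem hl]; ring
    rw [fgnT_eq_toep_symF hh, toep_congr n this, toep_const_mul, Matrix.smul_apply, smul_eq_mul,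
      mul_assoc]
  refine (h1.congr_of_eventuallyEq hev).congr_deriv ?_
  have : (fun l => symG H l * symF H l) =ᵐ[halfCircle] fun l =>
      2 * deriv specConst H * specShape H l + 2 * specConst H * specShapeDeriv H l := by
    filter_upwards [ae_halfCircle_mem] with l hl
    have := specShape_pos H hl
    rw [symF, symG, indicator_of_mem hl, indicator_of_mem hl]
    field_simp
  rw [toep_congr n this, toep_add n ((integrable_specShape hH).const_mul _) (hint.const_mul _),
    toep_const_mul, toep_const_mul]
  simp only [Matrix.add_apply, Matrix.smul_apply, smul_eq_mul]
  ring

end FgnSymbol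

section MatrixCalculus

variable {ι : Type*} [Fintype ι] [DecidableEq ι] {F : ℝ → Matrix ι ι ℝ} {F' : Matrix ι ι ℝ} {a : ℝ}

/-- Jacobi's formula. -/
lemma hasDerivAt_det (hF : ∀ i j, HasDerivAt (fun h => F h i j) (F' i j) a) :
    HasDerivAt (fun h => (F h).det) ((F a).adjugate * F').trace a := by
  simp only [Matrix.det_apply']
  have h1 : ∀ σ : Equiv.Perm ι, HasDerivAt (fun h => ((σ.sign : ℤ) : ℝ) * ∏ i, F h (σ i) i)
      (((σ.sign : ℤ) : ℝ) * ∑ i, (∏ j ∈ Finset.univ.erase i, F a (σ j) j) • F' (σ i) i) a :=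
    fun σ => (HasDerivAt.fun_finsetProd fun i _ => hF (σ i) i).const_mul _
  refine (HasDerivAt.fun_sum fun σ _ => h1 σ).congr_deriv ?_
  simp only [Finset.mul_sum]
  rw [Finset.sum_comm, Matrix.trace]
  refine Finset.sum_congr rfl fun i _ => ?_
  have h2 : ((F a).adjugate * F').diag i = ((F a).updateCol i fun k => F' k i).det := by
    rw [← Matrix.cramer_apply, Matrix.cramer_eq_adjugate_mulVec]
    rfl
  rw [h2, Matrix.det_apply']
  refine Finset.sum_congr rfl fun σ _ => ?_
  rw [← Finset.mul_prod_erase _ _ (Finset.mem_univ i), Matrix.updateCol_self, smul_eq_mul,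
    mul_comm (F' (σ i) i)]
  congr 2
  refine Finset.prod_congr rfl fun j hj => ?_
  rw [Matrix.updateCol_ne (Finset.ne_of_mem_erase hj)]

lemma deriv_log_det (hF : ∀ i j, HasDerivAt (fun h => F h i j) (F' i j) a)
    (h0 : (F a).det ≠ 0) :
    deriv (fun h => Real.log (F h).det) a = ((F a)⁻¹ * F').trace := by
  rw [((hasDerivAt_det hF).log h0).deriv, Matrix.inv_def, Ring.inverse_eq_inv', Matrix.smul_mul,
    Matrix.trace_smul, smul_eq_mul, div_eq_inv_mul]

lemma differentiableAt_inv_apply (hF : ∀ i j, HasDerivAt (fun h => F h i j) (F' i j) a)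
    (h0 : (F a).det ≠ 0) (i j : ι) : DifferentiableAt ℝ (fun h => (F h)⁻¹ i j) a := by
  have hadj : DifferentiableAt ℝ (fun h => (F h).adjugate i j) a := by
    simp only [Matrix.adjugate_apply]
    refine (hasDerivAt_det (F := fun h => (F h).updateRow j (Pi.single i 1))
      (F' := F'.updateRow j 0) fun k l => ?_).differentiableAt
    by_cases hk : k = j
    · subst hk
      simpa using hasDerivAt_const a (Pi.single (M := fun _ => ℝ) i 1 l)
    · simpa [Matrix.updateRow_ne hk] using hF k l
  simp only [Matrix.inv_def, Ring.inverse_eq_inv', Matrix.smul_apply, smul_eq_mul]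
  exact ((hasDerivAt_det hF).differentiableAt.inv h0).mul hadj

lemma deriv_inv_apply (hF : ∀ i j, HasDerivAt (fun h => F h i j) (F' i j) a)
    (h0 : (F a).det ≠ 0) :
    (fun i j => deriv (fun h => (F h)⁻¹ i j) a : Matrix ι ι ℝ) = -((F a)⁻¹ * F' * (F a)⁻¹) := by
  set E : Matrix ι ι ℝ := fun i j => deriv (fun h => (F h)⁻¹ i j) a with hE
  have hE' : ∀ i j, HasDerivAt (fun h => (F h)⁻¹ i j) (E i j) a :=
    fun i j => (differentiableAt_inv_apply hF h0 i j).hasDerivAt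
  have hev : ∀ᶠ h in 𝓝 a, (F h).det ≠ 0 :=
    (hasDerivAt_det hF).continuousAt.eventually_ne h0
  have key : F' * (F a)⁻¹ + F a * E = 0 := by
    ext i j
    have h1 : HasDerivAt (fun h => (F h * (F h)⁻¹) i j)
        ((F' * (F a)⁻¹ + F a * E) i j) a := by
      simp only [Matrix.mul_apply, Matrix.add_apply, ← Finset.sum_add_distrib]
      exact HasDerivAt.fun_sum fun k _ => (hF i k).fun_mul (hE' k j)
    have h2 : (fun h => (F h * (F h)⁻¹) i j) =ᶠ[𝓝 a] fun _ => (1 : Matrix ι ι ℝ) i j := by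
      filter_upwards [hev] with h hh
      rw [Matrix.mul_nonsing_inv _ (isUnit_iff_ne_zero.2 hh)]
    exact h1.unique ((hasDerivAt_const a _).congr_of_eventuallyEq h2)
  have hu : IsUnit (F a).det := isUnit_iff_ne_zero.2 h0
  calc E = (F a)⁻¹ * (F a * E) := by rw [← Matrix.mul_assoc, Matrix.nonsing_inv_mul _ hu, one_mul]
    _ = -((F a)⁻¹ * F' * (F a)⁻¹) := by
        rw [eq_neg_of_add_eq_zero_right key, Matrix.mul_neg, Matrix.mul_assoc]

end MatrixCalculus

section Assembly

lemma qForm_linear {n : ℕ} (a b : ℝ) (M N : Matrix (Fin n) (Fin n) ℝ) (x : Fin n → ℝ) :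
    qForm (a • M + b • N) x = a * qForm M x + b * qForm N x := by
  simp only [qForm_eq_dotProduct, Matrix.add_mulVec, Matrix.smul_mulVec, dotProduct_add,
    dotProduct_smul, smul_eq_mul]

lemma continuous_qForm {n : ℕ} (M : Matrix (Fin n) (Fin n) ℝ) : Continuous (qForm M) := by
  unfold qForm; fun_prop

lemma measurable_Astat (n : ℕ) (Δ H σ : ℝ) : Measurable (Astat n Δ H σ) := by
  have := continuous_qForm (fgnT n H)⁻¹
  have h : Continuous (Astat n Δ H σ) := by unfold Astat Cstat; fun_prop
  exact h.measurable

lemma measurable_Bstat (n : ℕ) (Δ H σ : ℝ) : Measurable (Bstat n Δ H σ) := by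
  have := continuous_qForm (dInvT n H)
  have h : Continuous (Bstat n Δ H σ) := by unfold Bstat; fun_prop
  exact h.measurable

variable {H : ℝ} (hH : H ∈ Set.Ioo (0 : ℝ) 1)
include hH

/-- In coordinates diagonalizing the covariance and its derivative simultaneously, linear
combinations of the score components are sums of centered squares. -/
lemma score_eq_sum {n : ℕ} {Δ σ : ℝ} (hσ : 0 < σ) (hΔ : 0 < Δ) (a b : ℝ)
    {G : Matrix (Fin n) (Fin n) ℝ} {m : Fin n → ℝ} (hG : Gᵀ * toep n (symF H) * G = 1)
    (hGm : Gᵀ * toep n (fun l => (a + -(b / 2) * symG H l) * symF H l) * G = Matrix.diagonal m)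
    (x : Fin n → ℝ) :
    a * Astat n Δ H σ x + b * Bstat n Δ H σ x
      = ∑ k, m k / √n *
        ((((√(σ ^ 2 * Δ ^ (2 * H)))⁻¹ • G)ᵀ *ᵥ x) k ^ 2 - 1) := by
  have hf := isAdmissibleSymbol_symF hH
  have hfi := hf.int
  have hgi : Integrable (fun l => symG H l * symF H l) halfCircle := by
    have hm := measurable_symG hH
    refine hf.integrable_mul_of_rpow hm (hf.integrable_rpow_mul_of_sq hm ?_ hm (a := 0) (b := 1)
      (c := 0) zero_le_one fun l => by simp)
    simpa using integrable_sq_mul_symF_rpow hH 0 1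
  set κ := σ ^ 2 * Δ ^ (2 * H) with hκ
  have hκ0 : 0 < κ := by positivity
  set T := toep n (symF H) with hT
  set T' := toep n (fun l => symG H l * symF H l) with hT'
  have hTe : fgnT n H = T := fgnT_eq_toep_symF hH n
  have hdet : (fgnT n H).det ≠ 0 := by
    rw [hTe]; exact (hf.posDef n).det_pos.ne'
  have hdInv : dInvT n H = -(T⁻¹ * T' * T⁻¹) := by
    rw [← hTe]; exact deriv_inv_apply (hasDerivAt_fgnT hH n) hdet
  have hlog : deriv (fun h : ℝ => Real.log (fgnT n h).det) H = (T⁻¹ * T').trace := by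
    rw [← hTe]; exact deriv_log_det (hasDerivAt_fgnT hH n) hdet
  have hD : toep n (fun l => (a + -(b / 2) * symG H l) * symF H l) = a • T + (-(b / 2)) • T' := by
    rw [← toep_const_mul, ← toep_const_mul, ← toep_add n (hfi.const_mul _) (hgi.const_mul _)]
    congr 1
    ext l
    ring
  have hTT : T⁻¹ * T = 1 := Matrix.nonsing_inv_mul _ (isUnit_iff_ne_zero.2 (hTe ▸ hdet))
  have hinv := inv_eq_mul_transpose_of_congr_one hG
  have hGD : G * Matrix.diagonal m * Gᵀ = a • T⁻¹ + (b / 2) • dInvT n H := by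
    calc G * Matrix.diagonal m * Gᵀ = (G * Gᵀ) * (a • T + (-(b / 2)) • T') * (G * Gᵀ) := by
          rw [← hGm, hD]; simp only [Matrix.mul_assoc]
      _ = _ := by
          rw [← hinv, hdInv]
          simp only [Matrix.mul_add, Matrix.add_mul, Matrix.mul_smul, Matrix.smul_mul, hTT, one_mul,
            smul_neg, neg_smul, Matrix.mul_neg, Matrix.neg_mul]
  have htr : ∑ k, m k = a * n - b / 2 * (T⁻¹ * T').trace := by
    rw [← Matrix.trace_diagonal, ← hGm, hD, ← trace_inv_mul_eq hG, Matrix.mul_add, Matrix.mul_smul,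
      Matrix.mul_smul, hTT, Matrix.trace_add, Matrix.trace_smul, Matrix.trace_smul, Matrix.trace_one]
    simp only [Fintype.card_fin, smul_eq_mul]
    ring
  have hq : ∑ k, m k * (Gᵀ *ᵥ x) k ^ 2 = a * qForm T⁻¹ x + b / 2 * qForm (dInvT n H) x := by
    rw [← qForm_diagonal, ← qForm_mul_mul_transpose, hGD, qForm_linear]
  have hR : ∑ k, m k / √n * ((((√κ)⁻¹ • G)ᵀ *ᵥ x) k ^ 2 - 1)
      = (√n)⁻¹ * (κ⁻¹ * ∑ k, m k * (Gᵀ *ᵥ x) k ^ 2 - ∑ k, m k) := by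
    rw [Finset.mul_sum, ← Finset.sum_sub_distrib, Finset.mul_sum]
    refine Finset.sum_congr rfl fun k _ => ?_
    rw [Matrix.transpose_smul, Matrix.smul_mulVec, Pi.smul_apply, smul_eq_mul, mul_pow, inv_pow,
      Real.sq_sqrt hκ0.le]
    ring
  rw [hR, hq, htr, Astat, Cstat, Bstat, hlog, hTe, mul_assoc (n : ℝ), mul_assoc (2 : ℝ), ← hκ]
  rcases Nat.eq_zero_or_pos n with hn | hn
  · subst hn; simp
  · have hn' : (0 : ℝ) < n := by exact_mod_cast hn
    have hs : 0 < √(n : ℝ) := Real.sqrt_pos.2 hn'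
    have hs2 : (n : ℝ) = √(n : ℝ) ^ 2 := (Real.sq_sqrt hn'.le).symm
    generalize √(n : ℝ) = s at hs hs2 ⊢
    rw [hs2]
    field_simp
    ring

lemma qForm_Jmat (t : Fin 2 → ℝ) :
    qForm (Jmat H) t
      = 2 * (Real.pi⁻¹ * ∫ l, (t 0 + -(t 1 / 2) * symG H l) ^ 2 ∂halfCircle) := by
  have h1 := integrable_symG hH
  have h2 := integrable_symG_sq hH
  have e : ∀ l, (t 0 + -(t 1 / 2) * symG H l) ^ 2
      = t 0 ^ 2 + -(t 0 * t 1) * symG H l + t 1 ^ 2 / 4 * symG H l ^ 2 := fun l => by ring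
  have e1 : ∫ _, t 0 ^ 2 ∂halfCircle = Real.pi * t 0 ^ 2 := by
    rw [halfCircle, integral_const]
    simp [Measure.real, Real.pi_pos.le]
  have := Real.pi_pos
  simp only [e]
  have h3 : ∫ l, (t 0 ^ 2 + -(t 0 * t 1) * symG H l + t 1 ^ 2 / 4 * symG H l ^ 2) ∂halfCircle
      = Real.pi * t 0 ^ 2 + -(t 0 * t 1) * ∫ l, symG H l ∂halfCircle
        + t 1 ^ 2 / 4 * ∫ l, symG H l ^ 2 ∂halfCircle := by
    rw [integral_add (f := fun l => t 0 ^ 2 + -(t 0 * t 1) * symG H l)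
      ((integrable_const _).add (h1.const_mul _)) (h2.const_mul _),
      integral_add (integrable_const _) (h1.const_mul _), e1, integral_const_mul,
      integral_const_mul]
  rw [h3]
  simp only [qForm, Fin.sum_univ_two, Jmat, jH_eq hH, eH_eq hH, Matrix.of_apply, Matrix.cons_val_zero,
    Matrix.cons_val_one, Matrix.cons_val']
  field_simp
  ring

end Assembly

/-- **Joint CLT for the score components `(A_n, B_n)`.** Under `P^n_{(H,σ)}` (any sampling
steps `Δ_n > 0`), `(A_n, B_n)` converges in law to a centered Gaussian vector with
covariance `J(H) = [[2, j_H], [j_H, e_H]]`. -/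
theorem clt_score_components (H σ : ℝ) (hH : H ∈ Set.Ioo (0 : ℝ) 1) (hσ : 0 < σ)
    (Δ : ℕ → ℝ) (hΔ : ∀ n, 0 < Δ n) :
    TendstoInLawGaussian
      (fun n => (fgnP n (Δ n) H σ).map
        (fun x => ![Astat n (Δ n) H σ x, Bstat n (Δ n) H σ x]))
      (Jmat H) := by
  intro t
  have hf := isAdmissibleSymbol_symF hH
  have hmA := fun n => measurable_Astat n (Δ n) H σ
  have hmB := fun n => measurable_Bstat n (Δ n) H σ
  have hhm : Measurable fun l => t 0 + -(t 1 / 2) * symG H l := by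
    have := measurable_symG hH
    fun_prop
  have hhi := integrable_sq_mul_symF_rpow hH (t 0) (-(t 1 / 2))
  choose G m hG hGm using fun n => exists_simultaneous_diagonalization (hf.posDef n)
    (toep_transpose n fun l => (t 0 + -(t 1 / 2) * symG H l) * symF H l)
  have key := tendstoInLaw_quadratic
    (S := fun n => (σ ^ 2 * Δ n ^ (2 * H)) • fgnT n H)
    (G := fun n => (√(σ ^ 2 * Δ n ^ (2 * H)))⁻¹ • G n)
    (fun n => by
      have := hΔ n
      have hκ : 0 < σ ^ 2 * Δ n ^ (2 * H) := by positivity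
      rw [fgnT_eq_toep_symF hH, Matrix.transpose_smul, Matrix.smul_mul, Matrix.mul_smul,
        Matrix.smul_mul, Matrix.mul_smul, Matrix.smul_mul, hG, smul_smul, smul_smul]
      convert one_smul ℝ _
      have hs := Real.sqrt_pos.2 hκ
      have hs2 := Real.sq_sqrt hκ.le
      generalize √(σ ^ 2 * Δ n ^ (2 * H)) = s at hs hs2 ⊢
      rw [← hs2]
      field_simp)
    (X := fun n x => t 0 * Astat n (Δ n) H σ x + t 1 * Bstat n (Δ n) H σ x)
    (fun n => ((hmA n).const_mul _).add ((hmB n).const_mul _))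
    (fun n x => score_eq_sum hH hσ (hΔ n) (t 0) (t 1) (hG n) (hGm n) x)
    (hf.tendsto_sum_sq hhm hhi hG hGm)
    (fun ε hε => hf.eventually_abs_le hhm hhi hG hGm hε)
  rw [← qForm_Jmat hH] at key
  convert key using 2 with n
  rw [Measure.map_map (by fun_prop) (measurable_pi_iff.2 fun i => by
    fin_cases i
    · exact hmA n
    · exact hmB n), fgnP]
  congr 1
  ext x
  simp [Fin.sum_univ_two]
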